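/- Let K belong to the class R₁ (the members of R with exactly one singular vertex) and let t be its singular vertex, with |lk(t,K)| a connected sum of h copies of tori or of Klein bottles (h ≥ 1). Then f₁(K) ≥ 4·f₀(K) + 6h; equivalently, g₂(K) ≥ 10 + 6h. -/

import Mathlib

/-- An abstract simplicial complex on vertex set `ℕ`: a finite, downward closed
collection of nonempty finite sets of vertices. -/
structure SComplex where
  faces : Finset (Finset ℕ)
  not_empty_mem : ∅ ∉ faces
  down_closed : ∀ s ∈ faces, ∀ t ⊆ s, t ≠ ∅ → t ∈ faces

namespace SComplex

/-- The set of vertices of the complex. -/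
def vertexSet (K : SComplex) : Finset ℕ := K.faces.sup id

/-- `fnum K i` is the number of `i`-dimensional faces of `K`. -/
def fnum (K : SComplex) (i : ℕ) : ℕ := (K.faces.filter fun s => s.card = i + 1).card

/-- `g₂` for a 3-dimensional complex: `f₁ - 4 f₀ + 10`. -/
def g2 (K : SComplex) : ℤ := (K.fnum 1 : ℤ) - 4 * (K.fnum 0 : ℤ) + 10

/-- `g₂` for a 2-dimensional complex: `f₁ - 3 f₀ + 6`. -/
def g2surf (K : SComplex) : ℤ := (K.fnum 1 : ℤ) - 3 * (K.fnum 0 : ℤ) + 6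

/-- Euler characteristic of a (2-dimensional) complex. -/
def euler (K : SComplex) : ℤ := (K.fnum 0 : ℤ) - (K.fnum 1 : ℤ) + (K.fnum 2 : ℤ)

/-- The link of a face `σ`. -/
def lk (K : SComplex) (σ : Finset ℕ) : SComplex where
  faces := K.faces.filter fun γ => γ ∩ σ = ∅ ∧ γ ∪ σ ∈ K.faces
  not_empty_mem := fun h => K.not_empty_mem (Finset.mem_filter.mp h).1
  down_closed := by
    intro s hs t hts ht
    rw [Finset.mem_filter] at hs ⊢
    refine ⟨K.down_closed s hs.1 t hts ht, ?_, ?_⟩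
    · have h1 : t ∩ σ ⊆ s ∩ σ := Finset.inter_subset_inter hts (Finset.Subset.refl σ)
      rw [hs.2.1] at h1
      exact Finset.subset_empty.mp h1
    · refine K.down_closed (s ∪ σ) hs.2.2 (t ∪ σ)
        (Finset.union_subset_union hts (Finset.Subset.refl σ)) ?_
      intro hc
      exact ht (Finset.union_eq_empty.mp hc).1

/-- The (closed) star of a face `σ`. -/
def st (K : SComplex) (σ : Finset ℕ) : SComplex where
  faces := K.faces.filter fun α => α ∪ σ ∈ K.faces
  not_empty_mem := fun h => K.not_empty_mem (Finset.mem_filter.mp h).1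
  down_closed := by
    intro s hs t hts ht
    rw [Finset.mem_filter] at hs ⊢
    refine ⟨K.down_closed s hs.1 t hts ht, ?_⟩
    refine K.down_closed (s ∪ σ) hs.2 (t ∪ σ)
      (Finset.union_subset_union hts (Finset.Subset.refl σ)) ?_
    intro hc
    exact ht (Finset.union_eq_empty.mp hc).1

/-- A facet is a maximal face. -/
def IsFacet (K : SComplex) (s : Finset ℕ) : Prop :=
  s ∈ K.faces ∧ ∀ t ∈ K.faces, s ⊆ t → s = t

/-- A pure `d`-dimensional complex: all facets have `d+1` vertices. -/
def IsPure (K : SComplex) (d : ℕ) : Prop :=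
  K.faces.Nonempty ∧ ∀ s, K.IsFacet s → s.card = d + 1

/-- Two facets are adjacent if they share a codimension-one face. -/
def FacetAdj (K : SComplex) (s t : Finset ℕ) : Prop :=
  K.IsFacet s ∧ K.IsFacet t ∧ (s ∩ t).card + 1 = s.card

/-- Strong connectedness: any two facets are joined by a chain of facets, consecutive
ones sharing a codimension-one face. -/
def StronglyConnected (K : SComplex) : Prop :=
  ∀ s t, K.IsFacet s → K.IsFacet t → Relation.ReflTransGen K.FacetAdj s t

/-- Two vertices are adjacent if they span an edge. -/
def VertAdj (K : SComplex) (u v : ℕ) : Prop := ({u, v} : Finset ℕ) ∈ K.faces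

/-- Connectedness of a complex (via its 1-skeleton). -/
def Conn (K : SComplex) : Prop :=
  K.faces.Nonempty ∧
    ∀ u v, {u} ∈ K.faces → {v} ∈ K.faces → Relation.ReflTransGen K.VertAdj u v

/-- A normal `d`-pseudomanifold: pure, strongly connected, every `(d-1)`-face is in
exactly two facets, and links of faces of dimension at most `d-2` are connected. -/
def IsNormalPseudomanifold (K : SComplex) (d : ℕ) : Prop :=
  K.IsPure d ∧ K.StronglyConnected ∧
    (∀ s ∈ K.faces, s.card = d →
      (K.faces.filter fun F => F.card = d + 1 ∧ s ⊆ F).card = 2) ∧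
    (∀ s ∈ K.faces, s.card ≤ d - 1 → (K.lk s).Conn)

/-- The geometric realization `|K|`, as a subspace of `ℕ → ℝ`. -/
def realSpace (K : SComplex) : Set (ℕ → ℝ) :=
  {w | (∀ v, 0 ≤ w v) ∧ ∃ s ∈ K.faces, (∀ v, w v ≠ 0 → v ∈ s) ∧ ∑ v ∈ s, w v = 1}

/-- The link of the vertex `v` triangulates the `(d-1)`-sphere. -/
def HasSphereLink (K : SComplex) (d : ℕ) (v : ℕ) : Prop :=
  Nonempty (↥((K.lk {v}).realSpace) ≃ₜ
    ↥(Metric.sphere (0 : EuclideanSpace ℝ (Fin d)) 1))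

/-- A singular vertex of a normal 3-pseudomanifold: its link is not a 2-sphere. -/
def IsSingular (K : SComplex) (v : ℕ) : Prop :=
  {v} ∈ K.faces ∧ ¬ K.HasSphereLink 3 v

/-- `d(σ)`: the number of vertices of the link of `σ`. -/
def deg (K : SComplex) (σ : Finset ℕ) : ℕ := (K.lk σ).fnum 0

/-- The boundary complex of the simplex on vertex set `s`: all nonempty proper subsets. -/
def properFaces (s : Finset ℕ) : Finset (Finset ℕ) :=
  s.powerset.filter fun t => t ≠ ∅ ∧ t ≠ s

/-- All nonempty faces of the simplex on vertex set `s`. -/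
def simplexFaces (s : Finset ℕ) : Finset (Finset ℕ) :=
  s.powerset.filter fun t => t ≠ ∅

/-- Operation (A): a bistellar 2-move on an edge `uv` with `lk(uv) = ∂(abc)`, `abc ∉ K`. -/
def BistellarTwoMove (K K' : SComplex) : Prop :=
  ∃ u v a b c : ℕ,
    ({u, v} : Finset ℕ) ∈ K.faces ∧ u ≠ v ∧
    ({a, b, c} : Finset ℕ).card = 3 ∧
    u ∉ ({a, b, c} : Finset ℕ) ∧ v ∉ ({a, b, c} : Finset ℕ) ∧
    (K.lk {u, v}).faces = properFaces {a, b, c} ∧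
    ({a, b, c} : Finset ℕ) ∉ K.faces ∧
    K'.faces = ((K.faces.filter fun α => ¬ ({u, v} : Finset ℕ) ⊆ α) ∪
      simplexFaces (insert u {a, b, c})) ∪ simplexFaces (insert v {a, b, c})

/-- The faces of the boundary complex of a pure `d`-dimensional complex with face set `F`:
faces contained in some `(d-1)`-face lying in exactly one facet. -/
def bdryFaces (F : Finset (Finset ℕ)) (d : ℕ) : Finset (Finset ℕ) :=
  F.filter fun s => ∃ r ∈ F, s ⊆ r ∧ r.card = d ∧
    (F.filter fun t => t.card = d + 1 ∧ r ⊆ t).card = 1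

/-- The faces of the cone with apex `w` over the complex with face set `F`. -/
def coneFaces (w : ℕ) (F : Finset (Finset ℕ)) : Finset (Finset ℕ) :=
  (F ∪ F.image (insert w)) ∪ {{w}}

/-- `K₁` is obtained from the normal `d`-pseudomanifold `K` by contracting the
edge `uv` (satisfying the link condition): delete all faces containing `u` or `v`
and cone off the boundary of the result with a new vertex `w`. -/
def EdgeContractionAt (d : ℕ) (K : SComplex) (u v : ℕ) (K₁ : SComplex) : Prop :=
  ({u, v} : Finset ℕ) ∈ K.faces ∧ u ≠ v ∧
  (K.lk {u}).faces ∩ (K.lk {v}).faces = (K.lk {u, v}).faces ∧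
  ∃ w, w ∉ K.vertexSet ∧
    K₁.faces = (K.faces.filter fun α => u ∉ α ∧ v ∉ α) ∪
      coneFaces w (bdryFaces (K.faces.filter fun α => u ∉ α ∧ v ∉ α) d)

/-- Operation (B): an edge contraction in a 3-dimensional complex. -/
def EdgeContraction (K K₁ : SComplex) : Prop := ∃ u v, EdgeContractionAt 3 K u v K₁

/-- The class `R`: normal 3-pseudomanifolds with one or two singular vertices such that
(i) if `K` contains the boundary of a 3-simplex then it contains the 3-simplex and
(ii) no normal 3-pseudomanifold with smaller `g₂` is obtained from `K` by a
bistellar 2-move, an edge contraction, an edge expansion followed by a bistellar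
2-move, or an edge expansion followed by an edge contraction. -/
def InClassR (K : SComplex) : Prop :=
  K.IsNormalPseudomanifold 3 ∧
  1 ≤ {v | K.IsSingular v}.ncard ∧ {v | K.IsSingular v}.ncard ≤ 2 ∧
  (∀ s : Finset ℕ, s.card = 4 → (∀ t ∈ properFaces s, t ∈ K.faces) → s ∈ K.faces) ∧
  (∀ K' : SComplex, K'.IsNormalPseudomanifold 3 →
    (BistellarTwoMove K K' ∨ EdgeContraction K K' ∨
      (∃ M, EdgeContraction M K ∧ BistellarTwoMove M K') ∨
      (∃ M, EdgeContraction M K ∧ EdgeContraction M K')) →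
    K.g2 ≤ K'.g2)

end SComplex


namespace SComplex

/-- Combinatorial data extracted from the complex. -/
structure Comb (t : ℕ) (V : Finset ℕ) (N : ℕ → Finset ℕ) (D : ℕ → ℕ → Finset ℕ) (h : ℕ) :
    Prop where
  tV : t ∈ V
  NV : ∀ x y, y ∈ N x → x ∈ V
  Nne : ∀ x ∈ V, (N x).Nonempty
  Nsymm : ∀ x y, y ∈ N x → x ∈ N y
  Nirr : ∀ x, x ∉ N x
  Dsub : ∀ x y z, z ∈ D x y → z ∈ N x
  Dsw : ∀ x y z, z ∈ D x y → z ∈ D y x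
  Drot : ∀ x y z, z ∈ D x y → y ∈ D x z
  A1 : ∀ x y, y ∈ N x → 4 ≤ (D x y).card
  A2 : ∀ x y c, x ≠ t → c ∈ D x y → (D x c ∩ D x y).card = 2
  A3 : ∀ x y, y ∈ N x → ∃ z, z ∈ N x ∧ z ∈ N y ∧ z ∉ D x y
  A4 : ∀ c x y z, c ≠ t → c ∈ D x y → c ∈ D y z → c ∈ D x z → z ∈ D x y
  A5 : ∀ (x : ℕ) (S : Finset ℕ), S ⊆ N x → S.Nonempty → (∀ z ∈ S, D x z ⊆ S) → N x ⊆ S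
  A6 : ∀ (x y : ℕ) (S : Finset ℕ), S ⊆ D x y → S.Nonempty →
    (∀ z ∈ S, D x z ∩ D x y ⊆ S) → D x y ⊆ S
  A7 : ∑ v ∈ N t, (D t v).card + 12 = 6 * (N t).card + 12 * h
  A8 : ∀ x, 6 ∣ ∑ y ∈ N x, (D x y).card

/-- Non-neighbours of `y` in the link of `x`. -/
def EE (N : ℕ → Finset ℕ) (D : ℕ → ℕ → Finset ℕ) (x y : ℕ) : Finset ℕ :=
  N x \ insert y (D x y)

namespace Comb

variable {t : ℕ} {V : Finset ℕ} {N : ℕ → Finset ℕ} {D : ℕ → ℕ → Finset ℕ} {h : ℕ}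

theorem memE {x y z : ℕ} : z ∈ EE N D x y ↔ z ∈ N x ∧ z ≠ y ∧ z ∉ D x y := by
  simp [EE]

theorem Dy (C : Comb t V N D h) {x y z : ℕ} (hz : z ∈ D x y) : y ∈ N x :=
  C.Dsub _ _ _ (C.Drot _ _ _ hz)

theorem Dz2 (C : Comb t V N D h) {x y z : ℕ} (hz : z ∈ D x y) : z ∈ N y :=
  C.Dsub _ _ _ (C.Dsw _ _ _ hz)

theorem Dcomm (C : Comb t V N D h) (x y : ℕ) : D x y = D y x := by
  ext z; exact ⟨C.Dsw _ _ _, C.Dsw _ _ _⟩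

theorem Dself (C : Comb t V N D h) (x y : ℕ) : y ∉ D x y := fun hy => C.Nirr _ (C.Dz2 hy)

theorem cardE (C : Comb t V N D h) {x y : ℕ} (hy : y ∈ N x) :
    (EE N D x y).card + (D x y).card + 1 = (N x).card := by
  have h1 : insert y (D x y) ⊆ N x := by
    intro z hz
    rcases Finset.mem_insert.1 hz with rfl | hz
    · exact hy
    · exact C.Dsub _ _ _ hz
  have h2 := Finset.card_sdiff_add_card_eq_card h1
  rw [Finset.card_insert_of_notMem (C.Dself x y)] at h2
  unfold EE; omega

theorem Enb (C : Comb t V N D h) {x y : ℕ} (hy : y ∈ N x) :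
    ∃ z ∈ EE N D x y, z ∈ N y := by
  obtain ⟨z, h1, h2, h3⟩ := C.A3 x y hy
  refine ⟨z, memE.2 ⟨h1, ?_, h3⟩, h2⟩
  rintro rfl; exact C.Nirr _ h2

theorem Epos (C : Comb t V N D h) {x y : ℕ} (hy : y ∈ N x) : 1 ≤ (EE N D x y).card := by
  obtain ⟨z, hz, _⟩ := C.Enb hy
  exact Finset.card_pos.2 ⟨z, hz⟩

theorem d6 (C : Comb t V N D h) {x : ℕ} (hx : x ∈ V) : 6 ≤ (N x).card := by
  obtain ⟨y, hy⟩ := C.Nne x hx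
  have := C.cardE hy
  have := C.Epos hy
  have := C.A1 _ _ hy
  omega

theorem Esymm (C : Comb t V N D h) {x y z : ℕ} (hy : y ∈ N x) (hz : z ∈ EE N D x y) :
    y ∈ EE N D x z := by
  rw [memE] at hz ⊢
  exact ⟨hy, hz.2.1.symm, fun hh => hz.2.2 (C.Drot _ _ _ hh)⟩

theorem E1' (C : Comb t V N D h) {x y q : ℕ} (hx : x ≠ t) (hq : q ∈ N x)
    (hs : D x q ⊆ D x y) : D x q = D x y := by
  refine Finset.Subset.antisymm hs (C.A6 x y _ hs ?_ ?_)
  · have := C.A1 _ _ hq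
    exact Finset.card_pos.1 (by omega)
  · intro z hz
    have h1 := C.A2 x q z hx hz
    have h2 := C.A2 x y z hx (hs hz)
    have h3 : D x z ∩ D x q ⊆ D x z ∩ D x y := Finset.inter_subset_inter (le_refl _) hs
    have h4 := Finset.eq_of_subset_of_card_le h3 (by omega)
    rw [← h4]; exact Finset.inter_subset_right

theorem E2a (C : Comb t V N D h) {x y q : ℕ} (hx : x ≠ t) (hy : y ∈ N x) (hq : q ∈ N x)
    (hyq : q ≠ y) (hs : D x q = D x y) : EE N D x y = {q} := by
  have hqD : q ∉ D x y := by rw [← hs]; exact C.Dself x q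
  have key : N x ⊆ insert y (insert q (D x y)) := by
    refine C.A5 x _ ?_ ⟨y, by simp⟩ ?_
    · intro z hz
      simp only [Finset.mem_insert] at hz
      rcases hz with rfl | rfl | hz
      · exact hy
      · exact hq
      · exact C.Dsub _ _ _ hz
    · intro z hz
      simp only [Finset.mem_insert] at hz
      rcases hz with rfl | rfl | hz
      · intro w hw; simp [hw]
      · intro w hw; rw [hs] at hw; simp [hw]
      · have hzq : z ∈ D x q := by rw [hs]; exact hz
        have := C.A6 x z (insert y (insert q (D x z ∩ D x y))) ?_ ⟨y, by simp⟩ ?_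
        · intro w hw
          have := this hw
          simp only [Finset.mem_insert, Finset.mem_inter] at this ⊢
          tauto
        · intro w hw
          simp only [Finset.mem_insert, Finset.mem_inter] at hw
          rcases hw with rfl | rfl | hw
          · exact C.Drot _ _ _ hz
          · exact C.Drot _ _ _ hzq
          · exact hw.1
        · intro w hw
          simp only [Finset.mem_insert, Finset.mem_inter] at hw
          rcases hw with rfl | rfl | hw
          · intro u hu; simp only [Finset.mem_insert, Finset.mem_inter] at hu ⊢; tauto
          · intro u hu; rw [hs] at hu
            simp only [Finset.mem_insert, Finset.mem_inter] at hu ⊢; tauto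
          · have h2 := C.A2 x z w hx hw.1
            have h3 : ({y, q} : Finset ℕ) ⊆ D x w ∩ D x z := by
              intro u hu
              simp only [Finset.mem_insert, Finset.mem_singleton] at hu
              rcases hu with rfl | rfl
              · exact Finset.mem_inter.2 ⟨C.Drot _ _ _ hw.2, C.Drot _ _ _ hz⟩
              · exact Finset.mem_inter.2 ⟨C.Drot _ _ _ (by rw [hs]; exact hw.2), C.Drot _ _ _ hzq⟩
            have h4 := Finset.eq_of_subset_of_card_le h3
              (by rw [h2, Finset.card_pair hyq.symm])
            rw [← h4]
            intro u hu; simp only [Finset.mem_insert, Finset.mem_singleton] at hu ⊢; tauto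
  ext z
  rw [memE, Finset.mem_singleton]
  constructor
  · rintro ⟨h1, h2, h3⟩
    have := key h1
    simp only [Finset.mem_insert] at this
    tauto
  · rintro rfl; exact ⟨hq, hyq, hqD⟩

theorem E1 (C : Comb t V N D h) {x y q : ℕ} (hx : x ≠ t)
    (hE : EE N D x y = {q}) : D x q = D x y := by
  have hq : q ∈ EE N D x y := by rw [hE]; simp
  have hq' := memE.1 hq
  refine C.E1' hx hq'.1 ?_
  intro z hz
  by_contra hzn
  have : z ∈ EE N D x y := memE.2 ⟨C.Dsub _ _ _ hz, ?_, hzn⟩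
  · rw [hE, Finset.mem_singleton] at this
    subst this; exact C.Dself _ _ hz
  · rintro rfl; exact hq'.2.2 (C.Drot _ _ _ hz)

theorem E2 (C : Comb t V N D h) {x y b : ℕ} (hx : x ≠ t) (hy : y ∈ N x)
    (hb : b ∈ EE N D x y) : EE N D x y = {b} ∨ ∃ z ∈ D x b, z ∈ EE N D x y := by
  by_cases hh : ∃ z ∈ D x b, z ∈ EE N D x y
  · exact Or.inr hh
  · left
    push Not at hh
    have hb' := memE.1 hb
    refine C.E2a hx hy hb'.1 hb'.2.1 (C.E1' hx hb'.1 ?_)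
    intro z hz
    by_contra hzn
    refine hh z hz (memE.2 ⟨C.Dsub _ _ _ hz, ?_, hzn⟩)
    rintro rfl; exact hb'.2.2 (C.Drot _ _ _ hz)

theorem E3 (C : Comb t V N D h) {x y c : ℕ} (hx : x ≠ t) (hc : c ∈ D x y) :
    ∃ z ∈ D x c, z ∈ EE N D x y := by
  have h1 := C.A1 x c (C.Dsub _ _ _ hc)
  have h2 := C.A2 x y c hx hc
  have h3 : ¬ D x c ⊆ insert y (D x c ∩ D x y) := by
    intro hh
    have := Finset.card_le_card hh
    have := Finset.card_insert_le y (D x c ∩ D x y)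
    omega
  obtain ⟨z, hz, hzn⟩ := Finset.not_subset.1 h3
  simp only [Finset.mem_insert, Finset.mem_inter, not_or, not_and] at hzn
  exact ⟨z, hz, memE.2 ⟨C.Dsub _ _ _ hz, hzn.1, hzn.2 hz⟩⟩

/-- Boundary of a vertex set in the link of `x`. -/
def bd (D : ℕ → ℕ → Finset ℕ) (x : ℕ) (S : Finset ℕ) : Finset ℕ := S.biUnion (D x) \ S

theorem mem_bd {x z : ℕ} {S : Finset ℕ} :
    z ∈ bd D x S ↔ (∃ v ∈ S, z ∈ D x v) ∧ z ∉ S := by simp [bd]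

theorem bd2 (C : Comb t V N D h) {x q : ℕ} {S : Finset ℕ} (hS : S ⊆ N x) (hne : S.Nonempty)
    (hq : q ∈ N x) (hqS : q ∉ S) (hqb : q ∉ bd D x S) : 2 ≤ (bd D x S).card := by
  by_contra hlt
  rcases Nat.lt_or_ge 0 (bd D x S).card with h0 | h0
  · obtain ⟨z, hz⟩ := Finset.card_eq_one.1 (by omega : (bd D x S).card = 1)
    have hcl : ∀ v ∈ S, ∀ w ∈ D x v, w ∈ S ∨ w = z := by
      intro v hv w hw
      by_cases hwS : w ∈ S
      · exact Or.inl hwS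
      · right
        have : w ∈ bd D x S := mem_bd.2 ⟨⟨v, hv, hw⟩, hwS⟩
        simpa [hz] using this
    have hzb : z ∈ bd D x S := by simp [hz]
    obtain ⟨⟨v, hv, hzv⟩, hzS⟩ := mem_bd.1 hzb
    have h1 : D x z ⊆ D x z ∩ S := by
      refine C.A6 x z _ Finset.inter_subset_left
        ⟨v, Finset.mem_inter.2 ⟨C.Drot _ _ _ hzv, hv⟩⟩ ?_
      intro w hw u hu
      rw [Finset.mem_inter] at hw hu ⊢
      refine ⟨hu.2, (hcl w hw.2 u hu.1).resolve_right ?_⟩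
      rintro rfl; exact C.Dself _ _ hu.2
    have h2 := C.A5 x (insert z S) ?_ ⟨z, by simp⟩ ?_
    · have := h2 hq
      rcases Finset.mem_insert.1 this with rfl | h
      · exact hqb hzb
      · exact hqS h
    · intro w hw
      rcases Finset.mem_insert.1 hw with rfl | h
      · exact C.Dsub _ _ _ hzv
      · exact hS h
    · intro w hw u hu
      rcases Finset.mem_insert.1 hw with rfl | h
      · exact Finset.mem_insert_of_mem (Finset.mem_inter.1 (h1 hu)).2
      · rcases hcl w h u hu with h | rfl
        · exact Finset.mem_insert_of_mem h
        · simp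
  · have hb : bd D x S = ∅ := Finset.card_eq_zero.1 (by omega)
    refine hqS (C.A5 x S hS hne ?_ hq)
    intro v hv w hw
    by_contra hwS
    have : w ∈ bd D x S := mem_bd.2 ⟨⟨v, hv, hw⟩, hwS⟩
    simp [hb] at this

/-- Properties of an antipodal pair seen from `x`. -/
theorem anti (C : Comb t V N D h) {x b q : ℕ} (hb : b ≠ t) (htb : t ∉ N b) (hx : x ∈ N b)
    (hE : EE N D b x = {q}) :
    q ∈ N x ∧ q ∈ N b ∧ q ∉ D x b ∧ b ≠ q ∧ (∀ c, c ∈ D x b → c ∉ D x q) ∧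
      D b q = D b x ∧ (D b x).card + 6 ≤ (N x).card ∧ 10 ≤ (N q).card := by
  have aux : ∀ {x q : ℕ}, x ∈ N b → EE N D b x = {q} →
      q ∈ N x ∧ q ∈ N b ∧ q ∉ D x b ∧ b ≠ q ∧ (∀ c, c ∈ D x b → c ∉ D x q) ∧
      D b q = D b x ∧ (D b x).card + 6 ≤ (N x).card := by
    intro x q hx hE
    have hq := memE.1 (show q ∈ EE N D b x by rw [hE]; simp)
    obtain ⟨z, hz, hzN⟩ := C.Enb hx
    rw [hE, Finset.mem_singleton] at hz
    subst hz
    have hD := C.E1 hb hE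
    have hdis : ∀ c, c ∈ D x b → c ∉ D x z := by
      intro c h1 h2
      have hct : c ≠ t := by rintro rfl; exact htb (C.Dz2 h1)
      have h3 : c ∈ D b z := by rw [hD]; exact C.Dsw _ _ _ h1
      exact hq.2.2 (C.Dsw _ _ _ (C.A4 c x b z hct h1 h3 h2))
    have hbz : b ≠ z := by rintro rfl; exact C.Nirr _ hq.1
    have hnD : z ∉ D x b := fun hh => hq.2.2 (C.Dsw _ _ _ hh)
    refine ⟨hzN, hq.1, hnD, hbz, hdis, hD, ?_⟩
    have hdj : Disjoint (D x b) (D x z) := Finset.disjoint_left.2 hdis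
    have hsub : insert b (insert z (D x b ∪ D x z)) ⊆ N x := by
      intro w hw
      simp only [Finset.mem_insert, Finset.mem_union] at hw
      rcases hw with rfl | rfl | hw | hw
      · exact C.Nsymm _ _ hx
      · exact hzN
      · exact C.Dsub _ _ _ hw
      · exact C.Dsub _ _ _ hw
    have hc := Finset.card_le_card hsub
    rw [Finset.card_insert_of_notMem, Finset.card_insert_of_notMem,
      Finset.card_union_of_disjoint hdj] at hc
    · have := C.A1 x z hzN
      rw [C.Dcomm b x]; omega
    · simp only [Finset.mem_union, not_or]
      exact ⟨hnD, C.Dself _ _⟩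
    · simp only [Finset.mem_insert, Finset.mem_union, not_or]
      exact ⟨hbz, C.Dself _ _, fun hh => hnD (C.Drot _ _ _ hh)⟩
  obtain ⟨h1, h2, h3, h4, h5, h6, h7⟩ := aux hx hE
  refine ⟨h1, h2, h3, h4, h5, h6, h7, ?_⟩
  have hE' : EE N D b q = {x} := by
    refine C.E2a hb h2 hx ?_ h6.symm
    rintro rfl; exact C.Nirr _ h1
  have := (aux h2 hE').2.2.2.2.2.2
  have := C.A1 _ _ h2
  omega

end Comb
end SComplex


namespace SComplex
namespace Comb

variable {t : ℕ} {V : Finset ℕ} {N : ℕ → Finset ℕ} {D : ℕ → ℕ → Finset ℕ} {h : ℕ}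

/-- Low-degree vertices in the link of `x` which receive charge from `x`. -/
def Low (t : ℕ) (N : ℕ → Finset ℕ) (D : ℕ → ℕ → Finset ℕ) (x : ℕ) : Finset ℕ :=
  (N x).filter fun b => (b ≠ t ∧ t ∉ N b) ∧
    ((N b).card = 6 ∨ ((N b).card = 7 ∧ (D b x).card = 5))

/-- Amount of charge. -/
def wt (N : ℕ → Finset ℕ) (b : ℕ) : ℕ := if (N b).card = 6 then 2 else 3

/-- The total charge paid by `x`. -/
def cost (t : ℕ) (N : ℕ → Finset ℕ) (D : ℕ → ℕ → Finset ℕ) (x : ℕ) : ℕ :=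
  ∑ b ∈ Low t N D x, wt N b

theorem wt_le (b : ℕ) : wt N b ≤ 3 := by unfold wt; split_ifs <;> omega

theorem cost_le (x : ℕ) : cost t N D x ≤ 3 * (Low t N D x).card := by
  unfold cost
  have := Finset.sum_le_card_nsmul (Low t N D x) (wt N) 3 (fun b _ => wt_le b)
  simpa [mul_comm] using this

theorem memLow {x b : ℕ} : b ∈ Low t N D x ↔ b ∈ N x ∧ (b ≠ t ∧ t ∉ N b) ∧
    ((N b).card = 6 ∨ ((N b).card = 7 ∧ (D b x).card = 5)) := by
  simp [Low]

theorem low_anti (C : Comb t V N D h) {x b : ℕ} (hb : b ∈ Low t N D x) :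
    ∃ q, EE N D b x = {q} := by
  obtain ⟨h1, h2, h3⟩ := memLow.1 hb
  have hx := C.Nsymm _ _ h1
  have := C.cardE hx
  have := C.Epos hx
  have := C.A1 _ _ hx
  exact Finset.card_eq_one.1 (by omega)

theorem low_facts (C : Comb t V N D h) {x b q : ℕ} (hb : b ∈ Low t N D x)
    (hE : EE N D b x = {q}) :
    q ∈ N x ∧ q ∈ N b ∧ q ∉ D x b ∧ b ≠ q ∧ (∀ c, c ∈ D x b → c ∉ D x q) ∧
      D b q = D b x ∧ (D b x).card + 6 ≤ (N x).card ∧ q ∉ Low t N D x ∧ q ≠ t := by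
  obtain ⟨h1, h2, h3⟩ := memLow.1 hb
  have hx := C.Nsymm _ _ h1
  obtain ⟨g1, g2, g3, g4, g5, g6, g7, g8⟩ := C.anti h2.1 h2.2 hx hE
  refine ⟨g1, g2, g3, g4, g5, g6, g7, ?_, ?_⟩
  · intro hq
    have := (memLow.1 hq).2.2
    omega
  · rintro rfl; exact h2.2 g2

theorem low_d (C : Comb t V N D h) {x b : ℕ} (hb : b ∈ Low t N D x) : 10 ≤ (N x).card := by
  obtain ⟨q, hq⟩ := C.low_anti hb
  have := (C.low_facts hb hq).2.2.2.2.2.2.1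
  have := C.A1 _ _ (C.Nsymm _ _ (memLow.1 hb).1)
  omega

theorem low_six (C : Comb t V N D h) {b : ℕ} (hb : b ≠ t) (htb : t ∉ N b)
    (h6 : (N b).card = 6) {y : ℕ} (hy : y ∈ N b) : b ∈ Low t N D y ∧ 10 ≤ (N y).card := by
  have h1 : b ∈ Low t N D y := memLow.2 ⟨C.Nsymm _ _ hy, ⟨hb, htb⟩, Or.inl h6⟩
  exact ⟨h1, C.low_d h1⟩

theorem low_adj (C : Comb t V N D h) {x b b' q : ℕ} (hb : b ∈ Low t N D x)
    (hb' : b' ∈ Low t N D x) (hD : b' ∈ D x b) (hE : EE N D b x = {q}) :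
    EE N D b' x = {q} := by
  obtain ⟨g1, g2, g3, g4, g5, g6, g7, g8⟩ := C.low_facts hb hE
  obtain ⟨q', hq'⟩ := C.low_anti hb'
  have h1 : b' ∈ D b q := by rw [g6]; exact C.Dsw _ _ _ hD
  have : q ∈ EE N D b' x := by
    rw [memE]
    refine ⟨C.Nsymm _ _ (C.Dz2 h1), ?_, ?_⟩
    · rintro rfl; exact C.Nirr _ g1
    · intro hh
      exact g5 b' hD (C.Drot _ _ _ (C.Dsw _ _ _ hh))
  rw [hq'] at this ⊢
  rw [Finset.mem_singleton.1 this]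

theorem claimB (C : Comb t V N D h) {x : ℕ} (hx : x ≠ t)
    (hd : 8 ≤ (N x).card) : cost t N D x + 48 ≤ 6 * (N x).card := by
  by_cases hne : (Low t N D x).Nonempty
  swap
  · rw [Finset.not_nonempty_iff_eq_empty] at hne
    simp [cost, hne]; omega
  have hsubN : Low t N D x ⊆ N x := Finset.filter_subset _ _
  have hcost : cost t N D x ≤ 3 * (Low t N D x).card := cost_le x
  by_cases h6 : ∃ b ∈ Low t N D x, (N b).card = 6
  · obtain ⟨b, hb, hb6⟩ := h6
    obtain ⟨q, hq⟩ := C.low_anti hb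
    obtain ⟨g1, g2, g3, g4, g5, g6, g7, g8, g9⟩ := C.low_facts hb hq
    obtain ⟨m1, m2, m3⟩ := memLow.1 hb
    have hsub : Low t N D x ⊆ N x \ insert q (D x b) := by
      intro z hz
      rw [Finset.mem_sdiff]
      refine ⟨hsubN hz, ?_⟩
      rw [Finset.mem_insert]
      rintro (rfl | hzD)
      · exact g8 hz
      · have h1 := (C.low_six m2.1 m2.2 hb6 (C.Dz2 hzD)).2
        have := (memLow.1 hz).2.2
        omega
    have hc := Finset.card_le_card hsub
    have h4 := C.A1 x b m1
    have hins : insert q (D x b) ⊆ N x := by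
      intro z hz
      rcases Finset.mem_insert.1 hz with rfl | hz
      · exact g1
      · exact C.Dsub _ _ _ hz
    rw [Finset.card_sdiff_of_subset hins, Finset.card_insert_of_notMem g3] at hc
    have hd10 := C.low_d hb
    rcases Nat.lt_or_ge 10 (N x).card with h11 | h10
    · omega
    · have h2 : cost t N D x ≤ 2 * (Low t N D x).card := by
        unfold cost
        have := Finset.sum_le_card_nsmul (Low t N D x) (wt N) 2 (by
          intro z hz
          obtain ⟨q', hq'⟩ := C.low_anti hz
          have := (C.low_facts hz hq').2.2.2.2.2.2.1
          have := (memLow.1 hz).2.2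
          unfold wt
          rw [if_pos (by omega)])
        simpa [mul_comm] using this
      omega
  · push Not at h6
    have h7 : ∀ b ∈ Low t N D x, (N b).card = 7 ∧ (D b x).card = 5 := by
      intro b hb
      have := (memLow.1 hb).2.2
      have := h6 b hb
      tauto
    obtain ⟨b, hb⟩ := hne
    obtain ⟨q, hq⟩ := C.low_anti hb
    obtain ⟨g1, g2, g3, g4, g5, g6, g7, g8, g9⟩ := C.low_facts hb hq
    obtain ⟨m1, m2, m3⟩ := memLow.1 hb
    have hb5 : (D x b).card = 5 := by rw [C.Dcomm]; exact (h7 b hb).2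
    by_cases hadj : ∃ b' ∈ D x b, b' ∈ Low t N D x
    · obtain ⟨b', hb'D, hb'⟩ := hadj
      have hq' := C.low_adj hb hb' hb'D hq
      obtain ⟨k1, k2, k3, k4, k5, k6, k7, k8, k9⟩ := C.low_facts hb' hq'
      have hb5' : (D x b').card = 5 := by rw [C.Dcomm]; exact (h7 b' hb').2
      have hi := C.A2 x b b' hx hb'D
      have hu := Finset.card_union_add_card_inter (D x b') (D x b)
      have hdj : Disjoint (D x b' ∪ D x b) (insert q (D x q)) := by
        rw [Finset.disjoint_left]
        intro z hz hz'
        rw [Finset.mem_union] at hz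
        rw [Finset.mem_insert] at hz'
        rcases hz with hz | hz <;> rcases hz' with rfl | hz'
        · exact k3 hz
        · exact k5 z hz hz'
        · exact g3 hz
        · exact g5 z hz hz'
      have hsub : (D x b' ∪ D x b) ∪ (insert q (D x q)) ⊆ N x := by
        intro z hz
        simp only [Finset.mem_union, Finset.mem_insert] at hz
        rcases hz with (hz | hz) | rfl | hz
        · exact C.Dsub _ _ _ hz
        · exact C.Dsub _ _ _ hz
        · exact g1
        · exact C.Dsub _ _ _ hz
      have hc := Finset.card_le_card hsub
      rw [Finset.card_union_of_disjoint hdj, Finset.card_insert_of_notMem (C.Dself _ _)] at hc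
      have h4 := C.A1 x q g1
      -- the component
      set S := (Low t N D x).filter fun c => EE N D c x = {q} with hS
      have hSN : S ⊆ N x := (Finset.filter_subset _ _).trans hsubN
      have hqS : q ∉ S := fun hh => g8 (Finset.mem_filter.1 hh).1
      have hqb : q ∉ bd D x S := by
        intro hh
        obtain ⟨⟨v, hv, hqv⟩, _⟩ := mem_bd.1 hh
        obtain ⟨v1, v2⟩ := Finset.mem_filter.1 hv
        exact (C.low_facts v1 v2).2.2.1 hqv
      have h2 := C.bd2 hSN ⟨b, Finset.mem_filter.2 ⟨hb, hq⟩⟩ g1 hqS hqb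
      have hins : insert q (bd D x S) ⊆ N x := by
        intro z hz
        rcases Finset.mem_insert.1 hz with rfl | hz
        · exact g1
        · obtain ⟨⟨v, hv, hqv⟩, _⟩ := mem_bd.1 hz
          exact C.Dsub _ _ _ hqv
      have hsub2 : Low t N D x ⊆ N x \ insert q (bd D x S) := by
        intro z hz
        rw [Finset.mem_sdiff]
        refine ⟨hsubN hz, ?_⟩
        rw [Finset.mem_insert]
        rintro (rfl | hzD)
        · exact g8 hz
        · obtain ⟨⟨v, hv, hqv⟩, hzS⟩ := mem_bd.1 hzD
          obtain ⟨v1, v2⟩ := Finset.mem_filter.1 hv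
          exact hzS (Finset.mem_filter.2 ⟨hz, C.low_adj v1 hz hqv v2⟩)
      have hc2 := Finset.card_le_card hsub2
      rw [Finset.card_sdiff_of_subset hins, Finset.card_insert_of_notMem hqb] at hc2
      omega
    · push Not at hadj
      have hsub : Low t N D x ⊆ N x \ insert q (D x b) := by
        intro z hz
        rw [Finset.mem_sdiff]
        refine ⟨hsubN hz, ?_⟩
        rw [Finset.mem_insert]
        rintro (rfl | hzD)
        · exact g8 hz
        · exact hadj z hzD hz
      have hc := Finset.card_le_card hsub
      have hins : insert q (D x b) ⊆ N x := by
        intro z hz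
        rcases Finset.mem_insert.1 hz with rfl | hz
        · exact g1
        · exact C.Dsub _ _ _ hz
      rw [Finset.card_sdiff_of_subset hins, Finset.card_insert_of_notMem g3] at hc
      have hd11 := g7
      rw [C.Dcomm b x, hb5] at hd11
      omega

/-- Number of neighbours of `x` in the link of `t` that are opposite. -/
def dG (t : ℕ) (N : ℕ → Finset ℕ) (D : ℕ → ℕ → Finset ℕ) (x : ℕ) : ℕ :=
  (EE N D x t ∩ N t).card

theorem Low_sub (C : Comb t V N D h) {x : ℕ} : Low t N D x ⊆ EE N D x t \ N t := by
  intro b hb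
  obtain ⟨m1, m2, m3⟩ := memLow.1 hb
  rw [Finset.mem_sdiff, memE]
  exact ⟨⟨m1, m2.1, fun hh => m2.2 (C.Nsymm _ _ (C.Dz2 hh))⟩,
    fun hh => m2.2 (C.Nsymm _ _ hh)⟩

theorem Fbound (C : Comb t V N D h) (x : ℕ) :
    cost t N D x + 3 * dG t N D x ≤ 3 * (EE N D x t).card := by
  have h1 := Finset.card_le_card (C.Low_sub (x := x))
  have h2 := Finset.card_sdiff_add_card_inter (EE N D x t) (N t)
  have h3 : cost t N D x ≤ 3 * (Low t N D x).card := cost_le x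
  unfold dG
  omega

theorem dGpos (C : Comb t V N D h) {x : ℕ} (hx : x ∈ N t) : 1 ≤ dG t N D x := by
  obtain ⟨z, hz, hzN⟩ := C.Enb (C.Nsymm _ _ hx)
  exact Finset.card_pos.2 ⟨z, Finset.mem_inter.2 ⟨hz, hzN⟩⟩

theorem dGle (x : ℕ) : dG t N D x ≤ (EE N D x t).card :=
  Finset.card_le_card Finset.inter_subset_left

theorem claimT (C : Comb t V N D h) {x : ℕ} (hx : x ∈ N t) (he : 2 ≤ (EE N D x t).card) :
    cost t N D x + 12 ≤ 6 * (EE N D x t).card := by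
  have hxt : x ≠ t := by rintro rfl; exact C.Nirr _ hx
  have htx := C.Nsymm _ _ hx
  have hF := C.Fbound x
  have hcost : cost t N D x ≤ 3 * (Low t N D x).card := cost_le x
  have hLE : Low t N D x ⊆ EE N D x t := C.Low_sub.trans Finset.sdiff_subset
  rcases Nat.lt_or_ge 3 (EE N D x t).card with h4 | h3
  · omega
  rcases (Low t N D x).eq_empty_or_nonempty with h0 | ⟨b, hb⟩
  · rw [h0] at hcost; simp at hcost; omega
  obtain ⟨q, hq⟩ := C.low_anti hb
  obtain ⟨g1, g2, g3, g4, g5, g6, g7, g8, g9⟩ := C.low_facts hb hq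
  have hbE := hLE hb
  have hns : ∀ z, EE N D x t ≠ {z} := by
    intro z hz; rw [hz] at he; simp at he
  obtain ⟨e2, he2, he2E⟩ := (C.E2 hxt htx hbE).resolve_left (hns b)
  have hbe2 : b ≠ e2 := by rintro rfl; exact C.Dself _ _ he2
  by_cases hqE : q ∈ EE N D x t
  · have hqe2 : e2 ≠ q := by rintro rfl; exact g3 he2
    have h1 : ({b, e2, q} : Finset ℕ) ⊆ EE N D x t := by
      intro z hz; simp only [Finset.mem_insert, Finset.mem_singleton] at hz
      rcases hz with rfl | rfl | rfl <;> assumption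
    have h2 := Finset.card_le_card h1
    rw [Finset.card_eq_three.2 ⟨b, e2, q, hbe2, g4, hqe2, rfl⟩] at h2
    have h5 : Low t N D x ⊆ (EE N D x t).erase q := by
      intro z hz
      rw [Finset.mem_erase]
      refine ⟨?_, hLE hz⟩
      rintro rfl; exact g8 hz
    have h6 := Finset.card_le_card h5
    rw [Finset.card_erase_of_mem hqE] at h6
    omega
  · have hqD : q ∈ D x t := by
      by_contra hh; exact hqE (memE.2 ⟨g1, g9, hh⟩)
    obtain ⟨e3, he3, he3E⟩ := C.E3 hxt hqD
    have hbe3 : b ≠ e3 := by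
      rintro rfl; exact g3 (C.Drot _ _ _ he3)
    have h23 : e2 ≠ e3 := by rintro rfl; exact g5 _ he2 he3
    have h1 : ({b, e2, e3} : Finset ℕ) ⊆ EE N D x t := by
      intro z hz; simp only [Finset.mem_insert, Finset.mem_singleton] at hz
      rcases hz with rfl | rfl | rfl <;> assumption
    have hc3 := Finset.card_eq_three.2 ⟨b, e2, e3, hbe2, hbe3, h23, rfl⟩
    have hEq := Finset.eq_of_subset_of_card_le h1 (by omega)
    by_cases hall : Low t N D x = EE N D x t
    · exfalso
      obtain ⟨z, hz, hzE⟩ := (C.E2 hxt htx he3E).resolve_left (hns e3)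
      rw [← hEq] at hzE
      simp only [Finset.mem_insert, Finset.mem_singleton] at hzE
      rcases hzE with rfl | rfl | rfl
      · exact g5 e3 (C.Drot _ _ _ hz) he3
      · have hl2 : z ∈ Low t N D x := by rw [hall]; exact he2E
        have := C.low_adj hb hl2 he2 hq
        exact (C.low_facts hl2 this).2.2.2.2.1 e3 (C.Drot _ _ _ hz) he3
      · exact C.Dself _ _ hz
    · have := Finset.card_lt_card (Finset.ssubset_iff_subset_ne.2 ⟨hLE, hall⟩)
      rw [hEq] at hc3
      omega

end Comb
end SComplex


namespace SComplex
namespace Comb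

variable {t : ℕ} {V : Finset ℕ} {N : ℕ → Finset ℕ} {D : ℕ → ℕ → Finset ℕ} {h : ℕ}

theorem cnle (s : Finset ℕ) (f : ℕ → ℕ) (n : ℕ) (hf : ∀ x ∈ s, n ≤ f x) :
    s.card • n ≤ ∑ x ∈ s, f x := Finset.card_nsmul_le_sum s f n hf

/-- Scaled final charge of a neighbour of `t`. -/
def FF (t : ℕ) (N : ℕ → Finset ℕ) (D : ℕ → ℕ → Finset ℕ) (x : ℕ) : ℕ :=
  6 * (EE N D x t).card - cost t N D x

theorem FF_add (C : Comb t V N D h) (x : ℕ) :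
    FF t N D x + cost t N D x = 6 * (EE N D x t).card := by
  have := C.Fbound x
  unfold FF; omega

theorem FF_ge (C : Comb t V N D h) (x : ℕ) :
    3 * (EE N D x t).card + 3 * dG t N D x ≤ FF t N D x := by
  have := C.Fbound x
  unfold FF; omega

theorem FF12 (C : Comb t V N D h) {x : ℕ} (hx : x ∈ N t) (he : 2 ≤ (EE N D x t).card) :
    12 ≤ FF t N D x := by
  have := C.claimT hx he
  unfold FF; omega

theorem FF6 (C : Comb t V N D h) {x : ℕ} (hx : x ∈ N t) : 6 ≤ FF t N D x := by
  have := C.FF_ge x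
  have := C.dGpos hx
  have := dGle (t := t) (N := N) (D := D) x
  omega

theorem antiT (C : Comb t V N D h) {v q : ℕ} (hv : v ∈ N t) (hE : EE N D v t = {q}) :
    q ∈ N t ∧ D v q = D v t ∧ (∀ c, c ∈ D t v → c ∉ D t q) ∧
      insert v (D t v) ⊆ EE N D q t ∩ N t := by
  have hvt : v ≠ t := by rintro rfl; exact C.Nirr _ hv
  have htv := C.Nsymm _ _ hv
  have hq := memE.1 (show q ∈ EE N D v t by rw [hE]; simp)
  obtain ⟨z, hz, hzN⟩ := C.Enb htv
  rw [hE, Finset.mem_singleton] at hz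
  subst hz
  have hD := C.E1 hvt hE
  have hdis : ∀ c, c ∈ D t v → c ∉ D t z := by
    intro c h1 h2
    have hct : c ≠ t := by rintro rfl; exact C.Nirr _ (C.Dsub _ _ _ h1)
    have h3 : c ∈ D v z := by rw [hD]; exact C.Dsw _ _ _ h1
    exact hq.2.2 (C.A4 c v t z hct (C.Dsw _ _ _ h1) h2 h3)
  refine ⟨hzN, hD, hdis, ?_⟩
  intro w hw
  rw [Finset.mem_inter, memE]
  rcases Finset.mem_insert.1 hw with rfl | hw
  · refine ⟨⟨C.Nsymm _ _ hq.1, hvt, ?_⟩, hv⟩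
    intro hh
    exact hq.2.2 (C.Drot _ _ _ (C.Dsw _ _ _ (C.Drot _ _ _ (C.Dsw _ _ _ (C.Drot _ _ _ (C.Dsw _ _ _ (C.Drot _ _ _ (C.Dsw _ _ _ (C.Drot _ _ _ hh)))))))))
  · have h3 : w ∈ D v z := by rw [hD]; exact C.Dsw _ _ _ hw
    refine ⟨⟨C.Dz2 h3, ?_, ?_⟩, C.Dsub _ _ _ hw⟩
    · rintro rfl; exact C.Nirr _ (C.Dsub _ _ _ hw)
    · intro hh; exact hdis w hw (C.Dsw _ _ _ hh)

theorem case1 (C : Comb t V N D h) {v₀ q : ℕ} (hv₀ : v₀ ∈ N t) (hE₀ : EE N D v₀ t = {q}) :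
    120 ≤ ∑ x ∈ N t, FF t N D x := by
  set P := (N t).filter fun v => EE N D v t = {q} with hP
  have hPmem : ∀ v, v ∈ P ↔ v ∈ N t ∧ EE N D v t = {q} := by intro v; simp [hP]
  have hv₀P : v₀ ∈ P := (hPmem _).2 ⟨hv₀, hE₀⟩
  have hqN : q ∈ N t := (C.antiT hv₀ hE₀).1
  have hqt : q ≠ t := by rintro rfl; exact C.Nirr _ hqN
  set B := bd D t P with hB
  have hdPB : Disjoint P B := by
    rw [Finset.disjoint_left]; intro z hz hz'
    exact (mem_bd.1 hz').2 hz
  have hPB : P ∪ B ⊆ EE N D q t ∩ N t := by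
    intro z hz
    rcases Finset.mem_union.1 hz with hz | hz
    · obtain ⟨h1, h2⟩ := (hPmem z).1 hz
      exact (C.antiT h1 h2).2.2.2 (Finset.mem_insert_self _ _)
    · obtain ⟨⟨v, hv, hzv⟩, _⟩ := mem_bd.1 hz
      obtain ⟨h1, h2⟩ := (hPmem v).1 hv
      exact (C.antiT h1 h2).2.2.2 (Finset.mem_insert_of_mem hzv)
  have hqE : q ∉ EE N D q t := fun hh => C.Nirr _ (memE.1 hh).1
  have hqPB : q ∉ P ∪ B := fun hh => hqE (Finset.mem_inter.1 (hPB hh)).1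
  have hqP : q ∉ P := fun hh => hqPB (Finset.mem_union_left _ hh)
  have hqB : q ∉ B := fun hh => hqPB (Finset.mem_union_right _ hh)
  have hs : (P ∪ B).card = P.card + B.card := Finset.card_union_of_disjoint hdPB
  have hFq : 6 * (P ∪ B).card ≤ FF t N D q := by
    have h1 := C.FF_ge q
    have h2 := dGle (t := t) (N := N) (D := D) q
    have h3 : (P ∪ B).card ≤ dG t N D q := Finset.card_le_card hPB
    omega
  have hB12 : ∀ c ∈ B, 12 ≤ FF t N D c := by
    intro c hc
    obtain ⟨⟨v, hv, hcv⟩, hcP⟩ := mem_bd.1 hc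
    obtain ⟨h1, h2⟩ := (hPmem v).1 hv
    obtain ⟨k1, k2, k3, k4⟩ := C.antiT h1 h2
    have hcN := C.Dsub _ _ _ hcv
    refine C.FF12 hcN ?_
    by_contra hlt
    have := C.Epos (C.Nsymm _ _ hcN)
    obtain ⟨q', hq'⟩ := Finset.card_eq_one.1 (by omega : (EE N D c t).card = 1)
    have hc2 := memE.1 (Finset.mem_inter.1 (k4 (Finset.mem_insert_of_mem hcv))).1
    have : q ∈ EE N D c t := by
      rw [memE]
      refine ⟨C.Nsymm _ _ hc2.1, hqt, ?_⟩
      intro hh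
      exact k3 c hcv (C.Drot _ _ _ (C.Dsw _ _ _ hh))
    rw [hq', Finset.mem_singleton] at this
    subst this
    exact hcP ((hPmem c).2 ⟨hcN, hq'⟩)
  have hsub1 : ∀ v ∈ P, insert v (D t v) ⊆ P ∪ B := by
    intro v hv z hz
    by_cases hzP : z ∈ P
    · exact Finset.mem_union_left _ hzP
    · rcases Finset.mem_insert.1 hz with rfl | hz
      · exact absurd hv hzP
      · exact Finset.mem_union_right _ (mem_bd.2 ⟨⟨v, hv, hz⟩, hzP⟩)
  have hB2 : 2 ≤ B.card := C.bd2 (Finset.filter_subset _ _) ⟨v₀, hv₀P⟩ hqN hqP hqB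
  have h14 : 14 ≤ 2 * (P ∪ B).card + B.card := by
    have h4 := C.A1 t v₀ hv₀
    by_cases hex : ∃ v ∈ P, v ≠ v₀
    · obtain ⟨v, hv, hvne⟩ := hex
      obtain ⟨m1, m2⟩ := (hPmem v).1 hv
      obtain ⟨k1, k2, k3, k4⟩ := C.antiT m1 m2
      obtain ⟨l1, l2, l3, l4⟩ := C.antiT hv₀ hE₀
      have h4' := C.A1 t v m1
      suffices 6 ≤ (P ∪ B).card by omega
      by_cases hadj : v ∈ D t v₀
      · have hi : (D t v ∩ D t v₀).card = 2 := by
          rw [C.Dcomm t v, C.Dcomm t v₀, ← k2, ← l2, C.Dcomm v q, C.Dcomm v₀ q]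
          refine C.A2 q v₀ v hqt ?_
          rw [C.Dcomm, l2, C.Dcomm]; exact hadj
        have hu := Finset.card_union_add_card_inter (D t v) (D t v₀)
        have : D t v ∪ D t v₀ ⊆ P ∪ B := Finset.union_subset
          ((Finset.subset_insert _ _).trans (hsub1 v hv))
          ((Finset.subset_insert _ _).trans (hsub1 v₀ hv₀P))
        have := Finset.card_le_card this
        omega
      · have : insert v (insert v₀ (D t v₀)) ⊆ P ∪ B := by
          intro z hz
          rcases Finset.mem_insert.1 hz with rfl | hz
          · exact Finset.mem_union_left _ hv
          · exact hsub1 v₀ hv₀P hz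
        have := Finset.card_le_card this
        rw [Finset.card_insert_of_notMem, Finset.card_insert_of_notMem (C.Dself _ _)] at this
        · omega
        · rw [Finset.mem_insert]; tauto
    · push Not at hex
      have hP1 : P = {v₀} := by
        ext z; rw [Finset.mem_singleton]
        exact ⟨fun hz => hex z hz, by rintro rfl; exact hv₀P⟩
      have hPc : P.card = 1 := by rw [hP1]; simp
      have : D t v₀ ⊆ B := by
        intro z hz
        refine mem_bd.2 ⟨⟨v₀, hv₀P, hz⟩, ?_⟩
        rw [hP1, Finset.mem_singleton]; rintro rfl; exact C.Dself _ _ hz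
      have := Finset.card_le_card this
      omega
  -- base sums
  have hsP : 6 * P.card ≤ ∑ x ∈ P, FF t N D x := by
    have := cnle P (FF t N D) 6 (fun x hx => C.FF6 ((hPmem x).1 hx).1)
    simpa [mul_comm] using this
  have hsB : 12 * B.card ≤ ∑ x ∈ B, FF t N D x := by
    have := cnle B (FF t N D) 12 hB12
    simpa [mul_comm] using this
  have hDN : D t q ⊆ N t := fun z hz => C.Dsub _ _ _ hz
  have hD4 := C.A1 t q hqN
  have hDdj : ∀ z ∈ D t q, z ∉ EE N D q t := fun z hz hh =>
    (memE.1 hh).2.2 (C.Dsw _ _ _ hz)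
  have hdj1 : Disjoint (insert q (P ∪ B)) (D t q) := by
    rw [Finset.disjoint_left]
    intro z hz hz'
    rcases Finset.mem_insert.1 hz with rfl | hz
    · exact C.Dself _ _ hz'
    · exact hDdj z hz' (Finset.mem_inter.1 (hPB hz)).1
  have hPBN : insert q (P ∪ B) ⊆ N t := by
    intro z hz
    rcases Finset.mem_insert.1 hz with rfl | hz
    · exact hqN
    · exact (Finset.mem_inter.1 (hPB hz)).2
  have hbase : ∑ x ∈ insert q (P ∪ B), FF t N D x
      = FF t N D q + (∑ x ∈ P, FF t N D x + ∑ x ∈ B, FF t N D x) := by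
    rw [Finset.sum_insert hqPB, Finset.sum_union hdPB]
  have htot : ∑ x ∈ insert q (P ∪ B), FF t N D x + ∑ x ∈ D t q, FF t N D x
      ≤ ∑ x ∈ N t, FF t N D x := by
    rw [← Finset.sum_union hdj1]
    exact Finset.sum_le_sum_of_subset (Finset.union_subset hPBN hDN)
  by_cases hall : ∀ r ∈ D t q, 12 ≤ FF t N D r
  · have := cnle (D t q) (FF t N D) 12 hall
    simp only [smul_eq_mul] at this
    omega
  · push Not at hall
    obtain ⟨r, hr, hrF⟩ := hall
    have hrN := hDN hr
    have hr1 : (EE N D r t).card = 1 := by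
      have := C.Epos (C.Nsymm _ _ hrN)
      by_contra hne
      have := C.FF12 hrN (by omega)
      omega
    obtain ⟨q', hq'⟩ := Finset.card_eq_one.1 hr1
    obtain ⟨k1, k2, k3, k4⟩ := C.antiT hrN hq'
    have hdG5 : 5 ≤ dG t N D q' := by
      have h1 := Finset.card_le_card k4
      rw [Finset.card_insert_of_notMem (C.Dself _ _)] at h1
      have := C.A1 t r hrN
      unfold dG; omega
    have he5 := dGle (t := t) (N := N) (D := D) q'
    have hF30 : 30 ≤ FF t N D q' := by
      have := C.FF_ge q'; omega
    have hq'P : q' ∉ P := by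
      intro hh
      have := ((hPmem q').1 hh).2
      rw [this] at he5
      simp at he5; omega
    have hqq' : q ∈ EE N D q' t :=
      (Finset.mem_inter.1 (k4 (Finset.mem_insert_of_mem (C.Drot _ _ _ hr)))).1
    have hqq'2 := memE.1 hqq'
    have hne : q' ≠ q := by rintro rfl; exact hqE hqq'
    have hq'D : q' ∉ D t q := fun hh =>
      hqq'2.2.2 (C.Dsw _ _ _ (C.Drot _ _ _ hh))
    have hsD : 6 * (D t q).card ≤ ∑ x ∈ D t q, FF t N D x := by
      have := cnle (D t q) (FF t N D) 6 (fun x hx => C.FF6 (hDN hx))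
      simpa [mul_comm] using this
    by_cases hq'B : q' ∈ B
    · have h1 : ∑ x ∈ B, FF t N D x = FF t N D q' + ∑ x ∈ B.erase q', FF t N D x :=
        (Finset.add_sum_erase B _ hq'B).symm
      have h2 := cnle (B.erase q') (FF t N D) 12
        (fun x hx => hB12 x (Finset.mem_of_mem_erase hx))
      rw [Finset.card_erase_of_mem hq'B] at h2
      simp only [smul_eq_mul] at h2
      omega
    · have hnot : q' ∉ insert q (P ∪ B) ∪ D t q := by
        simp only [Finset.mem_insert, Finset.mem_union]; tauto
      have htot2 : FF t N D q' + (∑ x ∈ insert q (P ∪ B), FF t N D x + ∑ x ∈ D t q, FF t N D x)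
          ≤ ∑ x ∈ N t, FF t N D x := by
        rw [← Finset.sum_union hdj1, ← Finset.sum_insert hnot]
        exact Finset.sum_le_sum_of_subset
          (Finset.insert_subset k1 (Finset.union_subset hPBN hDN))
      omega

theorem key (C : Comb t V N D h) {x g : ℕ} (hx : x ∈ N t) (hg : g ∈ EE N D x t ∩ N t) :
    6 ≤ (EE N D x t).card + dG t N D g := by
  obtain ⟨hgE, hgN⟩ := Finset.mem_inter.1 hg
  have hgE' := memE.1 hgE
  have hxt : x ≠ t := by rintro rfl; exact C.Nirr _ hx
  have h1 : insert x (D x g ∩ D x t) ⊆ EE N D g t ∩ N t := by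
    intro c hc
    rw [Finset.mem_inter, memE]
    rcases Finset.mem_insert.1 hc with rfl | hc
    · refine ⟨⟨C.Nsymm _ _ hgE'.1, hxt, ?_⟩, hx⟩
      intro hh
      exact hgE'.2.2 (C.Dsw _ _ _ (C.Drot _ _ _ (C.Dsw _ _ _ hh)))
    · obtain ⟨c1, c2⟩ := Finset.mem_inter.1 hc
      have hct : c ≠ t := by rintro rfl; exact C.Dself _ _ c2
      refine ⟨⟨C.Dz2 c1, hct, ?_⟩, C.Dz2 c2⟩
      intro hh
      exact hgE'.2.2 (C.A4 c x t g hct c2 (C.Dsw _ _ _ hh) c1)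
  have h2 : insert g (D x g \ D x t) ⊆ EE N D x t := by
    intro c hc
    rcases Finset.mem_insert.1 hc with rfl | hc
    · exact hgE
    · obtain ⟨c1, c2⟩ := Finset.mem_sdiff.1 hc
      refine memE.2 ⟨C.Dsub _ _ _ c1, ?_, c2⟩
      rintro rfl
      exact hgE'.2.2 (C.Drot _ _ _ c1)
  have c1 := Finset.card_le_card h1
  have c2 := Finset.card_le_card h2
  rw [Finset.card_insert_of_notMem] at c1 c2
  · have := Finset.card_sdiff_add_card_inter (D x g) (D x t)
    have := C.A1 x g hgE'.1
    unfold dG; omega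
  · intro hh; exact C.Dself _ _ (Finset.mem_sdiff.1 hh).1
  · intro hh; exact C.Nirr _ (C.Dsub _ _ _ (Finset.mem_inter.1 hh).1)

theorem Gsymm (C : Comb t V N D h) {x g : ℕ} (hx : x ∈ N t) (hg : g ∈ EE N D x t ∩ N t) :
    x ∈ EE N D g t ∩ N t := by
  obtain ⟨hgE, hgN⟩ := Finset.mem_inter.1 hg
  have hgE' := memE.1 hgE
  have hxt : x ≠ t := by rintro rfl; exact C.Nirr _ hx
  rw [Finset.mem_inter, memE]
  refine ⟨⟨C.Nsymm _ _ hgE'.1, hxt, ?_⟩, hx⟩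
  intro hh
  exact hgE'.2.2 (C.Dsw _ _ _ (C.Drot _ _ _ (C.Dsw _ _ _ hh)))

theorem exG (C : Comb t V N D h) {x : ℕ} (hx : x ∈ N t) : ∃ g, g ∈ EE N D x t ∩ N t :=
  Finset.card_pos.1 (C.dGpos hx)

theorem degsum (C : Comb t V N D h) :
    ∑ x ∈ N t, dG t N D x + 7 * (N t).card + 12 * h ≤ (N t).card * (N t).card + 12 := by
  have h1 : ∀ x ∈ N t, dG t N D x + (D t x).card + 1 ≤ (N t).card := by
    intro x hx
    have hdj : Disjoint (EE N D x t ∩ N t) (D t x) := by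
      rw [Finset.disjoint_left]
      intro z hz hz'
      exact (memE.1 (Finset.mem_inter.1 hz).1).2.2 (C.Dsw _ _ _ hz')
    have hn : x ∉ (EE N D x t ∩ N t) ∪ D t x := by
      intro hh
      rcases Finset.mem_union.1 hh with hh | hh
      · exact C.Nirr _ (memE.1 (Finset.mem_inter.1 hh).1).1
      · exact C.Dself _ _ hh
    have hsub : insert x ((EE N D x t ∩ N t) ∪ D t x) ⊆ N t :=
      Finset.insert_subset hx (Finset.union_subset Finset.inter_subset_right
        (fun z hz => C.Dsub _ _ _ hz))
    have := Finset.card_le_card hsub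
    rw [Finset.card_insert_of_notMem hn, Finset.card_union_of_disjoint hdj] at this
    exact this
  have h2 := Finset.sum_le_card_nsmul (N t) _ _ h1
  rw [Finset.sum_add_distrib, Finset.sum_add_distrib] at h2
  simp only [smul_eq_mul, Finset.sum_const, mul_one] at h2
  have := C.A7
  omega

theorem sum_split1 {s : Finset ℕ} (f : ℕ → ℕ) {g : ℕ} (hg : g ∈ s) (hf : ∀ x ∈ s, 12 ≤ f x) :
    f g + 12 * (s.card - 1) ≤ ∑ x ∈ s, f x := by
  rw [← Finset.add_sum_erase s f hg]
  have := cnle (s.erase g) f 12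
    (fun x hx => hf x (Finset.mem_of_mem_erase hx))
  rw [Finset.card_erase_of_mem hg] at this
  simp only [smul_eq_mul] at this
  omega

theorem case2 (C : Comb t V N D h) (hh : 1 ≤ h) (he : ∀ x ∈ N t, 2 ≤ (EE N D x t).card) :
    120 ≤ ∑ x ∈ N t, FF t N D x := by
  have hF : ∀ x ∈ N t, 12 ≤ FF t N D x := fun x hx => C.FF12 hx (he x hx)
  have hFs := cnle (N t) (FF t N D) 12 hF
  simp only [smul_eq_mul] at hFs
  have hds := C.degsum
  have hge : (N t).card ≤ ∑ x ∈ N t, dG t N D x := by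
    have := cnle (N t) (dG t N D) 1 (fun x hx => C.dGpos hx)
    simpa using this
  have h6 := C.d6 C.tV
  rcases Nat.lt_or_ge 9 (N t).card with h10 | h9
  · omega
  have hn : (N t).card = 6 ∨ (N t).card = 7 ∨ (N t).card = 8 ∨ (N t).card = 9 := by omega
  rcases hn with hn | hn | hn | hn
  · rw [hn] at hds hge; omega
  · rw [hn] at hds hge; omega
  · have hall : ∀ x ∈ N t, dG t N D x = 1 := by
      intro x hx
      have h1 := C.dGpos hx
      have h2 := Finset.add_sum_erase (N t) (dG t N D) hx
      have h3 := cnle ((N t).erase x) (dG t N D) 1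
        (fun y hy => C.dGpos (Finset.mem_of_mem_erase hy))
      rw [Finset.card_erase_of_mem hx] at h3
      simp only [smul_eq_mul] at h3
      rw [hn] at hds h3
      omega
    have h18 : ∀ x ∈ N t, 18 ≤ FF t N D x := by
      intro x hx
      obtain ⟨g, hg⟩ := C.exG hx
      have := C.key hx hg
      have := hall g (Finset.mem_inter.1 hg).2
      have := C.FF_ge x
      have := hall x hx
      omega
    have := cnle (N t) (FF t N D) 18 h18
    simp only [smul_eq_mul] at this
    omega
  · by_cases h4 : ∃ g ∈ N t, 4 ≤ dG t N D g
    · obtain ⟨g, hg, hg4⟩ := h4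
      have h1 := sum_split1 (FF t N D) hg hF
      have := C.FF_ge g
      have := dGle (t := t) (N := N) (D := D) g
      omega
    push Not at h4
    have he3 : ∀ x ∈ N t, 3 ≤ (EE N D x t).card := by
      intro x hx
      obtain ⟨g, hg⟩ := C.exG hx
      have := C.key hx hg
      have := h4 g (Finset.mem_inter.1 hg).2
      omega
    set S := (N t).filter fun x => FF t N D x < 15 with hS
    have hSprop : ∀ x ∈ S, (EE N D x t).card = 3 ∧ dG t N D x = 1 := by
      intro x hx
      obtain ⟨hx1, hx2⟩ := Finset.mem_filter.1 hx
      have := he3 x hx1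
      have := C.dGpos hx1
      have := C.FF_ge x
      omega
    have hSN : S ⊆ N t := Finset.filter_subset _ _
    have hcomp : ∀ x ∈ N t \ S, 15 ≤ FF t N D x := by
      intro x hx
      obtain ⟨h1, h2⟩ := Finset.mem_sdiff.1 hx
      by_contra hlt
      exact h2 (Finset.mem_filter.2 ⟨h1, by omega⟩)
    have hsplit : ∑ x ∈ N t \ S, FF t N D x + ∑ x ∈ S, FF t N D x = ∑ x ∈ N t, FF t N D x :=
      Finset.sum_sdiff hSN
    have hcS : (N t \ S).card + S.card = 9 := by
      rw [Finset.card_sdiff_add_card_eq_card hSN, hn]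
    have hS12 := cnle S (FF t N D) 12 (fun x hx => hF x (hSN hx))
    simp only [smul_eq_mul] at hS12
    -- nbr map
    have hnb : ∀ x ∈ S, ∃ g ∈ N t \ S, g ∈ EE N D x t ∩ N t ∧ dG t N D g = 3 := by
      intro x hx
      obtain ⟨g, hg⟩ := C.exG (hSN hx)
      have h1 := C.key (hSN hx) hg
      have h2 := hSprop x hx
      have hgN := (Finset.mem_inter.1 hg).2
      have h3 := h4 g hgN
      refine ⟨g, Finset.mem_sdiff.2 ⟨hgN, ?_⟩, hg, by omega⟩
      intro hgS
      have := hSprop g hgS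
      omega
    choose! φ hφ1 hφ2 hφ3 using hnb
    have hfib : S.card ≤ 3 * (S.image φ).card := by
      refine Finset.card_le_mul_card_image S 3 ?_
      intro g hg
      obtain ⟨x, hx, rfl⟩ := Finset.mem_image.1 hg
      have : S.filter (fun a => φ a = φ x) ⊆ EE N D (φ x) t ∩ N t := by
        intro y hy
        obtain ⟨y1, y2⟩ := Finset.mem_filter.1 hy
        rw [← y2]
        exact C.Gsymm (hSN y1) (hφ2 y y1)
      have h1 := Finset.card_le_card this
      have h2 := hφ3 x hx
      unfold dG at h2
      omega
    have him : S.image φ ⊆ N t \ S := by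
      intro g hg
      obtain ⟨x, hx, rfl⟩ := Finset.mem_image.1 hg
      exact hφ1 x hx
    have h3 := Finset.card_le_card him
    rcases S.eq_empty_or_nonempty with h0 | ⟨x, hx⟩
    · have := cnle (N t \ S) (FF t N D) 15 hcomp
      simp only [smul_eq_mul] at this
      have h00 : S.card = 0 := by rw [h0]; rfl
      omega
    · have hg := hφ1 x hx
      have hFg : 18 ≤ FF t N D (φ x) := by
        have := C.FF_ge (φ x)
        have := hφ3 x hx
        have := he3 (φ x) (Finset.mem_sdiff.1 hg).1
        omega
      have h5 := Finset.add_sum_erase (N t \ S) (FF t N D) hg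
      have h7 := cnle ((N t \ S).erase (φ x)) (FF t N D) 15
        (fun y hy => hcomp y (Finset.mem_of_mem_erase hy))
      rw [Finset.card_erase_of_mem hg] at h7
      simp only [smul_eq_mul] at h7
      omega

theorem total (C : Comb t V N D h) (hh : 1 ≤ h) : 120 ≤ ∑ x ∈ N t, FF t N D x := by
  by_cases h1 : ∃ v ∈ N t, (EE N D v t).card = 1
  · obtain ⟨v, hv, hv1⟩ := h1
    obtain ⟨q, hq⟩ := Finset.card_eq_one.1 hv1
    exact C.case1 hv hq
  · push Not at h1
    refine C.case2 hh ?_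
    intro x hx
    have := h1 x hx
    have := C.Epos (C.Nsymm _ _ hx)
    omega

/-- The charge paid to `b`. -/
def paid (t : ℕ) (N : ℕ → Finset ℕ) (D : ℕ → ℕ → Finset ℕ) (b : ℕ) : ℕ :=
  ∑ x ∈ N b, if b ∈ Low t N D x then wt N b else 0

theorem claimP (C : Comb t V N D h) {b : ℕ} (hbV : b ∈ V) (hb : b ≠ t) (htb : t ∉ N b) :
    cost t N D b + 48 ≤ 6 * (N b).card + paid t N D b := by
  have h6 := C.d6 hbV
  rcases Nat.lt_or_ge 7 (N b).card with h8 | h7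
  · have := C.claimB hb h8
    omega
  have hc0 : cost t N D b = 0 := by
    unfold cost
    rw [Finset.sum_eq_zero]
    intro z hz
    have := C.low_d hz
    omega
  rcases Nat.lt_or_ge 6 (N b).card with h7' | h6'
  · have h7 : (N b).card = 7 := by omega
    set k := ((N b).filter fun x => (D b x).card = 5).card with hk
    have h45 : ∀ x ∈ N b, (D b x).card = 4 + if (D b x).card = 5 then 1 else 0 := by
      intro x hx
      have := C.cardE hx
      have := C.Epos hx
      have := C.A1 _ _ hx
      split_ifs <;> omega
    have hsum : ∑ x ∈ N b, (D b x).card = 28 + k := by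
      rw [Finset.sum_congr rfl h45, Finset.sum_add_distrib]
      simp [h7, hk]
    have h8 := C.A8 b
    have hk7 : k ≤ 7 := by rw [← h7]; exact Finset.card_filter_le _ _
    have hk2 : k = 2 := by rw [hsum] at h8; omega
    have hp : paid t N D b = 6 := by
      unfold paid
      have : ∀ x ∈ N b, (if b ∈ Low t N D x then wt N b else 0)
          = if (D b x).card = 5 then 3 else 0 := by
        intro x hx
        have hx' := C.Nsymm _ _ hx
        have hw : wt N b = 3 := by unfold wt; rw [if_neg (by omega)]
        rw [hw]
        congr 1
        simp only [memLow, eq_iff_iff]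
        constructor
        · intro hh; omega
        · intro hh; exact ⟨hx', ⟨hb, htb⟩, Or.inr ⟨h7, hh⟩⟩
      rw [Finset.sum_congr rfl this, ← Finset.sum_filter]
      simp only [Finset.sum_const, smul_eq_mul]
      omega
    omega
  · have h6 : (N b).card = 6 := by omega
    have hp : paid t N D b = 12 := by
      unfold paid
      have : ∀ x ∈ N b, (if b ∈ Low t N D x then wt N b else 0) = 2 := by
        intro x hx
        rw [if_pos (C.low_six hb htb h6 hx).1]
        unfold wt; rw [if_pos h6]
      rw [Finset.sum_congr rfl this]
      simp [h6]
    omega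

theorem final (C : Comb t V N D h) (hh : 1 ≤ h) :
    8 * V.card + 12 * h ≤ ∑ v ∈ V, (N v).card := by
  have hNV : N t ⊆ V := fun y hy => C.NV y t (C.Nsymm _ _ hy)
  set B := (V.erase t) \ N t with hB
  have hNt : N t ⊆ V.erase t := by
    intro y hy
    rw [Finset.mem_erase]
    refine ⟨?_, hNV hy⟩
    rintro rfl; exact C.Nirr _ hy
  have hBm : ∀ b, b ∈ B ↔ b ∈ V ∧ b ≠ t ∧ t ∉ N b := by
    intro b
    rw [hB, Finset.mem_sdiff, Finset.mem_erase]
    constructor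
    · rintro ⟨⟨h1, h2⟩, h3⟩; exact ⟨h2, h1, fun hx => h3 (C.Nsymm _ _ hx)⟩
    · rintro ⟨h1, h2, h3⟩; exact ⟨⟨h2, h1⟩, fun hx => h3 (C.Nsymm _ _ hx)⟩
  have hsum : ∀ f : ℕ → ℕ, ∑ v ∈ V, f v = f t + (∑ v ∈ B, f v + ∑ v ∈ N t, f v) := by
    intro f
    rw [← Finset.add_sum_erase V f C.tV, hB, Finset.sum_sdiff hNt]
  have hcard : V.card = 1 + (B.card + (N t).card) := by
    have := hsum (fun _ => 1)
    simpa using this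
  have h1 : ∑ b ∈ B, cost t N D b + 48 * B.card
      ≤ 6 * ∑ b ∈ B, (N b).card + ∑ b ∈ B, paid t N D b := by
    have : ∑ b ∈ B, (cost t N D b + 48) ≤ ∑ b ∈ B, (6 * (N b).card + paid t N D b) := by
      refine Finset.sum_le_sum ?_
      intro b hb
      obtain ⟨g1, g2, g3⟩ := (hBm b).1 hb
      exact C.claimP g1 g2 g3
    rw [Finset.sum_add_distrib, Finset.sum_add_distrib, ← Finset.mul_sum] at this
    simp only [Finset.sum_const, smul_eq_mul] at this
    omega
  have h2 : ∑ b ∈ B, paid t N D b ≤ ∑ x ∈ B ∪ N t, cost t N D x := by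
    have e1 : ∀ b ∈ B, paid t N D b
        = ∑ x ∈ B ∪ N t, if b ∈ Low t N D x then wt N b else 0 := by
      intro b hb
      obtain ⟨g1, g2, g3⟩ := (hBm b).1 hb
      unfold paid
      refine Finset.sum_subset ?_ ?_
      · intro x hx
        by_cases hxt : x ∈ N t
        · exact Finset.mem_union_right _ hxt
        · refine Finset.mem_union_left _ ((hBm x).2 ⟨C.NV x b (C.Nsymm _ _ hx), ?_, ?_⟩)
          · rintro rfl; exact g3 hx
          · intro hh; exact hxt (C.Nsymm _ _ hh)
      · intro x _ hx
        rw [if_neg]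
        intro hh; exact hx (C.Nsymm _ _ (memLow.1 hh).1)
    rw [Finset.sum_congr rfl e1, Finset.sum_comm]
    refine Finset.sum_le_sum ?_
    intro x _
    unfold cost
    rw [← Finset.sum_filter]
    refine Finset.sum_le_sum_of_subset ?_
    intro b hb; exact (Finset.mem_filter.1 hb).2
  rw [Finset.sum_union (by rw [hB]; exact Finset.sdiff_disjoint)] at h2
  have h3 : ∑ x ∈ N t, FF t N D x + ∑ x ∈ N t, cost t N D x
      = 6 * ∑ x ∈ N t, (EE N D x t).card := by
    rw [← Finset.sum_add_distrib, Finset.mul_sum]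
    exact Finset.sum_congr rfl (fun x _ => C.FF_add x)
  have h4 := C.total hh
  have h5 : ∑ x ∈ N t, (EE N D x t).card + ∑ x ∈ N t, (D t x).card + (N t).card
      = ∑ x ∈ N t, (N x).card := by
    have : ∑ x ∈ N t, ((EE N D x t).card + (D t x).card + 1) = ∑ x ∈ N t, (N x).card := by
      refine Finset.sum_congr rfl ?_
      intro x hx
      rw [C.Dcomm t x]
      exact C.cardE (C.Nsymm _ _ hx)
    rw [← this, Finset.sum_add_distrib, Finset.sum_add_distrib]
    simp
  have h7 := C.A7
  have h8 := hsum (fun v => (N v).card)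
  omega

end Comb
end SComplex


namespace SComplex

open Topology Set

/-- A compatible family of local sections of the double cover given by the cocycle `c`. -/
def Sec {X : Type} [TopologicalSpace X] (U : ℕ → Set X) (c : ℕ → ℕ → ZMod 2) (W : Set X)
    (s : ℕ → X → ZMod 2) : Prop :=
  (∀ i, ContinuousOn (s i) (U i ∩ W)) ∧
    ∀ i j p, p ∈ W → p ∈ U i → p ∈ U j → s j p = s i p + c i j

theorem sec_simply {X : Type} [TopologicalSpace X] [SimplyConnectedSpace X]
    [LocallyPathConnectedSpace X] (U : ℕ → Set X) (hU : ∀ i, IsOpen (U i))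
    (hcov : ∀ p, ∃ i, p ∈ U i) (c : ℕ → ℕ → ZMod 2)
    (hc : ∀ i j k p, p ∈ U i → p ∈ U j → p ∈ U k → c i j + c j k = c i k) :
    ∃ s, Sec U c univ s := by
  classical
  choose idx hidx using hcov
  let Z : FiberBundleCore ℕ X (ZMod 2) :=
    { baseSet := U
      isOpen_baseSet := hU
      indexAt := idx
      mem_baseSet_at := hidx
      coordChange := fun i j _ v => v + c i j
      coordChange_self := by
        intro i x hx v
        have := hc i i i x hx hx hx
        have h0 : c i i = 0 := by simpa using this
        simp [h0]
      continuousOn_coordChange := by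
        intro i j
        exact ((continuous_of_discreteTopology (f := fun v : ZMod 2 => v + c i j)).comp
          continuous_snd).continuousOn
      coordChange_comp := by
        intro i j k x hx v
        have := hc i j k x hx.1.1 hx.1.2 hx.2
        rw [← this]; ring }
  have cov : IsCoveringMap (Bundle.TotalSpace.proj : Z.TotalSpace → X) :=
    FiberBundle.isCoveringMap
  obtain ⟨x0⟩ : Nonempty X := inferInstance
  obtain ⟨F, ⟨_, hF⟩, _⟩ := cov.existsUnique_continuousMap_lifts (ContinuousMap.id X) x0
    (⟨x0, (0 : ZMod 2)⟩ : Z.TotalSpace) rfl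
  have hFp : ∀ x, (F x).1 = x := fun x => congrFun hF x
  refine ⟨fun i x => ((Z.localTriv i) (F x)).2, ?_, ?_⟩
  · intro i
    refine continuous_snd.comp_continuousOn ?_
    refine (Z.localTriv i).continuousOn.comp F.continuous.continuousOn ?_
    intro x hx
    rw [Z.mem_localTriv_source, ← Z.baseSet_at, hFp]
    exact hx.1
  · intro i j p _ hi hj
    obtain ⟨a, ha⟩ : ∃ a : ZMod 2, a = (F p).2 := ⟨(F p).2, rfl⟩
    have hF1 : ∀ i, ((Z.localTriv i) (F p)).2 = a + c (idx (F p).1) i := by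
      intro i
      rw [ha]
      rfl
    change ((Z.localTriv j) (F p)).2 = ((Z.localTriv i) (F p)).2 + c i j
    rw [hF1, hF1, hFp, ← hc (idx p) i j p (hidx p) hi hj]
    ring

/-- The unit sphere in three-space. -/
abbrev S2 := ↥(Metric.sphere (0 : EuclideanSpace ℝ (Fin 3)) 1)

theorem sec_punctured (v : S2) (U : ℕ → Set S2) (hU : ∀ i, IsOpen (U i))
    (hcov : ∀ p, ∃ i, p ∈ U i) (c : ℕ → ℕ → ZMod 2)
    (hc : ∀ i j k p, p ∈ U i → p ∈ U j → p ∈ U k → c i j + c j k = c i k) :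
    ∃ s, Sec U c {v}ᶜ s := by
  have hv : ‖(v : EuclideanSpace ℝ (Fin 3))‖ = 1 := by simp
  set φ := stereographic hv with hφ
  have hsrc : φ.source = {v}ᶜ := stereographic_source hv
  have htgt : φ.target = univ := stereographic_target hv
  have hcont : Continuous φ.symm := by
    have := φ.continuousOn_symm
    rw [htgt] at this
    exact continuousOn_univ.1 this
  obtain ⟨s, hs1, hs2⟩ := sec_simply (fun i => φ.symm ⁻¹' U i)
    (fun i => (hU i).preimage hcont) (fun p => hcov _) c
    (fun i j k p h1 h2 h3 => hc i j k _ h1 h2 h3)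
  refine ⟨fun i p => s i (φ p), ?_, ?_⟩
  · intro i
    refine (hs1 i).comp (φ.continuousOn.mono ?_) ?_
    · rw [hsrc]; exact inter_subset_right
    · intro p hp
      refine ⟨?_, mem_univ _⟩
      change φ.symm (φ p) ∈ U i
      rw [φ.left_inv (by rw [hsrc]; exact hp.2)]
      exact hp.1
  · intro i j p hp hi hj
    refine hs2 i j _ (mem_univ _) ?_ ?_
    · change φ.symm (φ p) ∈ U i
      rw [φ.left_inv (by rw [hsrc]; exact hp)]; exact hi
    · change φ.symm (φ p) ∈ U j
      rw [φ.left_inv (by rw [hsrc]; exact hp)]; exact hj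

theorem two_punctured (v w : S2) (hvw : w ≠ v) : IsPreconnected ({v}ᶜ ∩ {w}ᶜ : Set S2) := by
  have hv : ‖(v : EuclideanSpace ℝ (Fin 3))‖ = 1 := by simp
  set φ := stereographic hv with hφ
  have hsrc : φ.source = {v}ᶜ := stereographic_source hv
  have htgt : φ.target = univ := stereographic_target hv
  have hcont : Continuous φ.symm := by
    have := φ.continuousOn_symm
    rw [htgt] at this
    exact continuousOn_univ.1 this
  have hv0 : (v : EuclideanSpace ℝ (Fin 3)) ≠ 0 := by
    intro h0; rw [h0] at hv; simp at hv
  have : Fact (Module.finrank ℝ (EuclideanSpace ℝ (Fin 3)) = 2 + 1) := ⟨by simp⟩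
  have hrank : 1 < Module.rank ℝ (ℝ ∙ (v : EuclideanSpace ℝ (Fin 3)))ᗮ := by
    have := Submodule.finrank_orthogonal_span_singleton (𝕜 := ℝ) (n := 2) hv0
    rw [← Module.finrank_eq_rank, this]
    norm_num
  have h1 := (isConnected_compl_singleton_of_one_lt_rank hrank (φ w)).isPreconnected
  have h2 := h1.image φ.symm hcont.continuousOn
  convert h2 using 1
  have hw : w ∈ φ.source := by rw [hsrc]; exact hvw
  ext p
  constructor
  · rintro ⟨hp1, hp2⟩
    have hp : p ∈ φ.source := by rw [hsrc]; exact hp1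
    refine ⟨φ p, ?_, φ.left_inv hp⟩
    intro heq
    exact hp2 (φ.injOn hp hw heq)
  · rintro ⟨y, hy, rfl⟩
    have hm : φ.symm y ∈ φ.source := φ.map_target (by rw [htgt]; trivial)
    refine ⟨by rw [← hsrc]; exact hm, ?_⟩
    intro heq
    apply hy
    rw [mem_singleton_iff] at heq ⊢
    rw [← heq, φ.right_inv (by rw [htgt]; trivial)]

theorem sec_sphere (U : ℕ → Set S2) (hU : ∀ i, IsOpen (U i))
    (hcov : ∀ p, ∃ i, p ∈ U i) (c : ℕ → ℕ → ZMod 2)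
    (hc : ∀ i j k p, p ∈ U i → p ∈ U j → p ∈ U k → c i j + c j k = c i k) :
    ∃ s, Sec U c univ s := by
  classical
  obtain ⟨v⟩ : Nonempty S2 := (NormedSpace.sphere_nonempty.2 zero_le_one).to_subtype
  set w : S2 := -v with hw
  have hwv : w ≠ v := by
    intro heq
    have h1 : (v : EuclideanSpace ℝ (Fin 3)) = -v := by
      conv_lhs => rw [← heq]
      rfl
    have hv : ‖(v : EuclideanSpace ℝ (Fin 3))‖ = 1 := by simp
    have h0 : (v : EuclideanSpace ℝ (Fin 3)) = 0 := by
      ext i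
      have h2 := congrArg (fun z : EuclideanSpace ℝ (Fin 3) => z i) h1
      simp only [PiLp.neg_apply] at h2
      simp only [PiLp.zero_apply]
      linarith
    rw [h0] at hv
    simp at hv
  obtain ⟨σ, hσ1, hσ2⟩ := sec_punctured v U hU hcov c hc
  obtain ⟨τ, hτ1, hτ2⟩ := sec_punctured w U hU hcov c hc
  set W : Set S2 := {v}ᶜ ∩ {w}ᶜ with hWdef
  have hWo : IsOpen W := isOpen_compl_singleton.inter isOpen_compl_singleton
  choose idx hidx using hcov
  have hδ : ∀ p ∈ W, ∀ i, p ∈ U i → σ i p - τ i p = σ (idx p) p - τ (idx p) p := by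
    intro p hp i hi
    rw [hσ2 (idx p) i p hp.1 (hidx p) hi, hτ2 (idx p) i p hp.2 (hidx p) hi]
    ring
  have hcontδ : ContinuousOn (fun p => σ (idx p) p - τ (idx p) p) W := by
    intro p hp
    have h1 : ContinuousOn (fun q => σ (idx p) q - τ (idx p) q) (U (idx p) ∩ W) := by
      have a1 := (hσ1 (idx p)).mono (inter_subset_inter_right (U (idx p))
        (inter_subset_left : W ⊆ {v}ᶜ))
      have a2 := (hτ1 (idx p)).mono (inter_subset_inter_right (U (idx p))
        (inter_subset_right : W ⊆ {w}ᶜ))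
      exact (continuous_of_discreteTopology (f := fun z : ZMod 2 × ZMod 2 => z.1 - z.2)).comp_continuousOn
        (a1.prodMk a2)
    have h2 : ContinuousOn (fun q => σ (idx q) q - τ (idx q) q) (U (idx p) ∩ W) := by
      refine h1.congr ?_
      intro q hq
      exact (hδ q hq.2 _ hq.1).symm
    exact (h2.continuousAt (((hU _).inter hWo).mem_nhds ⟨hidx p, hp⟩)).continuousWithinAt
  have hconst : ∃ k, ∀ p ∈ W, σ (idx p) p - τ (idx p) p = k := by
    by_cases hne : W.Nonempty
    · obtain ⟨p0, hp0⟩ := hne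
      refine ⟨σ (idx p0) p0 - τ (idx p0) p0, ?_⟩
      intro p hp
      exact (two_punctured v w hwv).constant hcontδ hp hp0
    · exact ⟨0, fun p hp => absurd ⟨p, hp⟩ hne⟩
  obtain ⟨k, hk⟩ := hconst
  have hk' : ∀ p ∈ W, ∀ i, p ∈ U i → σ i p = τ i p + k := by
    intro p hp i hi
    rw [← hk p hp, ← hδ p hp i hi]; ring
  let s : ℕ → S2 → ZMod 2 := fun i p => if p = v then τ i p + k else σ i p
  have hs1 : ∀ i p, p ≠ v → s i p = σ i p := fun i p hp => if_neg hp
  have hs2 : ∀ i p, p ≠ w → p ∈ U i → s i p = τ i p + k := by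
    intro i p hp hi
    by_cases hpv : p = v
    · exact if_pos hpv
    · rw [hs1 i p hpv]; exact hk' p ⟨hpv, hp⟩ i hi
  refine ⟨s, ?_, ?_⟩
  · intro i p hp
    have hpU := hp.1
    refine ContinuousAt.continuousWithinAt ?_
    by_cases hpv : p = v
    · have hpw : p ≠ w := by rw [hpv]; exact hwv.symm
      have h1 : ContinuousOn (fun q => τ i q + k) (U i ∩ {w}ᶜ) :=
        (continuous_of_discreteTopology (f := fun z : ZMod 2 => z + k)).comp_continuousOn (hτ1 i)
      have h2 : ContinuousOn (s i) (U i ∩ {w}ᶜ) := by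
        refine h1.congr ?_
        intro q hq
        exact hs2 i q hq.2 hq.1
      exact h2.continuousAt (((hU i).inter isOpen_compl_singleton).mem_nhds ⟨hpU, hpw⟩)
    · have h2 : ContinuousOn (s i) (U i ∩ {v}ᶜ) := by
        refine (hσ1 i).congr ?_
        intro q hq
        exact hs1 i q hq.2
      exact h2.continuousAt (((hU i).inter isOpen_compl_singleton).mem_nhds ⟨hpU, hpv⟩)
  · intro i j p _ hi hj
    by_cases hpv : p = v
    · have hpw : p ≠ w := by rw [hpv]; exact hwv.symm
      rw [hs2 i p hpw hi, hs2 j p hpw hj, hτ2 i j p hpw hi hj]; ring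
    · rw [hs1 i p hpv, hs1 j p hpv, hσ2 i j p hpv hi hj]

end SComplex


namespace SComplex

open Topology Set

theorem cochain_trivial (L : SComplex) (Φ : L.realSpace ≃ₜ S2) (c : ℕ → ℕ → ZMod 2)
    (hc : ∀ x y z, ({x, y, z} : Finset ℕ) ∈ L.faces → c x y + c y z = c x z) :
    ∃ f : ℕ → ZMod 2, ∀ x y, x ≠ y → ({x, y} : Finset ℕ) ∈ L.faces → f y = f x + c x y := by
  classical
  let U : ℕ → Set S2 := fun i => {p | 0 < (Φ.symm p).1 i}
  have hU : ∀ i, IsOpen (U i) := by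
    intro i
    have : Continuous fun p : S2 => (Φ.symm p).1 i :=
      (continuous_apply i).comp (continuous_subtype_val.comp Φ.symm.continuous)
    exact isOpen_lt continuous_const this
  have hcov : ∀ p, ∃ i, p ∈ U i := by
    intro p
    obtain ⟨h0, s, hs, h1, h2⟩ := (Φ.symm p).2
    by_contra hcon
    push Not at hcon
    have : ∑ v ∈ s, (Φ.symm p).1 v ≤ 0 := by
      refine Finset.sum_nonpos fun v _ => ?_
      have := hcon v
      simpa [U] using this
    linarith
  have hcc : ∀ i j k p, p ∈ U i → p ∈ U j → p ∈ U k → c i j + c j k = c i k := by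
    intro i j k p hi hj hk
    obtain ⟨h0, s, hs, h1, h2⟩ := (Φ.symm p).2
    apply hc
    refine L.down_closed s hs _ ?_ (by simp)
    intro v hv
    apply h1
    simp only [Finset.mem_insert, Finset.mem_singleton] at hv
    rcases hv with rfl | rfl | rfl
    exacts [(ne_of_gt hi), (ne_of_gt hj), (ne_of_gt hk)]
  obtain ⟨s, hs1, hs2⟩ := sec_sphere U hU hcov c hcc
  let f : ℕ → ZMod 2 := fun x => if h : (Pi.single x (1 : ℝ) : ℕ → ℝ) ∈ L.realSpace then
    s x (Φ ⟨_, h⟩) else 0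
  refine ⟨f, fun x y hxy hface => ?_⟩
  let g : ℝ → ℕ → ℝ := fun r v => if v = x then 1 - max 0 (min r 1) else
    if v = y then max 0 (min r 1) else 0
  have hg : ∀ r, g r ∈ L.realSpace := by
    intro r
    have h1 : 0 ≤ max 0 (min r 1) := le_max_left _ _
    have h2 : max 0 (min r 1) ≤ 1 := max_le zero_le_one (min_le_right _ _)
    refine ⟨?_, {x, y}, hface, ?_, ?_⟩
    · intro v
      simp only [g]
      split_ifs <;> linarith
    · intro v hv
      simp only [g] at hv
      split_ifs at hv with h3 h4
      · simp [h3]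
      · simp [h4]
      · simp at hv
    · rw [Finset.sum_pair hxy]
      simp [g, hxy.symm]
  let G : ℝ → L.realSpace := fun r => ⟨g r, hg r⟩
  have hGc : Continuous G := by
    refine Continuous.subtype_mk ?_ _
    refine continuous_pi fun v => ?_
    simp only [g]
    split_ifs <;> fun_prop
  have hA : s x (Φ (G 0)) = s x (Φ (G (1/2))) := by
    refine (isPreconnected_Icc (a := (0:ℝ)) (b := 1/2)).constant
      (f := fun r => s x (Φ (G r))) ?_ (by norm_num) (by norm_num)
    refine (hs1 x).comp (Φ.continuous.comp hGc).continuousOn ?_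
    intro r hr
    refine ⟨?_, mem_univ _⟩
    have : (0:ℝ) < 1 - max 0 (min r 1) := by
      have : max 0 (min r 1) ≤ 1/2 := max_le (by norm_num) ((min_le_left _ _).trans hr.2)
      linarith
    simpa [U, G, g] using this
  have hB : s y (Φ (G (1/2))) = s y (Φ (G 1)) := by
    refine (isPreconnected_Icc (a := (1/2:ℝ)) (b := 1)).constant
      (f := fun r => s y (Φ (G r))) ?_ (by norm_num) (by norm_num)
    refine (hs1 y).comp (Φ.continuous.comp hGc).continuousOn ?_
    intro r hr
    refine ⟨?_, mem_univ _⟩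
    have : (0:ℝ) < max 0 (min r 1) := by
      refine lt_max_of_lt_right (lt_min ?_ one_pos)
      linarith [hr.1]
    simpa [U, G, g, hxy.symm] using this
  have hC : s y (Φ (G (1/2))) = s x (Φ (G (1/2))) + c x y := by
    apply hs2 x y _ (mem_univ _)
    · simp [U, G, g]; norm_num
    · simp [U, G, g, hxy.symm]
  have e0 : (Pi.single x (1 : ℝ) : ℕ → ℝ) = g 0 := by
    funext v
    by_cases hv : v = x
    · subst hv; simp [g]
    · simp [g, hv]
  have e1 : (Pi.single y (1 : ℝ) : ℕ → ℝ) = g 1 := by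
    funext v
    by_cases hv : v = y
    · subst hv; simp [g, hxy.symm]
    · simp [g, hv]
  have fx : f x = s x (Φ (G 0)) := by
    have : (Pi.single x (1 : ℝ) : ℕ → ℝ) ∈ L.realSpace := e0 ▸ hg 0
    simp only [f, dif_pos this, G]
    congr 3
  have fy : f y = s y (Φ (G 1)) := by
    have : (Pi.single y (1 : ℝ) : ℕ → ℝ) ∈ L.realSpace := e1 ▸ hg 1
    simp only [f, dif_pos this, G]
    congr 3
  rw [fx, fy, ← hB, hC, hA]

/-- Faces of a given size, as a type. -/
abbrev LF (L : SComplex) (k : ℕ) := {τ // τ ∈ L.faces.filter fun τ => τ.card = k}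

/-- Every 3-cycle in the one-skeleton of a triangulated 2-sphere bounds mod 2. -/
theorem triangle_bounds (L : SComplex) (Φ : L.realSpace ≃ₜ S2) (a b c : ℕ)
    (hab : a ≠ b) (hbc : b ≠ c) (hca : c ≠ a) (hab' : ({a, b} : Finset ℕ) ∈ L.faces)
    (hbc' : ({b, c} : Finset ℕ) ∈ L.faces) (hca' : ({c, a} : Finset ℕ) ∈ L.faces) :
    ∃ T : Finset (Finset ℕ), ∀ e ∈ L.faces, e.card = 2 →
      (∑ τ ∈ L.faces with (τ.card = 3 ∧ e ⊆ τ), (if τ ∈ T then (1 : ZMod 2) else 0)) =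
        if e = {a, b} ∨ e = {b, c} ∨ e = {c, a} then 1 else 0 := by
  classical
  let δ : (L.LF 2 → ZMod 2) →ₗ[ZMod 2] (L.LF 3 → ZMod 2) :=
    { toFun := fun g τ => ∑ e : L.LF 2, if e.1 ⊆ τ.1 then g e else 0
      map_add' := by
        intro g g'
        funext τ
        simp only [Pi.add_apply, ← Finset.sum_add_distrib]
        refine Finset.sum_congr rfl fun e _ => ?_
        split_ifs <;> simp
      map_smul' := by
        intro r g
        funext τ
        simp only [Pi.smul_apply, smul_eq_mul, Finset.mul_sum, RingHom.id_apply]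
        refine Finset.sum_congr rfl fun e _ => ?_
        split_ifs <;> simp }
  let ε : ∀ x y, ({x, y} : Finset ℕ) ∈ L.faces → x ≠ y → L.LF 2 := fun x y h h' =>
    ⟨{x, y}, by simp [h, Finset.card_pair h']⟩
  let φ : Module.Dual (ZMod 2) (L.LF 2 → ZMod 2) :=
    LinearMap.proj (R := ZMod 2) (φ := fun _ : L.LF 2 => ZMod 2) (ε a b hab' hab) + LinearMap.proj (R := ZMod 2) (φ := fun _ : L.LF 2 => ZMod 2) (ε b c hbc' hbc) +
      LinearMap.proj (R := ZMod 2) (φ := fun _ : L.LF 2 => ZMod 2) (ε c a hca' hca)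
  have hφ : φ ∈ (LinearMap.ker δ).dualAnnihilator := by
    rw [Submodule.mem_dualAnnihilator]
    intro g hg
    rw [LinearMap.mem_ker] at hg
    let c' : ℕ → ℕ → ZMod 2 := fun x y => if h : ({x, y} : Finset ℕ) ∈ L.faces ∧ x ≠ y then
      g (ε x y h.1 h.2) else 0
    have cxx : ∀ x, c' x x = 0 := fun x => by simp [c']
    have csymm : ∀ x y, c' x y = c' y x := by
      intro x y
      by_cases h : ({x, y} : Finset ℕ) ∈ L.faces ∧ x ≠ y
      · have h' : ({y, x} : Finset ℕ) ∈ L.faces ∧ y ≠ x := ⟨by rw [Finset.pair_comm]; exact h.1, h.2.symm⟩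
        simp only [c', dif_pos h, dif_pos h']
        congr 1
        exact Subtype.ext (Finset.pair_comm x y)
      · have h' : ¬ (({y, x} : Finset ℕ) ∈ L.faces ∧ y ≠ x) := by
          rintro ⟨h1, h2⟩
          exact h ⟨by rw [Finset.pair_comm]; exact h1, h2.symm⟩
        simp only [c', dif_neg h, dif_neg h']
    have z2 : ∀ r : ZMod 2, r + r = 0 := by decide
    have hcc : ∀ x y z, ({x, y, z} : Finset ℕ) ∈ L.faces → c' x y + c' y z = c' x z := by
      intro x y z h
      by_cases hxy : x = y
      · subst hxy; simp [cxx]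
      by_cases hyz : y = z
      · subst hyz; simp [cxx]
      by_cases hxz : x = z
      · subst hxz; rw [csymm y x, cxx, z2]
      have ht3 : ({x, y, z} : Finset ℕ).card = 3 := by
        rw [Finset.card_eq_three]; exact ⟨x, y, z, hxy, hxz, hyz, rfl⟩
      have h1 : ({x, y} : Finset ℕ) ∈ L.faces :=
        L.down_closed _ h _ (by intro v; simp; tauto) (by simp)
      have h2 : ({y, z} : Finset ℕ) ∈ L.faces :=
        L.down_closed _ h _ (by intro v; simp; tauto) (by simp)
      have h3 : ({x, z} : Finset ℕ) ∈ L.faces :=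
        L.down_closed _ h _ (by intro v; simp; tauto) (by simp)
      have hτ := congrFun hg ⟨{x, y, z}, by simp [h, ht3]⟩
      change (∑ e : L.LF 2, if e.1 ⊆ ({x, y, z} : Finset ℕ) then g e else 0) = 0 at hτ
      rw [← Finset.sum_filter] at hτ
      have hset : (Finset.univ.filter fun e : L.LF 2 => e.1 ⊆ ({x, y, z} : Finset ℕ)) =
          {ε x y h1 hxy, ε y z h2 hyz, ε x z h3 hxz} := by
        ext e
        obtain ⟨e, he⟩ := e
        rw [Finset.mem_filter] at he
        simp only [Finset.mem_filter, Finset.mem_univ, true_and, Finset.mem_insert,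
          Finset.mem_singleton, ε, Subtype.mk.injEq]
        constructor
        · intro hsub
          obtain ⟨p, q, hpq, rfl⟩ := Finset.card_eq_two.1 he.2
          have hp : p ∈ ({x, y, z} : Finset ℕ) := hsub (by simp)
          have hq : q ∈ ({x, y, z} : Finset ℕ) := hsub (by simp)
          simp only [Finset.mem_insert, Finset.mem_singleton] at hp hq
          rcases hp with rfl | rfl | rfl <;> rcases hq with rfl | rfl | rfl <;>
            simp_all [Finset.pair_comm]
        · rintro (rfl | rfl | rfl) <;> intro v <;> simp <;> tauto
      rw [hset, Finset.sum_insert, Finset.sum_insert, Finset.sum_singleton] at hτ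
      · simp only [c', dif_pos (And.intro h1 hxy), dif_pos (And.intro h2 hyz),
          dif_pos (And.intro h3 hxz)]
        have := z2 (g (ε x z h3 hxz))
        linear_combination hτ - this
      · simp only [Finset.mem_singleton, ε, Subtype.mk.injEq]
        intro hh
        have : y ∈ ({x, z} : Finset ℕ) := hh ▸ (by simp)
        simp at this; tauto
      · simp only [Finset.mem_insert, Finset.mem_singleton, ε, Subtype.mk.injEq]
        rintro (hh | hh)
        · have : x ∈ ({y, z} : Finset ℕ) := hh ▸ (by simp)
          simp at this; tauto
        · have : y ∈ ({x, z} : Finset ℕ) := hh ▸ (by simp)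
          simp at this; tauto
    obtain ⟨f, hf⟩ := cochain_trivial L Φ c' hcc
    have e1 := hf a b hab hab'
    have e2 := hf b c hbc hbc'
    have e3 := hf c a hca hca'
    simp only [c', dif_pos (And.intro hab' hab)] at e1
    simp only [c', dif_pos (And.intro hbc' hbc)] at e2
    simp only [c', dif_pos (And.intro hca' hca)] at e3
    change g (ε a b hab' hab) + g (ε b c hbc' hbc) + g (ε c a hca' hca) = 0
    linear_combination -e1 - e2 - e3
  rw [← LinearMap.range_dualMap_eq_dualAnnihilator_ker] at hφ
  obtain ⟨ψ, hψ⟩ := hφ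
  refine ⟨L.faces.filter fun τ => ∃ h : τ.card = 3 ∧ τ ∈ L.faces,
    ψ (Pi.single ⟨τ, by simp [h.1, h.2]⟩ 1) = 1, ?_⟩
  intro e he he2
  let E : L.LF 2 := ⟨e, by simp [he, he2]⟩
  have key : ψ (δ (Pi.single E 1)) = φ (Pi.single E 1) := by rw [← hψ]; rfl
  have hR : φ (Pi.single E 1) = if e = {a, b} ∨ e = {b, c} ∨ e = {c, a} then 1 else 0 := by
    change (Pi.single E 1 : L.LF 2 → ZMod 2) (ε a b hab' hab) + (Pi.single E 1 : L.LF 2 → ZMod 2) (ε b c hbc' hbc) +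
      (Pi.single E 1 : L.LF 2 → ZMod 2) (ε c a hca' hca) = _
    have n1 : ({a, b} : Finset ℕ) ≠ {b, c} := by
      intro hh
      have : a ∈ ({b, c} : Finset ℕ) := hh ▸ (by simp)
      simp at this; tauto
    have n2 : ({b, c} : Finset ℕ) ≠ {c, a} := by
      intro hh
      have : b ∈ ({c, a} : Finset ℕ) := hh ▸ (by simp)
      simp at this; tauto
    have n3 : ({a, b} : Finset ℕ) ≠ {c, a} := by
      intro hh
      have : b ∈ ({c, a} : Finset ℕ) := hh ▸ (by simp)
      simp at this; tauto
    simp only [Pi.single_apply, E, ε, Subtype.mk.injEq]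
    by_cases q1 : e = {a, b}
    · subst q1; simp [n1.symm, n3.symm]
    by_cases q2 : e = {b, c}
    · subst q2; simp [n1, n2.symm]
    by_cases q3 : e = {c, a}
    · subst q3; simp [n3, n2]
    · simp [q1, q2, q3, Ne.symm q1, Ne.symm q2, Ne.symm q3]
  have hL : ψ (δ (Pi.single E 1)) = ∑ τ : L.LF 3, (if e ⊆ τ.1 then ψ (Pi.single τ 1) else 0) := by
    have : δ (Pi.single E 1) = ∑ τ : L.LF 3, (if e ⊆ τ.1 then (1 : ZMod 2) else 0) • (Pi.single τ 1 : L.LF 3 → ZMod 2) := by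
      funext τ
      rw [Finset.sum_apply]
      simp only [Pi.smul_apply, Pi.single_apply, smul_eq_mul, mul_ite, mul_one, mul_zero,
        Finset.sum_ite_eq, Finset.mem_univ, if_true]
      change (∑ e' : L.LF 2, if e'.1 ⊆ τ.1 then (Pi.single E 1 : L.LF 2 → ZMod 2) e' else 0) = _
      rw [Finset.sum_eq_single E]
      · simp [E]
      · intro b _ hb; simp [hb]
      · simp
    rw [this, map_sum]
    refine Finset.sum_congr rfl fun τ _ => ?_
    rw [map_smul]
    split_ifs <;> simp
  rw [← Finset.sum_filter] at hL
  rw [← hR, ← key, hL]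
  refine Finset.sum_bij' (i := fun τ hτ => (⟨τ, by
      simp only [Finset.mem_filter] at hτ ⊢; exact ⟨hτ.1, hτ.2.1⟩⟩ : L.LF 3))
    (j := fun τ _ => τ.1) ?_ ?_ ?_ ?_ ?_
  · intro τ hτ
    simp only [Finset.mem_filter] at hτ
    simp [hτ.2.2]
  · intro τ hτ
    have h1 := τ.2
    simp only [Finset.mem_filter, Finset.mem_univ, true_and] at hτ h1 ⊢
    exact ⟨h1.1, h1.2, hτ⟩
  · intro τ hτ; rfl
  · intro τ hτ; rfl
  · intro τ hτ
    simp only [Finset.mem_filter] at hτ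
    have z2 : ∀ r : ZMod 2, r ≠ 1 → r = 0 := by decide
    split_ifs with h
    · rw [Finset.mem_filter] at h
      obtain ⟨_, _, h⟩ := h
      exact h.symm
    · rw [Finset.mem_filter] at h
      refine (z2 _ fun hh => h ⟨hτ.1, ⟨hτ.2.1, hτ.1⟩, hh⟩).symm

end SComplex


namespace SComplex

/-- Closure form of connectedness of the link of `s` in the face set `F`. -/
def CC (F : Finset (Finset ℕ)) (s : Finset ℕ) : Prop :=
  ∀ (P : ℕ → Prop) (x y : ℕ), x ∉ s → y ∉ s → insert x s ∈ F → insert y s ∈ F →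
    (∀ p q, p ∉ s → q ∉ s → P p → insert p (insert q s) ∈ F → P q) → P x → P y

/-- Working form of the axioms of normal 3-pseudomanifolds. -/
structure NP (F : Finset (Finset ℕ)) : Prop where
  ne : F.Nonempty
  emp : ∅ ∉ F
  down : ∀ s ∈ F, ∀ t ⊆ s, t ≠ ∅ → t ∈ F
  pure : ∀ s ∈ F, ∃ G ∈ F, s ⊆ G ∧ G.card = 4
  le4 : ∀ s ∈ F, s.card ≤ 4
  two : ∀ s ∈ F, s.card = 3 →
    ∃ p q, p ≠ q ∧ ∀ x, (x ∉ s ∧ insert x s ∈ F) ↔ (x = p ∨ x = q)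
  cc : ∀ s, (s = ∅ ∨ s ∈ F) → s.card ≤ 2 → CC F s

theorem conn_of_CC {K : SComplex} {s : Finset ℕ} (h : CC K.faces s)
    (hne : ∃ x, x ∉ s ∧ insert x s ∈ K.faces) :
    (K.lk s).Conn := by
  classical
  have hv : ∀ u, {u} ∈ (K.lk s).faces ↔ u ∉ s ∧ insert u s ∈ K.faces := by
    intro u
    simp only [lk, Finset.mem_filter, Finset.singleton_inter, Finset.insert_eq]
    constructor
    · rintro ⟨h1, h2, h3⟩
      refine ⟨fun h => by simp [h] at h2, h3⟩
    · rintro ⟨h1, h2⟩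
      refine ⟨K.down_closed _ h2 _ (by intro; simp; tauto) (by simp), by simp [h1], h2⟩
  refine ⟨?_, ?_⟩
  · obtain ⟨x, hx⟩ := hne
    exact ⟨{x}, (hv x).2 hx⟩
  · intro u v hu hv'
    rw [hv] at hu hv'
    refine h (fun z => Relation.ReflTransGen (K.lk s).VertAdj u z) u v hu.1 hv'.1 hu.2 hv'.2 ?_
      Relation.ReflTransGen.refl
    intro p q hp hq h1 h2
    refine h1.tail ?_
    simp only [VertAdj, lk, Finset.mem_filter]
    have e : ({p, q} : Finset ℕ) ∪ s = insert p (insert q s) := by ext; simp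
    refine ⟨K.down_closed _ h2 _ (by intro; simp; tauto) (by simp), ?_, e ▸ h2⟩
    ext z
    simp only [Finset.mem_inter, Finset.mem_insert, Finset.mem_singleton, Finset.notMem_empty,
      iff_false, not_and]
    rintro (rfl | rfl) <;> assumption

theorem CC_of_conn {K : SComplex} {s : Finset ℕ} (h : (K.lk s).Conn) : CC K.faces s := by
  classical
  intro P x y hx hy hxs hys hcl hPx
  have hv : ∀ u, u ∉ s → insert u s ∈ K.faces → {u} ∈ (K.lk s).faces := by
    intro u h1 h2
    simp only [lk, Finset.mem_filter]
    refine ⟨K.down_closed _ h2 _ (by intro; simp; tauto) (by simp), by simp [h1], ?_⟩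
    rwa [← Finset.insert_eq]
  have := h.2 x y (hv x hx hxs) (hv y hy hys)
  clear hy hys
  induction this with
  | refl => exact hPx
  | tail hh0 h2 ih =>
    rename_i b c
    simp only [VertAdj, lk, Finset.mem_filter] at h2
    have e : ({b, c} : Finset ℕ) ∪ s = insert b (insert c s) := by ext; simp
    have hb : b ∉ s := by
      intro hb
      have : b ∈ ({b, c} : Finset ℕ) ∩ s := by simp [hb]
      rw [h2.2.1] at this; simp at this
    have hc : c ∉ s := by
      intro hb
      have : c ∈ ({b, c} : Finset ℕ) ∩ s := by simp [hb]
      rw [h2.2.1] at this; simp at this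
    exact hcl b c hb hc ih (e ▸ h2.2.2)

theorem two_iff {F : Finset (Finset ℕ)} {s : Finset ℕ} (hs : s.card = 3) :
    (F.filter fun G => G.card = 3 + 1 ∧ s ⊆ G).card = 2 ↔
    ∃ p q, p ≠ q ∧ ∀ x, (x ∉ s ∧ insert x s ∈ F) ↔ (x = p ∨ x = q) := by
  classical
  have key : ∀ G, G.card = 3 + 1 → s ⊆ G → ∃ x, x ∉ s ∧ G = insert x s := by
    intro G h1 h2
    have : (G \ s).card = 1 := by rw [Finset.card_sdiff_of_subset h2]; omega
    obtain ⟨x, hx⟩ := Finset.card_eq_one.1 this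
    refine ⟨x, ?_, ?_⟩
    · have : x ∈ G \ s := by simp [hx]
      exact (Finset.mem_sdiff.1 this).2
    · rw [← Finset.sdiff_union_of_subset h2, hx, Finset.insert_eq]
  have inj : ∀ x y, x ∉ s → insert x s = insert y s → x = y := by
    intro x y hx h
    have : x ∈ insert y s := h ▸ Finset.mem_insert_self x s
    rcases Finset.mem_insert.1 this with h | h
    · exact h
    · exact absurd h hx
  constructor
  · intro h
    obtain ⟨A, B, hAB, hE⟩ := Finset.card_eq_two.1 h
    have hA : A ∈ F.filter fun G => G.card = 3 + 1 ∧ s ⊆ G := by rw [hE]; simp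
    have hB : B ∈ F.filter fun G => G.card = 3 + 1 ∧ s ⊆ G := by rw [hE]; simp
    simp only [Finset.mem_filter] at hA hB
    obtain ⟨p, hp, rfl⟩ := key A hA.2.1 hA.2.2
    obtain ⟨q, hq, rfl⟩ := key B hB.2.1 hB.2.2
    refine ⟨p, q, fun h => hAB (by rw [h]), fun x => ⟨?_, ?_⟩⟩
    · rintro ⟨hx, hxF⟩
      have : insert x s ∈ F.filter fun G => G.card = 3 + 1 ∧ s ⊆ G := by
        simp [hxF, Finset.card_insert_of_notMem hx, hs]
      rw [hE] at this
      simp only [Finset.mem_insert, Finset.mem_singleton] at this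
      rcases this with h | h
      · exact Or.inl (inj _ _ hx h)
      · exact Or.inr (inj _ _ hx h)
    · rintro (rfl | rfl)
      exacts [⟨hp, hA.1⟩, ⟨hq, hB.1⟩]
  · rintro ⟨p, q, hpq, h⟩
    have hp := (h p).2 (Or.inl rfl)
    have hq := (h q).2 (Or.inr rfl)
    rw [Finset.card_eq_two]
    refine ⟨insert p s, insert q s, fun hh => hpq (inj _ _ hp.1 hh), ?_⟩
    ext G
    simp only [Finset.mem_filter, Finset.mem_insert, Finset.mem_singleton]
    constructor
    · rintro ⟨h1, h2, h3⟩
      obtain ⟨x, hx, rfl⟩ := key G h2 h3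
      rcases (h x).1 ⟨hx, h1⟩ with rfl | rfl <;> simp
    · rintro (rfl | rfl)
      · exact ⟨hp.2, by rw [Finset.card_insert_of_notMem hp.1, hs], Finset.subset_insert _ _⟩
      · exact ⟨hq.2, by rw [Finset.card_insert_of_notMem hq.1, hs], Finset.subset_insert _ _⟩

theorem facet_iff {K : SComplex} (h : NP K.faces) (s : Finset ℕ) :
    K.IsFacet s ↔ s ∈ K.faces ∧ s.card = 4 := by
  constructor
  · rintro ⟨h1, h2⟩
    obtain ⟨G, hG, hsG, hc⟩ := h.pure s h1
    rw [h2 G hG hsG]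
    exact ⟨hG, hc⟩
  · rintro ⟨h1, h2⟩
    refine ⟨h1, fun t ht hst => Finset.eq_of_subset_of_card_le hst ?_⟩
    rw [h2]; exact h.le4 t ht

theorem exists_bigger {F : Finset (Finset ℕ)} (h : NP F) {s : Finset ℕ} (hs : s ∈ F ∨ s = ∅)
    (hc : s.card ≤ 3) : ∃ x, x ∉ s ∧ insert x s ∈ F := by
  have : ∃ G ∈ F, s ⊆ G ∧ G.card = 4 := by
    rcases hs with hs | rfl
    · exact h.pure s hs
    · obtain ⟨s, hs⟩ := h.ne
      obtain ⟨G, h1, _, h2⟩ := h.pure s hs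
      exact ⟨G, h1, Finset.empty_subset _, h2⟩
  obtain ⟨G, hG, hsG, hG4⟩ := this
  obtain ⟨x, hx, hxs⟩ := Finset.exists_mem_notMem_of_card_lt_card (s := s) (t := G) (by omega)
  exact ⟨x, hxs, h.down G hG _ (Finset.insert_subset hx hsG) (by simp)⟩

theorem normal_of_NP {K : SComplex} (h : NP K.faces) : K.IsNormalPseudomanifold 3 := by
  classical
  have chain : ∀ n s, 4 = s.card + n + 1 → (s = ∅ ∨ s ∈ K.faces) →
      ∀ A B, A ∈ K.faces → B ∈ K.faces → A.card = 4 → B.card = 4 →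
      s ⊆ A → s ⊆ B → Relation.ReflTransGen K.FacetAdj A B := by
    intro n
    induction n with
    | zero =>
      intro s hs _ A B hA hB hA4 hB4 hsA hsB
      by_cases hAB : A = B
      · rw [hAB]
      · refine Relation.ReflTransGen.single ⟨(facet_iff h A).2 ⟨hA, hA4⟩,
          (facet_iff h B).2 ⟨hB, hB4⟩, ?_⟩
        have h1 : s.card ≤ (A ∩ B).card := Finset.card_le_card (Finset.subset_inter hsA hsB)
        have h2 : (A ∩ B).card < A.card := by
          refine Finset.card_lt_card (Finset.ssubset_iff_subset_ne.2 ⟨Finset.inter_subset_left, ?_⟩)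
          intro hh
          exact hAB (Finset.eq_of_subset_of_card_le (Finset.inter_eq_left.1 hh) (by omega))
        omega
    | succ n ih =>
      intro s hs hs0 A B hA hB hA4 hB4 hsA hsB
      obtain ⟨x, hxA, hxs⟩ := Finset.exists_mem_notMem_of_card_lt_card (s := s) (t := A) (by omega)
      obtain ⟨y, hyB, hys⟩ := Finset.exists_mem_notMem_of_card_lt_card (s := s) (t := B) (by omega)
      have up : ∀ z, z ∉ s → ∀ C D, C ∈ K.faces → D ∈ K.faces → C.card = 4 → D.card = 4 →
          insert z s ⊆ C → insert z s ⊆ D → Relation.ReflTransGen K.FacetAdj C D := by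
        intro z hz C D hC hD hC4 hD4 hzC hzD
        exact ih (insert z s) (by rw [Finset.card_insert_of_notMem hz]; omega)
          (Or.inr (K.down_closed C hC _ hzC (by simp))) C D hC hD hC4 hD4 hzC hzD
      have := h.cc s hs0 (by omega) (fun z => ∀ C ∈ K.faces, C.card = 4 → insert z s ⊆ C →
        Relation.ReflTransGen K.FacetAdj A C) x y hxs hys
        (K.down_closed A hA _ (Finset.insert_subset hxA hsA) (by simp))
        (K.down_closed B hB _ (Finset.insert_subset hyB hsB) (by simp)) ?_ ?_
      · exact this B hB hB4 (Finset.insert_subset hyB hsB)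
      · intro p q hp hq hP hpq C hC hC4 hqC
        obtain ⟨G, hG, hpG, hG4⟩ := h.pure _ hpq
        have h1 := hP G hG hG4 (fun z hz => hpG (by simp at hz ⊢; tauto))
        exact h1.trans (up q hq G C hG hC hG4 hC4 (fun z hz => hpG (by simp at hz ⊢; tauto)) hqC)
      · intro C hC hC4 hxC
        exact up x hxs A C hA hC hA4 hC4 (Finset.insert_subset hxA hsA) hxC
  refine ⟨⟨h.ne, fun s hs => ((facet_iff h s).1 hs).2⟩, ?_, ?_, ?_⟩
  · intro A B hA hB
    rw [facet_iff h] at hA hB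
    exact chain 3 ∅ (by simp) (Or.inl rfl) A B hA.1 hB.1 hA.2 hB.2 (by simp) (by simp)
  · intro s hs hs3
    exact (two_iff hs3).2 (h.two s hs hs3)
  · intro s hs hs2
    exact conn_of_CC (h.cc s (Or.inr hs) hs2) (exists_bigger h (Or.inl hs) (by omega))

theorem NP_of_normal {K : SComplex} (h : K.IsNormalPseudomanifold 3) : NP K.faces := by
  classical
  obtain ⟨⟨hne, hpure⟩, hsc, htwo, hconn⟩ := h
  have up : ∀ s ∈ K.faces, ∃ G, K.IsFacet G ∧ s ⊆ G := by
    intro s hs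
    obtain ⟨G, hG, hmax⟩ := Finset.exists_max_image (K.faces.filter fun G => s ⊆ G) Finset.card
      ⟨s, by simp [hs]⟩
    rw [Finset.mem_filter] at hG
    refine ⟨G, ⟨hG.1, fun t ht hGt => ?_⟩, hG.2⟩
    exact Finset.eq_of_subset_of_card_le hGt (hmax t (by simp [ht, hG.2.trans hGt]))
  have hp : ∀ s ∈ K.faces, ∃ G ∈ K.faces, s ⊆ G ∧ G.card = 4 := by
    intro s hs
    obtain ⟨G, hG, hsG⟩ := up s hs
    exact ⟨G, hG.1, hsG, hpure G hG⟩
  refine ⟨hne, K.not_empty_mem, K.down_closed, hp, ?_, ?_, ?_⟩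
  · intro s hs
    obtain ⟨G, hG, hsG, h4⟩ := hp s hs
    rw [← h4]; exact Finset.card_le_card hsG
  · intro s hs hs3
    exact (two_iff hs3).1 (htwo s hs hs3)
  · rintro s (rfl | hs) hs2
    · intro P x y _ _ hx hy hcl hPx
      obtain ⟨A, hA, hxA⟩ := up _ hx
      obtain ⟨B, hB, hyB⟩ := up _ hy
      have step : ∀ G ∈ K.faces, ∀ p ∈ G, ∀ q ∈ G, P p → P q := by
        intro G hG p hp q hq hPp
        refine hcl p q (by simp) (by simp) hPp (K.down_closed G hG _ ?_ (by simp))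
        intro z hz
        simp at hz
        rcases hz with rfl | rfl <;> assumption
      have : ∀ z ∈ B, P z := by
        have hAB := hsc A B hA hB
        clear hB hyB
        induction hAB with
        | refl => exact fun z hz => step A hA.1 x (hxA (by simp)) z hz hPx
        | tail hh0 h2 ih =>
          rename_i C D
          obtain ⟨hC, hD, hCD⟩ := h2
          have : (C ∩ D).Nonempty := by
            rw [← Finset.card_pos]
            have := hpure C hC
            omega
          obtain ⟨p, hp⟩ := this
          rw [Finset.mem_inter] at hp
          exact fun z hz => step D hD.1 p hp.2 z hz (ih p hp.1)
      exact this y (hyB (by simp))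
    · exact CC_of_conn (hconn s hs hs2)

end SComplex


namespace SComplex

/-- A triangle of the link of `w`. -/
def Tri (F : Finset (Finset ℕ)) (w : ℕ) (τ : Finset ℕ) : Prop :=
  τ.card = 3 ∧ w ∉ τ ∧ insert w τ ∈ F

/-- Data for splitting the vertex `w` along the triangle `Δ`. -/
structure Split (F : Finset (Finset ℕ)) (w : ℕ) (Δ : Finset ℕ) (n : Bool → ℕ)
    (col : Finset ℕ → Bool) : Prop where
  np : NP F
  card : Δ.card = 3
  nF : Δ ∉ F
  fresh : ∀ i, ∀ s ∈ F, n i ∉ s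
  ninj : ∀ i j, n i = n j → i = j
  B1 : ∀ e τ τ', e.card = 2 → ¬ e ⊆ Δ → e ⊆ τ → e ⊆ τ' → Tri F w τ → Tri F w τ' → col τ = col τ'
  B2 : ∀ e, e ⊆ Δ → e.card = 2 → ∀ i, ∃ τ, Tri F w τ ∧ e ⊆ τ ∧ col τ = i

namespace Split

variable {F : Finset (Finset ℕ)} {w : ℕ} {Δ : Finset ℕ} {n : Bool → ℕ} {col : Finset ℕ → Bool}

/-- Faces of the `i`-th side of the link of `w`. -/
def X (F : Finset (Finset ℕ)) (w : ℕ) (col : Finset ℕ → Bool) (i : Bool) (s : Finset ℕ) : Prop :=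
  ∃ τ, Tri F w τ ∧ col τ = i ∧ s ⊆ τ

/-- Membership in the complex after splitting and the bistellar move. -/
def Mem' (F : Finset (Finset ℕ)) (w : ℕ) (Δ : Finset ℕ) (n : Bool → ℕ)
    (col : Finset ℕ → Bool) (s : Finset ℕ) : Prop :=
  s ≠ ∅ ∧ ((∃ G ∈ F, G.card = 4 ∧ w ∉ G ∧ s ⊆ G) ∨
    ∃ i τ, ((Tri F w τ ∧ col τ = i) ∨ τ = Δ) ∧ s ⊆ insert (n i) τ)

theorem exists_e (S : Split F w Δ n col) {s : Finset ℕ} (h : s ⊆ Δ) (h' : s ≠ Δ) :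
    ∃ e, s ⊆ e ∧ e ⊆ Δ ∧ e.card = 2 := by
  have : s.card < 3 := by
    rw [← S.card]
    exact Finset.card_lt_card (Finset.ssubset_iff_subset_ne.2 ⟨h, h'⟩)
  obtain ⟨e, h1, h2, h3⟩ := Finset.exists_subsuperset_card_eq h (n := 2) (by omega)
    (by rw [S.card]; omega)
  exact ⟨e, h1, h2, h3⟩

theorem Xproper (S : Split F w Δ n col) {s : Finset ℕ} (h : s ⊆ Δ) (h' : s ≠ Δ) (i : Bool) :
    X F w col i s := by
  obtain ⟨e, h1, h2, h3⟩ := S.exists_e h h'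
  obtain ⟨τ, h4, h5, h6⟩ := S.B2 e h2 h3 i
  exact ⟨τ, h4, h6, h1.trans h5⟩

theorem Xmono {s s' : Finset ℕ} {i : Bool} (h : X F w col i s') (hs : s ⊆ s') :
    X F w col i s := by
  obtain ⟨τ, h1, h2, h3⟩ := h
  exact ⟨τ, h1, h2, hs.trans h3⟩

theorem XF (S : Split F w Δ n col) {s : Finset ℕ} {i : Bool} (h : X F w col i s) :
    w ∉ s ∧ insert w s ∈ F := by
  obtain ⟨τ, h1, h2, h3⟩ := h
  refine ⟨fun hw => h1.2.1 (h3 hw), S.np.down _ h1.2.2 _ (Finset.insert_subset_insert _ h3) (by simp)⟩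

theorem XF0 (S : Split F w Δ n col) {s : Finset ℕ} {i : Bool} (h : X F w col i s) (hs : s ≠ ∅) :
    s ∈ F :=
  S.np.down _ (S.XF h).2 _ (Finset.subset_insert _ _) hs

theorem FX (S : Split F w Δ n col) {s : Finset ℕ} (hw : w ∉ s) (h : insert w s ∈ F) :
    ∃ i, X F w col i s := by
  obtain ⟨G, hG, hsG, hc⟩ := S.np.pure _ h
  have hwG : w ∈ G := hsG (by simp)
  refine ⟨col (G.erase w), G.erase w, ⟨?_, by simp, ?_⟩, rfl, ?_⟩
  · rw [Finset.card_erase_of_mem hwG]; omega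
  · rwa [Finset.insert_erase hwG]
  · intro z hz
    rw [Finset.mem_erase]
    exact ⟨fun h => hw (h ▸ hz), hsG (by simp [hz])⟩

theorem Xtri {s : Finset ℕ} {i : Bool} (hs : s.card = 3) :
    X F w col i s ↔ Tri F w s ∧ col s = i := by
  constructor
  · rintro ⟨τ, h1, h2, h3⟩
    have : s = τ := Finset.eq_of_subset_of_card_le h3 (by rw [hs, h1.1])
    subst this
    exact ⟨h1, h2⟩
  · rintro ⟨h1, h2⟩
    exact ⟨s, h1, h2, Finset.Subset.refl _⟩

theorem Xle {s : Finset ℕ} {i : Bool} (h : X F w col i s) : s.card ≤ 3 := by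
  obtain ⟨τ, h1, h2, h3⟩ := h
  rw [← h1.1]; exact Finset.card_le_card h3

theorem Xboth (S : Split F w Δ n col) {s : Finset ℕ} {i j : Bool} (hi : X F w col i s)
    (hj : X F w col j s) (hij : i ≠ j) : s ⊆ Δ ∧ s ≠ Δ := by
  classical
  refine ⟨?_, ?_⟩
  swap
  · rintro rfl
    exact S.nF (S.XF0 hi (by rintro h; have := S.card; rw [h] at this; simp at this))
  by_contra hcon
  have h3 := Xle hi
  obtain ⟨τ, h1, h2, h4⟩ := hi
  obtain ⟨τ', h1', h2', h4'⟩ := hj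
  have hne : s ≠ ∅ := by rintro rfl; simp at hcon
  have hpos : 0 < s.card := Finset.card_pos.2 (Finset.nonempty_iff_ne_empty.2 hne)
  rcases (by omega : s.card = 1 ∨ s.card = 2 ∨ s.card = 3) with hc | hc | hc
  · obtain ⟨x, rfl⟩ := Finset.card_eq_one.1 hc
    have hxΔ : x ∉ Δ := by simpa using hcon
    have hxτ : x ∈ τ := by simpa using h4
    have hxτ' : x ∈ τ' := by simpa using h4'
    obtain ⟨y, hyτ, hyx⟩ : ∃ y ∈ τ, y ≠ x := by
      obtain ⟨y, hy, hyx⟩ := Finset.exists_mem_notMem_of_card_lt_card (s := {x}) (t := τ) (by simp [h1.1])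
      exact ⟨y, hy, by simpa using hyx⟩
    obtain ⟨y', hyτ', hyx'⟩ : ∃ y ∈ τ', y ≠ x := by
      obtain ⟨y, hy, hyx⟩ := Finset.exists_mem_notMem_of_card_lt_card (s := {x}) (t := τ') (by simp [h1'.1])
      exact ⟨y, hy, by simpa using hyx⟩
    have hwx : w ≠ x := by rintro rfl; exact h1.2.1 hxτ
    have hface : ({w, x} : Finset ℕ) ∈ F := S.np.down _ h1.2.2 _
      (by intro z; simp; rintro (rfl | rfl) <;> simp [hxτ]) (by simp)
    have same : ∀ z τ₁ τ₂, z ≠ x → x ∈ τ₁ → z ∈ τ₁ → x ∈ τ₂ → z ∈ τ₂ → Tri F w τ₁ → Tri F w τ₂ →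
        col τ₁ = col τ₂ := by
      intro z τ₁ τ₂ hz h1 h2 h3 h4 h5 h6
      refine S.B1 {x, z} τ₁ τ₂ (Finset.card_pair hz.symm) (fun h => hxΔ (h (by simp))) ?_ ?_ h5 h6
      · intro t; simp; rintro (rfl | rfl) <;> assumption
      · intro t; simp; rintro (rfl | rfl) <;> assumption
    have := S.np.cc {w, x} (Or.inr hface) Finset.card_le_two
      (fun z => ∀ τ₁, Tri F w τ₁ → x ∈ τ₁ → z ∈ τ₁ → col τ₁ = i) y y'
      (by simp [hyx]; rintro rfl; exact h1.2.1 hyτ) (by simp [hyx']; rintro rfl; exact h1'.2.1 hyτ')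
      (S.np.down _ h1.2.2 _ (by intro z; simp; rintro (rfl | rfl | rfl) <;> simp [*]) (by simp))
      (S.np.down _ h1'.2.2 _ (by intro z; simp; rintro (rfl | rfl | rfl) <;> simp [*]) (by simp))
      ?_ ?_ τ' h1' hxτ' hyτ'
    · exact hij (this.symm.trans h2')
    · intro p q hp hq hP hpq τ₁ ht1 hx1 hq1
      simp only [Finset.mem_insert, Finset.mem_singleton, not_or] at hp hq
      have : insert p (insert q ({w, x} : Finset ℕ)) = insert w {p, q, x} := by
        ext; simp; tauto
      rw [this] at hpq
      by_cases hpq' : p = q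
      · subst hpq'; exact hP τ₁ ht1 hx1 hq1
      have ht : Tri F w {p, q, x} := by
        refine ⟨Finset.card_eq_three.2 ⟨p, q, x, hpq', hp.2, hq.2, rfl⟩, ?_, hpq⟩
        simp; exact ⟨Ne.symm hp.1, Ne.symm hq.1, hwx⟩
      rw [← hP _ ht (by simp) (by simp)]
      exact same q τ₁ _ hq.2 hx1 hq1 (by simp) (by simp) ht1 ht
    · intro τ₁ ht1 hx1 hy1
      rw [← h2]
      exact same y τ₁ τ hyx hx1 hy1 hxτ hyτ ht1 h1
  · exact hij (h2.symm.trans ((S.B1 s τ τ' hc hcon h4 h4' h1 h1').trans h2'))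
  · have e1 := Finset.eq_of_subset_of_card_le h4 (by rw [hc, h1.1])
    have e2 := Finset.eq_of_subset_of_card_le h4' (by rw [hc, h1'.1])
    rw [← e1] at h2
    rw [← e2] at h2'
    exact hij (h2.symm.trans h2')

theorem nX (S : Split F w Δ n col) {s : Finset ℕ} {i j : Bool} (h : X F w col i s) : n j ∉ s := by
  intro hh
  exact S.fresh j _ (S.XF h).2 (by simp [hh])

theorem nΔ (S : Split F w Δ n col) (j : Bool) : n j ∉ Δ := by
  intro hh
  have h1 : ({n j} : Finset ℕ) ≠ Δ := by
    intro h; have := S.card; rw [← h] at this; simp at this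
  have := S.Xproper (s := {n j}) (by simpa using hh) h1 true
  exact S.nX this (j := j) (by simp)

theorem wΔ (S : Split F w Δ n col) : w ∉ Δ := by
  intro hh
  have h1 : ({w} : Finset ℕ) ≠ Δ := by
    intro h; have := S.card; rw [← h] at this; simp at this
  have := S.Xproper (s := {w}) (by simpa using hh) h1 true
  exact (S.XF this).1 (by simp)

theorem Δne (S : Split F w Δ n col) : Δ ≠ ∅ := by
  intro h; have := S.card; rw [h] at this; simp at this

theorem mem_old (S : Split F w Δ n col) {s : Finset ℕ} (hn : ∀ i, n i ∉ s) :
    Mem' F w Δ n col s ↔ (s ∈ F ∧ w ∉ s) ∨ s = Δ := by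
  constructor
  · rintro ⟨hne, ⟨G, hG, h4, hw, hs⟩ | ⟨i, τ, hτ, hs⟩⟩
    · exact Or.inl ⟨S.np.down _ hG _ hs hne, fun h => hw (hs h)⟩
    · have hs' : s ⊆ τ := (Finset.subset_insert_iff_of_notMem (hn i)).1 hs
      have key : ∀ j, X F w col j s → (s ∈ F ∧ w ∉ s) ∨ s = Δ := fun j hX =>
        Or.inl ⟨S.XF0 hX hne, (S.XF hX).1⟩
      rcases hτ with ⟨h1, h2⟩ | rfl
      · exact key i ⟨τ, h1, h2, hs'⟩
      · by_cases h : s = τ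
        · exact Or.inr h
        · exact key i (S.Xproper hs' h i)
  · rintro (⟨hs, hw⟩ | rfl)
    · refine ⟨fun h => S.np.emp (h ▸ hs), ?_⟩
      obtain ⟨G, hG, hsG, hc⟩ := S.np.pure _ hs
      by_cases hwG : w ∈ G
      · right
        have : insert w s ∈ F := S.np.down _ hG _ (Finset.insert_subset hwG hsG) (by simp)
        obtain ⟨i, τ, h1, h2, h3⟩ := S.FX hw this
        exact ⟨i, τ, Or.inl ⟨h1, h2⟩, h3.trans (Finset.subset_insert _ _)⟩
      · exact Or.inl ⟨G, hG, hc, hwG, hsG⟩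
    · exact ⟨S.Δne, Or.inr ⟨true, _, Or.inr rfl, Finset.subset_insert _ _⟩⟩

theorem mem_new (S : Split F w Δ n col) {s : Finset ℕ} {i : Bool} (hn : n i ∉ s) :
    Mem' F w Δ n col (insert (n i) s) ↔ X F w col i s ∨ s = Δ := by
  constructor
  · rintro ⟨hne, ⟨G, hG, h4, hw, hs⟩ | ⟨j, τ, hτ, hs⟩⟩
    · exact absurd (hs (by simp)) (S.fresh i G hG)
    · have hnτ : n i ∉ τ := by
        rcases hτ with ⟨h1, h2⟩ | rfl
        · exact fun h => S.fresh i _ h1.2.2 (by simp [h])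
        · exact S.nΔ i
      have hij : i = j := by
        have := hs (Finset.mem_insert_self _ _)
        rcases Finset.mem_insert.1 this with h | h
        · exact S.ninj _ _ h
        · exact absurd h hnτ
      subst hij
      have hs' : s ⊆ τ := by
        intro z hz
        have := hs (Finset.mem_insert_of_mem hz)
        rcases Finset.mem_insert.1 this with h | h
        · exact absurd (h ▸ hz) hn
        · exact h
      rcases hτ with ⟨h1, h2⟩ | rfl
      · exact Or.inl ⟨τ, h1, h2, hs'⟩
      · by_cases h : s = τ
        · exact Or.inr h
        · exact Or.inl (S.Xproper hs' h i)
  · rintro (⟨τ, h1, h2, h3⟩ | rfl)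
    · exact ⟨by simp, Or.inr ⟨i, τ, Or.inl ⟨h1, h2⟩, Finset.insert_subset_insert _ h3⟩⟩
    · exact ⟨by simp, Or.inr ⟨i, _, Or.inr rfl, Finset.Subset.refl _⟩⟩

theorem mem_new' (S : Split F w Δ n col) {s : Finset ℕ} {i : Bool} (hs : s ⊆ Δ) :
    Mem' F w Δ n col (insert (n i) s) := by
  rw [S.mem_new (fun h => S.nΔ i (hs h))]
  by_cases h : s = Δ
  · exact Or.inr h
  · exact Or.inl (S.Xproper hs h i)

theorem mem_down {s t : Finset ℕ} (h : Mem' F w Δ n col s) (hts : t ⊆ s) (ht : t ≠ ∅) :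
    Mem' F w Δ n col t := by
  obtain ⟨_, h⟩ := h
  refine ⟨ht, ?_⟩
  rcases h with ⟨G, h1, h2, h3, h4⟩ | ⟨i, τ, h1, h2⟩
  · exact Or.inl ⟨G, h1, h2, h3, hts.trans h4⟩
  · exact Or.inr ⟨i, τ, h1, hts.trans h2⟩

open Classical in
/-- The new face set. -/
noncomputable def F' (F : Finset (Finset ℕ)) (w : ℕ) (Δ : Finset ℕ) (n : Bool → ℕ)
    (col : Finset ℕ → Bool) : Finset (Finset ℕ) :=
  (F.sup id ∪ {n true, n false}).powerset.filter (Mem' F w Δ n col)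

theorem mem_F' (S : Split F w Δ n col) {s : Finset ℕ} :
    s ∈ F' F w Δ n col ↔ Mem' F w Δ n col s := by
  classical
  simp only [F', Finset.mem_filter, Finset.mem_powerset, and_iff_right_iff_imp]
  have hF : ∀ G ∈ F, G ⊆ F.sup id := fun G hG => Finset.le_sup (f := id) hG
  have hΔ : Δ ⊆ F.sup id := by
    intro z hz
    have h1 : ({z} : Finset ℕ) ≠ Δ := by
      intro h; have := S.card; rw [← h] at this; simp at this
    have := S.XF0 (S.Xproper (s := {z}) (by simpa using hz) h1 true) (by simp)
    exact hF _ this (by simp)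
  rintro ⟨_, ⟨G, h1, h2, h3, h4⟩ | ⟨i, τ, h1, h2⟩⟩ z hz
  · exact Finset.mem_union_left _ (hF G h1 (h4 hz))
  · rcases Finset.mem_insert.1 (h2 hz) with rfl | h
    · apply Finset.mem_union_right
      cases i <;> simp
    · apply Finset.mem_union_left
      rcases h1 with ⟨h5, _⟩ | rfl
      · exact hF _ h5.2.2 (by simp [h])
      · exact hΔ h

theorem cc_old (S : Split F w Δ n col) {s : Finset ℕ} (hn : ∀ i, n i ∉ s)
    (hs : s = ∅ ∨ s ∈ F) (hw : w ∉ s) (hc : s.card ≤ 2) : CC (F' F w Δ n col) s := by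
  classical
  intro P x y hx hy hxs hys hcl hPx
  simp only [S.mem_F'] at hxs hys hcl
  have hsΔ : s ≠ Δ := by intro h; rw [h, S.card] at hc; omega
  have eqv : ∀ i j, X F w col i s → X F w col j s → P (n i) → P (n j) := by
    intro i j hi hj hP
    by_cases hij : i = j
    · rwa [← hij]
    obtain ⟨h1, h2⟩ := S.Xboth hi hj hij
    obtain ⟨d, hd, hds⟩ : ∃ d ∈ Δ, d ∉ s :=
      Finset.exists_mem_notMem_of_card_lt_card (by rw [S.card]; omega)
    have h3 : insert d s ⊆ Δ := Finset.insert_subset hd h1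
    have hPd := hcl (n i) d (hn i) hds hP (S.mem_new' h3)
    refine hcl d (n j) hds (hn j) hPd ?_
    rw [Finset.insert_comm]
    exact S.mem_new' h3
  have toN : ∀ i p, p ∉ s → X F w col i (insert p s) → (P p ↔ P (n i)) := by
    intro i p hp hX
    have hm := (S.mem_new (i := i) (S.nX hX)).2 (Or.inl hX)
    constructor
    · intro h
      exact hcl p (n i) hp (hn i) h (by rw [Finset.insert_comm]; exact hm)
    · intro h
      exact hcl (n i) p (hn i) hp h hm
  have good : ∀ x, x ∉ s → Mem' F w Δ n col (insert x s) →
      ∃ z, z ∉ s ∧ z ≠ w ∧ insert z s ∈ F ∧ (P x ↔ P z) := by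
    intro x hx hxs
    have fromN : ∀ i, X F w col i s → ∃ z, z ∉ s ∧ z ≠ w ∧ insert z s ∈ F ∧ (P (n i) ↔ P z) := by
      rintro i ⟨τ, h1, h2, h3⟩
      obtain ⟨z, hz, hzs⟩ : ∃ z ∈ τ, z ∉ s :=
        Finset.exists_mem_notMem_of_card_lt_card (by rw [h1.1]; omega)
      have hX : X F w col i (insert z s) := ⟨τ, h1, h2, Finset.insert_subset hz h3⟩
      refine ⟨z, hzs, ?_, S.XF0 hX (by simp), (toN i z hzs hX).symm⟩
      rintro rfl
      exact h1.2.1 hz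
    by_cases hxn : ∃ i, x = n i
    · obtain ⟨i, rfl⟩ := hxn
      rw [S.mem_new hx] at hxs
      exact fromN i (hxs.resolve_right hsΔ)
    · push Not at hxn
      have hn' : ∀ i, n i ∉ insert x s := by
        intro i h
        rcases Finset.mem_insert.1 h with h | h
        · exact hxn i h.symm
        · exact hn i h
      rw [S.mem_old hn'] at hxs
      rcases hxs with ⟨h1, h2⟩ | h
      · refine ⟨x, hx, ?_, h1, Iff.rfl⟩
        rintro rfl
        simp at h2
      · have hX := S.Xproper (s := s) (h ▸ Finset.subset_insert _ _) hsΔ true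
        obtain ⟨z, hz1, hz2, hz3, hz4⟩ := fromN true hX
        refine ⟨z, hz1, hz2, hz3, Iff.trans ?_ hz4⟩
        have hm := S.mem_new' (s := insert x s) (i := true) (by rw [h])
        constructor
        · intro hP
          exact hcl x (n true) hx (hn _) hP (by rw [Finset.insert_comm]; exact hm)
        · intro hP
          exact hcl (n true) x (hn _) hx hP hm
  obtain ⟨x', hx1, hx2, hx3, hx4⟩ := good x hx hxs
  obtain ⟨y', hy1, hy2, hy3, hy4⟩ := good y hy hys
  rw [hy4]
  rw [hx4] at hPx
  have := S.np.cc s hs hc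
    (fun z => (z ≠ w → P z) ∧ (z = w → ∀ i, X F w col i s → P (n i))) x' y' hx1 hy1 hx3 hy3 ?_
    ⟨fun _ => hPx, fun h => absurd h hx2⟩
  · exact this.1 hy2
  rintro p q hp hq ⟨hP1, hP2⟩ hpq
  by_cases hpw : p = w
  · subst hpw
    refine ⟨fun hqw => ?_, fun h => hP2 rfl⟩
    obtain ⟨i, hi⟩ := S.FX (s := insert q s) (by simp [hqw.symm, hw]) hpq
    exact (toN i q hq hi).2 (hP2 rfl i (Xmono hi (Finset.subset_insert _ _)))
  · have hPp := hP1 hpw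
    refine ⟨fun hqw => ?_, ?_⟩
    · refine hcl p q hp hq hPp ?_
      rw [S.mem_old (fun i => S.fresh i _ hpq)]
      left
      refine ⟨hpq, ?_⟩
      simp [Ne.symm hpw, hqw.symm, hw]
    · rintro rfl j hj
      rw [Finset.insert_comm] at hpq
      obtain ⟨i, hi⟩ := S.FX (s := insert p s) (by simp [Ne.symm hpw, hw]) hpq
      exact eqv i j (Xmono hi (Finset.subset_insert _ _)) hj ((toN i p hp hi).1 hPp)

theorem cc_new (S : Split F w Δ n col) {s : Finset ℕ} {i : Bool} (hn : n i ∉ s)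
    (hs : X F w col i s) (hc : s.card ≤ 1) : CC (F' F w Δ n col) (insert (n i) s) := by
  classical
  intro P x y hx hy hxs hys hcl hPx
  simp only [S.mem_F'] at hxs hys hcl
  have vtx : ∀ z, z ∉ insert (n i) s → Mem' F w Δ n col (insert z (insert (n i) s)) →
      z ∉ s ∧ X F w col i (insert z s) := by
    intro z hz hm
    simp only [Finset.mem_insert, not_or] at hz
    rw [Finset.insert_comm, S.mem_new (by simp [Ne.symm hz.1, hn])] at hm
    refine ⟨hz.2, hm.resolve_right ?_⟩
    intro h
    have h1 := Finset.card_insert_le z s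
    rw [h, S.card] at h1
    omega
  obtain ⟨hx1, hxX⟩ := vtx x hx hxs
  obtain ⟨hy1, hyX⟩ := vtx y hy hys
  have edge : ∀ p q, p ∉ s → q ∉ s → p ≠ n i → q ≠ n i →
      (X F w col i (insert p (insert q s)) ∨ insert p (insert q s) ⊆ Δ) → P p → P q := by
    intro p q hp hq hpn hqn h hP
    refine hcl p q (by simp [hp, hpn]) (by simp [hq, hqn]) hP ?_
    have e : insert p (insert q (insert (n i) s)) = insert (n i) (insert p (insert q s)) := by
      ext; simp; tauto
    rw [e]
    rcases h with h | h
    · exact (S.mem_new (S.nX h)).2 (Or.inl h)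
    · exact S.mem_new' h
  have nΔ' : ∀ d ∈ Δ, d ≠ n i := fun d hd h => S.nΔ i (h ▸ hd)
  have hws := S.XF hs
  have w1 : ∀ z, X F w col i (insert z s) → z ∉ s → z ∉ insert w s ∧ insert z (insert w s) ∈ F := by
    intro z hz hzs
    have := S.XF hz
    refine ⟨?_, by rw [Finset.insert_comm]; exact this.2⟩
    simp only [Finset.mem_insert, not_or]
    exact ⟨fun h => this.1 (by simp [h]), hzs⟩
  have := S.np.cc (insert w s) (Or.inr hws.2)
    ((Finset.card_insert_le _ _).trans (by omega))
    (fun z => (X F w col i (insert z s) → P z) ∧ (¬ X F w col i (insert z s) →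
      ∀ d ∈ Δ, d ∉ s → insert d s ⊆ Δ → P d)) x y (w1 x hxX hx1).1 (w1 y hyX hy1).1
    (w1 x hxX hx1).2 (w1 y hyX hy1).2 ?_ ⟨fun _ => hPx, fun h => absurd hxX h⟩
  · exact this.1 hyX
  rintro p q hp hq ⟨h1, h2⟩ hpq
  simp only [Finset.mem_insert, not_or] at hp hq
  have e : insert p (insert q (insert w s)) = insert w (insert p (insert q s)) := by
    ext; simp; tauto
  rw [e] at hpq
  have hwpq : w ∉ insert p (insert q s) := by
    simp only [Finset.mem_insert, not_or]
    exact ⟨Ne.symm hp.1, Ne.symm hq.1, hws.1⟩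
  obtain ⟨j, hj⟩ := S.FX hwpq hpq
  have hpn : p ≠ n i := fun h => S.nX hj (j := i) (by simp [h])
  have hqn : q ≠ n i := fun h => S.nX hj (j := i) (by simp [h])
  have hjp : X F w col j (insert p s) := Xmono hj (by intro z; simp; tauto)
  have hjq : X F w col j (insert q s) := Xmono hj (by intro z; simp; tauto)
  by_cases hij : i = j
  · subst hij
    exact ⟨fun _ => edge p q hp.2 hq.2 hpn hqn (Or.inl hj) (h1 hjp), fun h => absurd hjq h⟩
  refine ⟨fun hiq => ?_, fun hiq => ?_⟩
  · have hqΔ := (S.Xboth hiq hjq hij).1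
    by_cases hip : X F w col i (insert p s)
    · have hpΔ := (S.Xboth hip hjp hij).1
      refine edge p q hp.2 hq.2 hpn hqn (Or.inr ?_) (h1 hip)
      exact Finset.insert_subset (hpΔ (by simp)) hqΔ
    · exact h2 hip q (hqΔ (by simp)) hq.2 hqΔ
  · intro d hd hds hdΔ
    by_cases hip : X F w col i (insert p s)
    · have hpΔ := (S.Xboth hip hjp hij).1
      refine edge p d hp.2 hds hpn (nΔ' d hd) (Or.inr ?_) (h1 hip)
      exact Finset.insert_subset (hpΔ (by simp)) hdΔ
    · exact h2 hip d hd hds hdΔ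

theorem two_new (S : Split F w Δ n col) {e : Finset ℕ} {i : Bool} (hn : n i ∉ e)
    (he : X F w col i e) (hc : e.card = 2) :
    ∃ p q, p ≠ q ∧ ∀ x, (x ∉ insert (n i) e ∧ Mem' F w Δ n col (insert x (insert (n i) e))) ↔
      (x = p ∨ x = q) := by
  classical
  have hwe := S.XF he
  obtain ⟨p, q, hpq, H⟩ := S.np.two (insert w e) hwe.2
    (by rw [Finset.card_insert_of_notMem hwe.1, hc])
  have hTri : ∀ x, x ∉ e → (Tri F w (insert x e) ↔ x = p ∨ x = q) := by
    intro x hx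
    rw [← H, Finset.insert_comm]
    simp only [Tri, Finset.card_insert_of_notMem hx, hc, true_and, Finset.mem_insert, not_or]
    constructor
    · rintro ⟨⟨h1, h2⟩, h3⟩; exact ⟨⟨Ne.symm h1, hx⟩, h3⟩
    · rintro ⟨⟨h1, h2⟩, h3⟩; exact ⟨⟨Ne.symm h1, hwe.1⟩, h3⟩
  have hpe : p ∉ e := fun h => ((H p).2 (Or.inl rfl)).1 (by simp [h])
  have hqe : q ∉ e := fun h => ((H q).2 (Or.inr rfl)).1 (by simp [h])
  have apex : ∀ x, (x ∉ insert (n i) e ∧ Mem' F w Δ n col (insert x (insert (n i) e))) ↔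
      x ∉ e ∧ ((Tri F w (insert x e) ∧ col (insert x e) = i) ∨ insert x e = Δ) := by
    intro x
    constructor
    · rintro ⟨h1, h2⟩
      simp only [Finset.mem_insert, not_or] at h1
      rw [Finset.insert_comm, S.mem_new (by simp [Ne.symm h1.1, hn]),
        Xtri (by rw [Finset.card_insert_of_notMem h1.2, hc])] at h2
      exact ⟨h1.2, h2⟩
    · rintro ⟨h1, h2⟩
      rw [← Xtri (by rw [Finset.card_insert_of_notMem h1, hc])] at h2
      have hni : n i ∉ insert x e := by
        rcases h2 with h | h
        · exact S.nX h
        · rw [h]; exact S.nΔ i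
      refine ⟨?_, ?_⟩
      · simp only [Finset.mem_insert, not_or]
        exact ⟨fun h => hni (by simp [h]), h1⟩
      · rw [Finset.insert_comm]
        exact (S.mem_new hni).2 h2
  by_cases heΔ : e ⊆ Δ
  · have sing : ∀ τ, τ.card = 3 → e ⊆ τ → ∃ d, d ∉ e ∧ τ = insert d e := by
      intro τ h1 h2
      obtain ⟨d, hd, hde⟩ := Finset.exists_mem_notMem_of_card_lt_card (s := e) (t := τ) (by omega)
      refine ⟨d, hde, ?_⟩
      symm
      apply Finset.eq_of_subset_of_card_le (Finset.insert_subset hd h2)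
      rw [Finset.card_insert_of_notMem hde]; omega
    obtain ⟨d, hde, hd⟩ := sing Δ S.card heΔ
    obtain ⟨τ1, ht1, he1, hc1⟩ := S.B2 e heΔ hc i
    obtain ⟨τ2, ht2, he2, hc2⟩ := S.B2 e heΔ hc (!i)
    obtain ⟨x1, hx1, rfl⟩ := sing τ1 ht1.1 he1
    obtain ⟨x2, hx2, rfl⟩ := sing τ2 ht2.1 he2
    have hinj : ∀ x y, x ∉ e → insert x e = insert y e → x = y := by
      intro x y hx h
      have : x ∈ insert y e := h ▸ Finset.mem_insert_self _ _
      rcases Finset.mem_insert.1 this with h | h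
      · exact h
      · exact absurd h hx
    refine ⟨x1, d, ?_, fun x => ?_⟩
    · rintro rfl
      exact S.nF (hd ▸ S.np.down _ ht1.2.2 _ (Finset.subset_insert _ _) (by simp))
    · rw [apex]
      constructor
      · rintro ⟨h1, ⟨h2, h3⟩ | h2⟩
        · left
          have a1 := (hTri x1 hx1).1 ht1
          have a2 := (hTri x2 hx2).1 ht2
          have a3 := (hTri x h1).1 h2
          have n12 : x1 ≠ x2 := by
            rintro rfl
            rw [hc1] at hc2; simp at hc2
          have n2 : x ≠ x2 := by
            rintro rfl
            rw [h3] at hc2; simp at hc2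
          rcases a1 with rfl | rfl <;> rcases a2 with rfl | rfl <;> rcases a3 with rfl | rfl <;>
            first | rfl | exact absurd rfl n12 | exact absurd rfl n2
        · right
          exact hinj _ _ h1 (h2.trans hd)
      · rintro (rfl | rfl)
        · exact ⟨hx1, Or.inl ⟨ht1, hc1⟩⟩
        · exact ⟨hde, Or.inr hd.symm⟩
  · refine ⟨p, q, hpq, fun x => ?_⟩
    rw [apex]
    constructor
    · rintro ⟨h1, ⟨h2, h3⟩ | h2⟩
      · exact (hTri x h1).1 h2
      · exact absurd (h2 ▸ Finset.subset_insert _ _) heΔ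
    · intro h
      have hxe : x ∉ e := by rcases h with rfl | rfl <;> assumption
      have ht := (hTri x hxe).2 h
      obtain ⟨τ, h1, h2, h3⟩ := he
      exact ⟨hxe, Or.inl ⟨ht, (S.B1 e _ τ hc heΔ (Finset.subset_insert _ _) h3 ht h1).trans h2⟩⟩

theorem two_old (S : Split F w Δ n col) {r : Finset ℕ} (hn : ∀ i, n i ∉ r)
    (hr : Mem' F w Δ n col r) (hc : r.card = 3) :
    ∃ p q, p ≠ q ∧ ∀ x, (x ∉ r ∧ Mem' F w Δ n col (insert x r)) ↔ (x = p ∨ x = q) := by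
  classical
  have old : ∀ x, (∀ i, x ≠ n i) → x ∉ r → Mem' F w Δ n col (insert x r) →
      insert x r ∈ F ∧ w ∉ insert x r := by
    intro x hx hxr hm
    rw [S.mem_old] at hm
    · refine hm.resolve_right fun h => ?_
      have := Finset.card_insert_of_notMem hxr
      rw [h, S.card] at this; omega
    · intro i h
      rcases Finset.mem_insert.1 h with h | h
      · exact hx i h.symm
      · exact hn i h
  rw [S.mem_old hn] at hr
  by_cases hrΔ : r = Δ
  · subst hrΔ
    refine ⟨n true, n false, fun h => by simpa using S.ninj _ _ h, fun x => ⟨?_, ?_⟩⟩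
    · rintro ⟨h1, h2⟩
      by_contra hcon
      push Not at hcon
      have := (old x (by intro i; cases i <;> simp [hcon]) h1 h2).1
      exact S.nF (S.np.down _ this _ (Finset.subset_insert _ _) S.Δne)
    · rintro (rfl | rfl)
      · exact ⟨hn _, S.mem_new' (Finset.Subset.refl _)⟩
      · exact ⟨hn _, S.mem_new' (Finset.Subset.refl _)⟩
  obtain ⟨hrF, hwr⟩ := hr.resolve_right hrΔ
  obtain ⟨p, q, hpq, H⟩ := S.np.two r hrF hc
  have nw : ∀ i x, (x ∉ r ∧ insert x r ∈ F) → x ≠ n i := by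
    rintro i x ⟨h1, h2⟩ rfl
    exact S.fresh i _ h2 (by simp)
  by_cases hT : insert w r ∈ F
  · have hT' : Tri F w r := ⟨hc, hwr, hT⟩
    obtain ⟨q', hq'w, H'⟩ : ∃ q', q' ≠ w ∧ ∀ x, (x ∉ r ∧ insert x r ∈ F) ↔ (x = w ∨ x = q') := by
      rcases (H w).1 ⟨hwr, hT⟩ with rfl | rfl
      · exact ⟨q, hpq.symm, H⟩
      · exact ⟨p, hpq, fun x => (H x).trans or_comm⟩
    have hq := (H' q').2 (Or.inr rfl)
    refine ⟨n (col r), q', (nw _ _ hq).symm, fun x => ⟨?_, ?_⟩⟩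
    · rintro ⟨h1, h2⟩
      by_cases hx : ∃ i, x = n i
      · obtain ⟨i, rfl⟩ := hx
        rw [S.mem_new h1, Xtri hc] at h2
        left
        rw [(h2.resolve_right hrΔ).2]
      · push Not at hx
        obtain ⟨h3, h4⟩ := old x hx h1 h2
        right
        refine ((H' x).1 ⟨h1, h3⟩).resolve_left ?_
        rintro rfl
        simp at h4
    · rintro (rfl | rfl)
      · exact ⟨hn _, (S.mem_new (hn _)).2 (Or.inl ((Xtri hc).2 ⟨hT', rfl⟩))⟩
      · refine ⟨hq.1, (S.mem_old (S.fresh · _ hq.2)).2 (Or.inl ⟨hq.2, ?_⟩)⟩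
        simp [hq'w.symm, hwr]
  · refine ⟨p, q, hpq, fun x => ?_⟩
    rw [← H]
    constructor
    · rintro ⟨h1, h2⟩
      by_cases hx : ∃ i, x = n i
      · obtain ⟨i, rfl⟩ := hx
        rw [S.mem_new h1, Xtri hc] at h2
        exact absurd (h2.resolve_right hrΔ).1.2.2 hT
      · push Not at hx
        exact ⟨h1, (old x hx h1 h2).1⟩
    · rintro ⟨h1, h2⟩
      refine ⟨h1, (S.mem_old (S.fresh · _ h2)).2 (Or.inl ⟨h2, ?_⟩)⟩
      simp only [Finset.mem_insert, not_or]
      exact ⟨fun h => hT (h ▸ h2), hwr⟩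

theorem erase_new (S : Split F w Δ n col) {s : Finset ℕ} {i : Bool} (h : Mem' F w Δ n col s)
    (hi : n i ∈ s) (hc : s.card ≤ 3) : X F w col i (s.erase (n i)) := by
  rw [← Finset.insert_erase hi, S.mem_new (by simp)] at h
  refine h.resolve_right fun h => ?_
  have := Finset.card_erase_of_mem hi
  rw [h, S.card] at this
  omega

theorem NP' (S : Split F w Δ n col) : NP (F' F w Δ n col) := by
  classical
  refine ⟨⟨Δ, ?_⟩, ?_, ?_, ?_, ?_, ?_, ?_⟩
  · rw [S.mem_F', S.mem_old S.nΔ]; exact Or.inr rfl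
  · rw [S.mem_F']; exact fun h => h.1 rfl
  · intro s hs t hts ht
    rw [S.mem_F'] at hs ⊢
    exact mem_down hs hts ht
  · intro s hs
    simp only [S.mem_F'] at hs ⊢
    obtain ⟨hne, ⟨G, h1, h2, h3, h4⟩ | ⟨i, τ, h1, h2⟩⟩ := hs
    · refine ⟨G, ⟨?_, Or.inl ⟨G, h1, h2, h3, Finset.Subset.refl _⟩⟩, h4, h2⟩
      rintro rfl; simp at h2
    · refine ⟨insert (n i) τ, ⟨by simp, Or.inr ⟨i, τ, h1, Finset.Subset.refl _⟩⟩, h2, ?_⟩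
      rcases h1 with ⟨h5, _⟩ | rfl
      · rw [Finset.card_insert_of_notMem (fun h => S.fresh i _ h5.2.2 (by simp [h])), h5.1]
      · rw [Finset.card_insert_of_notMem (S.nΔ i), S.card]
  · intro s hs
    rw [S.mem_F'] at hs
    obtain ⟨hne, ⟨G, h1, h2, h3, h4⟩ | ⟨i, τ, h1, h2⟩⟩ := hs
    · rw [← h2]; exact Finset.card_le_card h4
    · refine (Finset.card_le_card h2).trans ((Finset.card_insert_le _ _).trans ?_)
      rcases h1 with ⟨h5, _⟩ | rfl
      · rw [h5.1]
      · rw [S.card]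
  · intro s hs hc
    simp only [S.mem_F'] at hs ⊢
    by_cases h : ∃ i, n i ∈ s
    · obtain ⟨i, hi⟩ := h
      have := S.two_new (e := s.erase (n i)) (i := i) (by simp) (S.erase_new hs hi hc.le)
        (by rw [Finset.card_erase_of_mem hi]; omega)
      rwa [Finset.insert_erase hi] at this
    · push Not at h
      exact S.two_old h hs hc
  · intro s hs hc
    by_cases h : ∃ i, n i ∈ s
    · obtain ⟨i, hi⟩ := h
      have hs' : Mem' F w Δ n col s := by
        rw [← S.mem_F']
        refine hs.resolve_left ?_
        rintro rfl; simp at hi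
      have := S.cc_new (s := s.erase (n i)) (i := i) (by simp) (S.erase_new hs' hi (by omega))
        (by rw [Finset.card_erase_of_mem hi]; omega)
      rwa [Finset.insert_erase hi] at this
    · push Not at h
      rcases hs with rfl | hs
      · exact S.cc_old h (Or.inl rfl) (by simp) hc
      · rw [S.mem_F', S.mem_old h] at hs
        have := hs.resolve_right (by rintro rfl; rw [S.card] at hc; omega)
        exact S.cc_old h (Or.inr this.1) this.2 hc

end Split
end SComplex


namespace SComplex
namespace Split

variable {F : Finset (Finset ℕ)} {w : ℕ} {Δ : Finset ℕ} {n : Bool → ℕ} {col : Finset ℕ → Bool}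

/-- Membership in the complex after splitting the vertex `w`. -/
def MemM (F : Finset (Finset ℕ)) (w : ℕ) (Δ : Finset ℕ) (n : Bool → ℕ)
    (col : Finset ℕ → Bool) (s : Finset ℕ) : Prop :=
  s ≠ ∅ ∧ ((∃ G ∈ F, G.card = 4 ∧ w ∉ G ∧ s ⊆ G) ∨
    (∃ i τ, Tri F w τ ∧ col τ = i ∧ s ⊆ insert (n i) τ) ∨
    ∃ e, e ⊆ Δ ∧ e.card = 2 ∧ s ⊆ insert (n true) (insert (n false) e))

open Classical in
/-- The face set after splitting the vertex `w`. -/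
noncomputable def FM (F : Finset (Finset ℕ)) (w : ℕ) (Δ : Finset ℕ) (n : Bool → ℕ)
    (col : Finset ℕ → Bool) : Finset (Finset ℕ) :=
  (F.sup id ∪ {n true, n false}).powerset.filter (MemM F w Δ n col)

theorem Δsub (S : Split F w Δ n col) : Δ ⊆ F.sup id := by
  intro z hz
  have h1 : ({z} : Finset ℕ) ≠ Δ := by
    intro h; have := S.card; rw [← h] at this; simp at this
  have := S.XF0 (S.Xproper (s := {z}) (by simpa using hz) h1 true) (by simp)
  exact (Finset.le_sup (f := id) this : _ ⊆ F.sup id) (by simp)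

theorem mem_FM (S : Split F w Δ n col) {s : Finset ℕ} :
    s ∈ FM F w Δ n col ↔ MemM F w Δ n col s := by
  classical
  simp only [FM, Finset.mem_filter, Finset.mem_powerset, and_iff_right_iff_imp]
  have hF : ∀ G ∈ F, G ⊆ F.sup id := fun G hG => Finset.le_sup (f := id) hG
  rintro ⟨_, ⟨G, h1, h2, h3, h4⟩ | ⟨i, τ, h1, _, h2⟩ | ⟨e, h1, h2, h3⟩⟩ z hz
  · exact Finset.mem_union_left _ (hF G h1 (h4 hz))
  · rcases Finset.mem_insert.1 (h2 hz) with rfl | h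
    · apply Finset.mem_union_right
      cases i <;> simp
    · apply Finset.mem_union_left
      exact hF _ h1.2.2 (by simp [h])
  · have := h3 hz
    simp only [Finset.mem_insert] at this
    rcases this with rfl | rfl | h
    · simp
    · simp
    · exact Finset.mem_union_left _ (S.Δsub (h1 h))

/-- The split complex. -/
noncomputable def M (S : Split F w Δ n col) : SComplex where
  faces := FM F w Δ n col
  not_empty_mem := by rw [S.mem_FM]; exact fun h => h.1 rfl
  down_closed := by
    intro s hs t hts ht
    rw [S.mem_FM] at hs ⊢
    obtain ⟨_, ⟨G, h1, h2, h3, h4⟩ | ⟨i, τ, h1, h2, h3⟩ | ⟨e, h1, h2, h3⟩⟩ := hs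
    · exact ⟨ht, Or.inl ⟨G, h1, h2, h3, hts.trans h4⟩⟩
    · exact ⟨ht, Or.inr (Or.inl ⟨i, τ, h1, h2, hts.trans h3⟩)⟩
    · exact ⟨ht, Or.inr (Or.inr ⟨e, h1, h2, hts.trans h3⟩)⟩

/-- The final complex. -/
noncomputable def K' (S : Split F w Δ n col) : SComplex where
  faces := F' F w Δ n col
  not_empty_mem := S.NP'.emp
  down_closed := S.NP'.down

theorem uv (S : Split F w Δ n col) : n true ≠ n false := fun h => by simpa using S.ninj _ _ h

theorem nτ (S : Split F w Δ n col) {τ : Finset ℕ} (h : Tri F w τ) (i : Bool) : n i ∉ τ :=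
  fun hh => S.fresh i _ h.2.2 (by simp [hh])

/-- Faces containing the new edge. -/
theorem memM_uv (S : Split F w Δ n col) {γ : Finset ℕ} (h1 : n true ∉ γ) (h2 : n false ∉ γ) :
    MemM F w Δ n col (γ ∪ {n true, n false}) ↔ γ ⊆ Δ ∧ γ ≠ Δ := by
  classical
  constructor
  · rintro ⟨_, ⟨G, h3, h4, h5, h6⟩ | ⟨i, τ, h3, h4, h5⟩ | ⟨e, h3, h4, h5⟩⟩
    · exact absurd (h6 (by simp)) (S.fresh true G h3)
    · exfalso
      have a1 : n true ∈ insert (n i) τ := h5 (by simp)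
      have a2 : n false ∈ insert (n i) τ := h5 (by simp)
      have b1 := (Finset.mem_insert.1 a1).resolve_right (S.nτ h3 _)
      have b2 := (Finset.mem_insert.1 a2).resolve_right (S.nτ h3 _)
      exact S.uv (b1.trans b2.symm)
    · have : γ ⊆ e := by
        intro z hz
        have := h5 (Finset.mem_union_left _ hz)
        simp only [Finset.mem_insert] at this
        rcases this with rfl | rfl | h
        · exact absurd hz h1
        · exact absurd hz h2
        · exact h
      refine ⟨this.trans h3, ?_⟩
      rintro rfl
      have := Finset.card_le_card this
      rw [S.card] at this; omega
  · rintro ⟨h3, h4⟩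
    obtain ⟨e, h5, h6, h7⟩ := S.exists_e h3 h4
    refine ⟨?_, Or.inr (Or.inr ⟨e, h6, h7, ?_⟩)⟩
    · intro h
      have : n true ∈ γ ∪ {n true, n false} := by simp
      rw [h] at this; simp at this
    · intro z hz
      simp only [Finset.mem_union, Finset.mem_insert, Finset.mem_singleton] at hz ⊢
      rcases hz with h | h | h
      · exact Or.inr (Or.inr (h5 h))
      · exact Or.inl h
      · exact Or.inr (Or.inl h)

theorem memM_one (S : Split F w Δ n col) {γ : Finset ℕ} {i : Bool} (h1 : n i ∉ γ)
    (h : MemM F w Δ n col (γ ∪ {n i})) (h2 : n (!i) ∉ γ) : X F w col i γ := by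
  classical
  obtain ⟨_, ⟨G, h3, h4, h5, h6⟩ | ⟨j, τ, h3, h4, h5⟩ | ⟨e, h3, h4, h5⟩⟩ := h
  · exact absurd (h6 (by simp)) (S.fresh i G h3)
  · have a1 : n i ∈ insert (n j) τ := h5 (by simp)
    have b1 := S.ninj _ _ ((Finset.mem_insert.1 a1).resolve_right (S.nτ h3 _))
    subst b1
    refine ⟨τ, h3, h4, fun z hz => ?_⟩
    rcases Finset.mem_insert.1 (h5 (Finset.mem_union_left _ hz)) with rfl | h
    · exact absurd hz h1
    · exact h
  · have : γ ⊆ e := by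
      intro z hz
      have := h5 (Finset.mem_union_left _ hz)
      simp only [Finset.mem_insert] at this
      rcases this with rfl | rfl | h
      · cases i <;> simp_all
      · cases i <;> simp_all
      · exact h
    refine S.Xproper (this.trans h3) ?_ i
    rintro rfl
    have := Finset.card_le_card this
    rw [S.card] at this; omega

/-- Old faces of the split complex. -/
theorem memM_old (S : Split F w Δ n col) {α : Finset ℕ} :
    (α ∈ S.M.faces ∧ n true ∉ α ∧ n false ∉ α) ↔ α ∈ F ∧ w ∉ α := by
  classical
  change (α ∈ FM F w Δ n col ∧ _) ↔ _
  rw [S.mem_FM]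
  constructor
  · rintro ⟨⟨hne, h⟩, h1, h2⟩
    have hn : ∀ i, n i ∉ α := by rintro (_ | _) <;> assumption
    have key : ∀ i, X F w col i α → α ∈ F ∧ w ∉ α := fun i hX => ⟨S.XF0 hX hne, (S.XF hX).1⟩
    rcases h with ⟨G, h3, h4, h5, h6⟩ | ⟨j, τ, h3, h4, h5⟩ | ⟨e, h3, h4, h5⟩
    · exact ⟨S.np.down _ h3 _ h6 hne, fun h => h5 (h6 h)⟩
    · exact key j ⟨τ, h3, h4, (Finset.subset_insert_iff_of_notMem (hn j)).1 h5⟩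
    · refine key true (S.Xproper (s := α) ?_ ?_ true)
      · refine Finset.Subset.trans ?_ h3
        intro z hz
        have := h5 hz
        simp only [Finset.mem_insert] at this
        rcases this with rfl | rfl | h
        · exact absurd hz h1
        · exact absurd hz h2
        · exact h
      · rintro rfl
        have : α ⊆ e := by
          intro z hz
          have := h5 hz
          simp only [Finset.mem_insert] at this
          rcases this with rfl | rfl | h
          · exact absurd hz h1
          · exact absurd hz h2
          · exact h
        have := Finset.card_le_card this
        rw [S.card] at this; omega
  · rintro ⟨h1, h2⟩
    refine ⟨⟨fun h => S.np.emp (h ▸ h1), ?_⟩, S.fresh _ _ h1, S.fresh _ _ h1⟩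
    obtain ⟨G, hG, hsG, hc⟩ := S.np.pure _ h1
    by_cases hwG : w ∈ G
    · right; left
      obtain ⟨i, τ, h3, h4, h5⟩ := S.FX h2 (S.np.down _ hG _ (Finset.insert_subset hwG hsG) (by simp))
      exact ⟨i, τ, h3, h4, h5.trans (Finset.subset_insert _ _)⟩
    · exact Or.inl ⟨G, hG, hc, hwG, hsG⟩

theorem wF (S : Split F w Δ n col) : {w} ∈ F := by
  have := (S.XF (S.Xproper (s := ∅) (by simp) S.Δne.symm true)).2
  simpa using this

theorem nw (S : Split F w Δ n col) (i : Bool) : n i ≠ w := by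
  intro h
  exact S.fresh i _ S.wF (by simp [h])

theorem bdry (S : Split F w Δ n col) {s : Finset ℕ} :
    s ∈ bdryFaces (F.filter fun α => w ∉ α) 3 ↔ s ≠ ∅ ∧ w ∉ s ∧ insert w s ∈ F := by
  classical
  have cnt : ∀ r ∈ F, w ∉ r → r.card = 3 →
      (((F.filter fun α => w ∉ α).filter fun t => t.card = 3 + 1 ∧ r ⊆ t).card = 1 ↔
        insert w r ∈ F) := by
    intro r hr hw hc
    have h2 := (two_iff hc).2 (S.np.two r hr hc)
    have h3 := Finset.card_filter_add_card_filter_not (s := F.filter fun t => t.card = 3 + 1 ∧ r ⊆ t)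
      (fun t => w ∉ t)
    have h4 : (F.filter fun t => t.card = 3 + 1 ∧ r ⊆ t).filter (fun t => ¬ w ∉ t) =
        if insert w r ∈ F then {insert w r} else ∅ := by
      ext t
      simp only [Finset.mem_filter, not_not]
      have hh : ∀ t, t.card = 3 + 1 → r ⊆ t → w ∈ t → t = insert w r := by
        intro t h1 h2 h3
        symm
        apply Finset.eq_of_subset_of_card_le (Finset.insert_subset h3 h2)
        rw [Finset.card_insert_of_notMem hw]; omega
      split_ifs with hif
      · rw [Finset.mem_singleton]
        constructor
        · rintro ⟨⟨h1, h2, h3⟩, h4⟩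
          exact hh t h2 h3 h4
        · rintro rfl
          exact ⟨⟨hif, by rw [Finset.card_insert_of_notMem hw, hc], Finset.subset_insert _ _⟩,
            by simp⟩
      · simp only [Finset.notMem_empty, iff_false]
        rintro ⟨⟨h1, h2, h3⟩, h4⟩
        exact hif (hh t h2 h3 h4 ▸ h1)
    rw [h4, h2] at h3
    rw [Finset.filter_comm]
    by_cases hif : insert w r ∈ F
    · rw [if_pos hif, Finset.card_singleton] at h3
      exact ⟨fun _ => hif, fun _ => by omega⟩
    · rw [if_neg hif, Finset.card_empty] at h3
      exact ⟨fun h => by omega, fun h => absurd h hif⟩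
  simp only [bdryFaces, Finset.mem_filter]
  constructor
  · rintro ⟨⟨h1, h2⟩, r, ⟨hr, hwr⟩, hsr, hc, h3⟩
    have h4 := (cnt r hr hwr hc).1 (by simpa only [Finset.filter_filter] using h3)
    exact ⟨fun h => S.np.emp (h ▸ h1), h2,
      S.np.down _ h4 _ (Finset.insert_subset_insert _ hsr) (by simp)⟩
  · rintro ⟨h1, h2, h3⟩
    obtain ⟨i, τ, h4, h5, h6⟩ := S.FX h2 h3
    have hτ : τ ∈ F := S.np.down _ h4.2.2 _ (Finset.subset_insert _ _)
      (by rintro rfl; have := h4.1; simp at this)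
    refine ⟨⟨S.np.down _ h3 _ (Finset.subset_insert _ _) h1, h2⟩, τ, ⟨hτ, h4.2.1⟩, h6, h4.1, ?_⟩
    have := (cnt τ hτ h4.2.1 h4.1).2 h4.2.2
    simpa only [Finset.filter_filter] using this

end Split

theorem Split.contr {K : SComplex} {w : ℕ} {Δ : Finset ℕ} {n : Bool → ℕ} {col : Finset ℕ → Bool}
    (S : Split K.faces w Δ n col) : EdgeContraction S.M K := by
  classical
  refine ⟨n true, n false, ?_, S.uv, ?_, w, ?_, ?_⟩
  · change _ ∈ Split.FM _ _ _ _ _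
    rw [S.mem_FM]
    have := (S.memM_uv (γ := ∅) (by simp) (by simp)).2 ⟨by simp, S.Δne.symm⟩
    simpa using this
  · ext γ
    simp only [Finset.mem_inter, lk, Finset.mem_filter]
    change (γ ∈ Split.FM _ _ _ _ _ ∧ _ ∧ _ ∈ Split.FM _ _ _ _ _) ∧
      (γ ∈ Split.FM _ _ _ _ _ ∧ _ ∧ _ ∈ Split.FM _ _ _ _ _) ↔
      γ ∈ Split.FM _ _ _ _ _ ∧ _ ∧ _ ∈ Split.FM _ _ _ _ _
    have d1 : ∀ x, γ ∩ {x} = ∅ ↔ x ∉ γ := by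
      intro x; rw [← Finset.disjoint_iff_inter_eq_empty, disjoint_comm]; simp
    have d2 : γ ∩ {n true, n false} = ∅ ↔ n true ∉ γ ∧ n false ∉ γ := by
      rw [← Finset.disjoint_iff_inter_eq_empty, disjoint_comm]; simp
    rw [d1, d1, d2]
    constructor
    · rintro ⟨⟨h1, h2, h3⟩, ⟨_, h4, h5⟩⟩
      refine ⟨h1, ⟨h2, h4⟩, ?_⟩
      rw [S.mem_FM] at h3 h5 ⊢
      rw [S.memM_uv h2 h4]
      exact S.Xboth (S.memM_one h2 h3 h4) (S.memM_one h4 h5 h2) (by simp)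
    · rintro ⟨h1, ⟨h2, h3⟩, h4⟩
      refine ⟨⟨h1, h2, S.M.down_closed _ h4 _ ?_ ?_⟩, h1, h3, S.M.down_closed _ h4 _ ?_ ?_⟩
      · intro z; simp; tauto
      · intro h
        have : n true ∈ γ ∪ {n true} := by simp
        rw [h] at this; simp at this
      · intro z; simp; tauto
      · intro h
        have : n false ∈ γ ∪ {n false} := by simp
        rw [h] at this; simp at this
  · intro h
    simp only [vertexSet, Finset.mem_sup, id] at h
    obtain ⟨s, hs, hws⟩ := h
    change s ∈ Split.FM _ _ _ _ _ at hs
    rw [S.mem_FM] at hs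
    obtain ⟨_, ⟨G, h3, h4, h5, h6⟩ | ⟨j, τ, h3, h4, h5⟩ | ⟨e, h3, h4, h5⟩⟩ := hs
    · exact h5 (h6 hws)
    · rcases Finset.mem_insert.1 (h5 hws) with h | h
      · exact S.nw _ h.symm
      · exact h3.2.1 h
    · have := h5 hws
      simp only [Finset.mem_insert] at this
      rcases this with h | h | h
      · exact S.nw _ h.symm
      · exact S.nw _ h.symm
      · exact S.wΔ (h3 h)
  · have e : (S.M.faces.filter fun α => n true ∉ α ∧ n false ∉ α) = K.faces.filter fun α => w ∉ α := by
      ext α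
      rw [Finset.mem_filter, Finset.mem_filter]
      exact S.memM_old
    rw [e]
    ext s
    simp only [coneFaces, Finset.mem_union, Finset.mem_image, S.bdry, Finset.mem_singleton,
      Finset.mem_filter]
    constructor
    · intro hs
      by_cases hw : w ∈ s
      · right
        by_cases hsw : s = {w}
        · exact Or.inr hsw
        · left; right
          refine ⟨s.erase w, ⟨?_, by simp, ?_⟩, Finset.insert_erase hw⟩
          · intro h
            rw [Finset.erase_eq_empty_iff] at h
            rcases h with rfl | h
            · simp at hw
            · exact hsw h
          · rwa [Finset.insert_erase hw]
      · exact Or.inl ⟨hs, hw⟩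
    · rintro (h | (h | ⟨s, h, rfl⟩) | rfl)
      · exact h.1
      · exact K.down_closed _ h.2.2 _ (Finset.subset_insert _ _) h.1
      · exact h.2.2
      · exact S.wF

theorem Split.bist {F : Finset (Finset ℕ)} {w : ℕ} {Δ : Finset ℕ} {n : Bool → ℕ}
    {col : Finset ℕ → Bool} (S : Split F w Δ n col) : BistellarTwoMove S.M S.K' := by
  classical
  obtain ⟨a, b, c, hab, hac, hbc, hΔ⟩ := Finset.card_eq_three.1 S.card
  refine ⟨n true, n false, a, b, c, ?_⟩
  rw [← hΔ]
  refine ⟨?_, S.uv, S.card, S.nΔ _, S.nΔ _, ?_, ?_, ?_⟩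
  · change _ ∈ Split.FM _ _ _ _ _
    rw [S.mem_FM]
    have := (S.memM_uv (γ := ∅) (by simp) (by simp)).2 ⟨by simp, S.Δne.symm⟩
    simpa using this
  · ext γ
    simp only [lk, Finset.mem_filter, properFaces, Finset.mem_powerset]
    have d2 : γ ∩ {n true, n false} = ∅ ↔ n true ∉ γ ∧ n false ∉ γ := by
      rw [← Finset.disjoint_iff_inter_eq_empty, disjoint_comm]; simp
    rw [d2]
    change γ ∈ Split.FM _ _ _ _ _ ∧ _ ∧ _ ∈ Split.FM _ _ _ _ _ ↔ _
    constructor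
    · rintro ⟨h1, ⟨h2, h3⟩, h4⟩
      rw [S.mem_FM, S.memM_uv h2 h3] at h4
      rw [S.mem_FM] at h1
      exact ⟨h4.1, h1.1, h4.2⟩
    · rintro ⟨h1, h2, h3⟩
      have h4 : n true ∉ γ := fun h => S.nΔ _ (h1 h)
      have h5 : n false ∉ γ := fun h => S.nΔ _ (h1 h)
      have h6 : γ ∪ {n true, n false} ∈ FM F w Δ n col := by
        rw [S.mem_FM, S.memM_uv h4 h5]; exact ⟨h1, h3⟩
      exact ⟨S.M.down_closed _ h6 _ Finset.subset_union_left h2, ⟨h4, h5⟩, h6⟩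
  · intro h
    exact S.nF ((S.memM_old.1 ⟨h, S.nΔ _, S.nΔ _⟩).1)
  · ext s
    simp only [Finset.mem_union, Finset.mem_filter, simplexFaces, Finset.mem_powerset]
    change s ∈ F' _ _ _ _ _ ↔ ((s ∈ FM _ _ _ _ _ ∧ _) ∨ _) ∨ _
    rw [S.mem_F', S.mem_FM]
    have nuv : ∀ i τ, Tri F w τ → s ⊆ insert (n i) τ → ¬ {n true, n false} ⊆ s := by
      intro i τ h1 h2 h3
      have a1 := (Finset.mem_insert.1 (h2 (h3 (by simp : n true ∈ _)))).resolve_right (S.nτ h1 _)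
      have a2 := (Finset.mem_insert.1 (h2 (h3 (by simp : n false ∈ _)))).resolve_right (S.nτ h1 _)
      exact S.uv (a1.trans a2.symm)
    constructor
    · rintro ⟨hne, ⟨G, h3, h4, h5, h6⟩ | ⟨i, τ, ⟨h1, h2⟩ | rfl, h3⟩⟩
      · refine Or.inl (Or.inl ⟨⟨hne, Or.inl ⟨G, h3, h4, h5, h6⟩⟩, fun h => ?_⟩)
        exact S.fresh true _ h3 (h6 (h (by simp)))
      · exact Or.inl (Or.inl ⟨⟨hne, Or.inr (Or.inl ⟨i, τ, h1, h2, h3⟩)⟩, nuv i τ h1 h3⟩)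
      · cases i
        · exact Or.inr ⟨h3, hne⟩
        · exact Or.inl (Or.inr ⟨h3, hne⟩)
    · rintro ((⟨⟨hne, h⟩, h'⟩ | ⟨h1, h2⟩) | ⟨h1, h2⟩)
      · refine ⟨hne, ?_⟩
        rcases h with ⟨G, h3, h4, h5, h6⟩ | ⟨j, τ, h3, h4, h5⟩ | ⟨e, h3, h4, h5⟩
        · exact Or.inl ⟨G, h3, h4, h5, h6⟩
        · exact Or.inr ⟨j, τ, Or.inl ⟨h3, h4⟩, h5⟩
        · right
          by_cases ht : n true ∈ s
          · have hf : n false ∉ s := by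
              intro hf
              exact h' (by intro z; simp; rintro (rfl | rfl) <;> assumption)
            refine ⟨true, Δ, Or.inr rfl, fun z hz => ?_⟩
            have := h5 hz
            simp only [Finset.mem_insert] at this ⊢
            rcases this with h | rfl | h
            · exact Or.inl h
            · exact absurd hz hf
            · exact Or.inr (h3 h)
          · refine ⟨false, Δ, Or.inr rfl, fun z hz => ?_⟩
            have := h5 hz
            simp only [Finset.mem_insert] at this ⊢
            rcases this with rfl | h | h
            · exact absurd hz ht
            · exact Or.inl h
            · exact Or.inr (h3 h)
      · exact ⟨h2, Or.inr ⟨true, Δ, Or.inr rfl, h1⟩⟩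
      · exact ⟨h2, Or.inr ⟨false, Δ, Or.inr rfl, h1⟩⟩

theorem Split.count {K : SComplex} {w : ℕ} {Δ : Finset ℕ} {n : Bool → ℕ} {col : Finset ℕ → Bool}
    (S : Split K.faces w Δ n col) : S.K'.g2 < K.g2 := by
  classical
  have h0 : K.fnum 0 + 1 ≤ S.K'.fnum 0 := by
    have hsub : ((K.faces.filter fun s => s.card = 0 + 1).erase {w}) ∪ {{n true}, {n false}} ⊆
        S.K'.faces.filter fun s => s.card = 0 + 1 := by
      intro s hs
      rw [Finset.mem_filter]
      change s ∈ F' _ _ _ _ _ ∧ _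
      rw [S.mem_F']
      simp only [Finset.mem_union, Finset.mem_erase, Finset.mem_filter, Finset.mem_insert,
        Finset.mem_singleton] at hs
      have hnew : ∀ i, Mem' K.faces w Δ n col {n i} := by
        intro i
        have := S.mem_new' (i := i) (Finset.empty_subset Δ)
        simpa using this
      rcases hs with ⟨h1, h2, h3⟩ | rfl | rfl
      · refine ⟨(S.mem_old (S.fresh · _ h2)).2 (Or.inl ⟨h2, ?_⟩), h3⟩
        intro hw
        obtain ⟨x, rfl⟩ := Finset.card_eq_one.1 h3
        simp at hw
        exact h1 (by rw [hw])
      · exact ⟨hnew _, by simp⟩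
      · exact ⟨hnew _, by simp⟩
    have hc := Finset.card_le_card hsub
    rw [Finset.card_union_of_disjoint, Finset.card_erase_of_mem, Finset.card_pair] at hc
    · have : 0 < (K.faces.filter fun s => s.card = 0 + 1).card :=
        Finset.card_pos.2 ⟨{w}, by simp [S.wF]⟩
      unfold fnum
      omega
    · simpa using S.uv
    · simp [S.wF]
    · rw [Finset.disjoint_right]
      intro s hs hs'
      simp only [Finset.mem_erase, Finset.mem_filter, Finset.mem_insert,
        Finset.mem_singleton] at hs hs'
      rcases hs with rfl | rfl
      · exact S.fresh true _ hs'.2.1 (by simp)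
      · exact S.fresh false _ hs'.2.1 (by simp)
  have h1 : S.K'.fnum 1 ≤ K.fnum 1 + 3 := by
    let N := (K.faces.sup id).filter fun x => x ≠ w ∧ ({w, x} : Finset ℕ) ∈ K.faces
    let A : Bool → Finset ℕ := fun i => N.filter fun x => X K.faces w col i {x}
    have hsub : (S.K'.faces.filter fun s => s.card = 1 + 1) ⊆
        ((K.faces.filter fun s => s.card = 1 + 1).filter fun s => w ∉ s) ∪
        ((A true).image (fun x => {n true, x}) ∪ (A false).image (fun x => {n false, x})) := by
      intro s hs
      rw [Finset.mem_filter] at hs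
      obtain ⟨hs, hc⟩ := hs
      change s ∈ F' _ _ _ _ _ at hs
      rw [S.mem_F'] at hs
      by_cases h : ∃ i, n i ∈ s
      · obtain ⟨i, hi⟩ := h
        have hX := S.erase_new hs hi (by omega)
        obtain ⟨x, hx⟩ := Finset.card_eq_one.1 (by rw [Finset.card_erase_of_mem hi]; omega :
          (s.erase (n i)).card = 1)
        rw [hx] at hX
        have hs' : s = {n i, x} := by rw [← Finset.insert_erase hi, hx]
        have hxA : x ∈ A i := by
          have hh := S.XF hX
          have : x ≠ w := by rintro rfl; exact hh.1 (by simp)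
          simp only [A, N, Finset.mem_filter]
          refine ⟨⟨?_, this, hh.2⟩, hX⟩
          exact (Finset.le_sup (f := id) hh.2 : _ ⊆ K.faces.sup id) (by simp)
        apply Finset.mem_union_right
        cases i
        · exact Finset.mem_union_right _ (Finset.mem_image.2 ⟨x, hxA, hs'.symm⟩)
        · exact Finset.mem_union_left _ (Finset.mem_image.2 ⟨x, hxA, hs'.symm⟩)
      · push Not at h
        rw [S.mem_old h] at hs
        have := hs.resolve_right (by rintro rfl; have := S.card; omega)
        apply Finset.mem_union_left
        simp only [Finset.mem_filter]
        exact ⟨⟨this.1, hc⟩, this.2⟩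
    have hc := Finset.card_le_card hsub
    have hu := Finset.card_union_le ((K.faces.filter fun s => s.card = 1 + 1).filter fun s => w ∉ s)
      ((A true).image (fun x => ({n true, x} : Finset ℕ)) ∪ (A false).image (fun x => {n false, x}))
    have hu2 := Finset.card_union_le ((A true).image (fun x => ({n true, x} : Finset ℕ)))
      ((A false).image (fun x => {n false, x}))
    have hi1 := Finset.card_image_le (s := A true) (f := fun x => ({n true, x} : Finset ℕ))
    have hi2 := Finset.card_image_le (s := A false) (f := fun x => ({n false, x} : Finset ℕ))
    have hAA := Finset.card_union_add_card_inter (A true) (A false)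
    have hAu : (A true ∪ A false).card ≤ N.card := by
      apply Finset.card_le_card
      exact Finset.union_subset (Finset.filter_subset _ _) (Finset.filter_subset _ _)
    have hAi : (A true ∩ A false).card ≤ 3 := by
      rw [← S.card]
      apply Finset.card_le_card
      intro x hx
      simp only [A, Finset.mem_inter, Finset.mem_filter] at hx
      have := (S.Xboth hx.1.2 hx.2.2 (by simp)).1
      simpa using this
    have hN : N.card ≤ ((K.faces.filter fun s => s.card = 1 + 1).filter fun s => ¬ w ∉ s).card := by
      refine Finset.card_le_card_of_injOn (fun x => {w, x}) ?_ ?_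
      · intro x hx
        have hx' : x ∈ N := hx
        simp only [N, Finset.mem_filter] at hx'
        simp [hx'.2.2, Finset.card_pair hx'.2.1.symm]
      · intro x hx y hy hxy
        have hx' : x ∈ N := hx
        simp only [N, Finset.mem_filter] at hx'
        have : x ∈ ({w, y} : Finset ℕ) := by
          have h : ({w, x} : Finset ℕ) = {w, y} := hxy
          rw [← h]; simp
        simp [hx'.2.1] at this
        exact this
    have hp := Finset.card_filter_add_card_filter_not (s := K.faces.filter fun s => s.card = 1 + 1)
      (fun t => w ∉ t)
    unfold fnum
    omega
  unfold g2
  have : (K.fnum 0 : ℤ) + 1 ≤ S.K'.fnum 0 := by exact_mod_cast h0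
  have : (S.K'.fnum 1 : ℤ) ≤ K.fnum 1 + 3 := by exact_mod_cast h1
  linarith

theorem Split.absurd {K : SComplex} {w : ℕ} {Δ : Finset ℕ} {n : Bool → ℕ} {col : Finset ℕ → Bool}
    (S : Split K.faces w Δ n col) (hK : InClassR K) : False := by
  have := hK.2.2.2.2 S.K' (normal_of_NP S.NP') (Or.inr (Or.inr (Or.inl ⟨S.M, S.contr, S.bist⟩)))
  have := S.count
  omega

end SComplex


namespace SComplex

theorem parity_even (S : Finset ℕ) (R : ℕ → ℕ → Prop) [DecidableRel R] (hs : ∀ x y, R x y → R y x)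
    (hi : ∀ x, ¬ R x x) : Even (∑ z ∈ S, (S.filter (R z)).card) := by
  classical
  have h1 : ∑ z ∈ S, (S.filter (R z)).card = ((S ×ˢ S).filter fun p => R p.1 p.2).card := by
    rw [Finset.card_filter, Finset.sum_product]
    refine Finset.sum_congr rfl fun z _ => ?_
    rw [Finset.card_filter]
  rw [h1]
  have h2 : (((((S ×ˢ S).filter fun p => R p.1 p.2).card : ℕ)) : ZMod 2) = 0 := by
    rw [Finset.card_eq_sum_ones, Nat.cast_sum]
    refine Finset.sum_involution (fun p _ => (p.2, p.1)) ?_ ?_ ?_ ?_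
    · intro p _; simp; decide
    · rintro ⟨a, b⟩ h _ hh
      simp only [Prod.mk.injEq] at hh
      simp only [Finset.mem_filter] at h
      rw [hh.1] at h
      exact hi _ h.2
    · rintro ⟨a, b⟩ h
      simp only [Finset.mem_filter, Finset.mem_product] at h ⊢
      exact ⟨h.1.symm, hs _ _ h.2⟩
    · rintro ⟨a, b⟩ _; rfl
  exact (ZMod.natCast_eq_zero_iff_even).1 h2

theorem ccdel_aux {F : Finset (Finset ℕ)} (h : NP F) {s : Finset ℕ} {v : ℕ} (hvs : v ∉ s)
    (hc : s.card = 2) (P : ℕ → Prop)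
    (hcl : ∀ p q, p ∉ s → q ∉ s → p ≠ v → q ≠ v → P p → insert p (insert q s) ∈ F → P q)
    (p q : ℕ) (hpq : p ≠ q)
    (H : ∀ x, (x ∉ insert v s ∧ insert x (insert v s) ∈ F) ↔ (x = p ∨ x = q))
    (hp : P p) : P q := by
  classical
  by_contra hq
  have hp' := (H p).2 (Or.inl rfl)
  have hq' := (H q).2 (Or.inr rfl)
  let S := (F.sup id).filter fun z => z ≠ v ∧ z ∉ s ∧ insert z s ∈ F ∧ P z
  have hS : ∀ z, z ∈ S ↔ z ≠ v ∧ z ∉ s ∧ insert z s ∈ F ∧ P z := by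
    intro z
    simp only [S, Finset.mem_filter, and_iff_right_iff_imp]
    rintro ⟨_, _, h3, _⟩
    exact (Finset.le_sup (f := id) h3 : _ ⊆ F.sup id) (by simp)
  let R : ℕ → ℕ → Prop := fun z z' => z ≠ z' ∧ insert z (insert z' s) ∈ F
  have hev := parity_even S R (fun x y hxy => ⟨hxy.1.symm, by rw [Finset.insert_comm]; exact hxy.2⟩)
    (fun x hx => hx.1 rfl)
  have hpS : p ∈ S := by
    rw [hS]
    refine ⟨fun hh => hp'.1 (by simp [hh]), fun hh => hp'.1 (by simp [hh]), ?_, hp⟩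
    exact h.down _ hp'.2 _ (by intro z; simp; tauto) (by simp)
  have nbr : ∀ z ∈ S, ∀ x, x ∈ S.filter (R z) ↔ x ≠ v ∧ (x ∉ insert z s ∧ insert x (insert z s) ∈ F) := by
    intro z hz x
    rw [hS] at hz
    rw [Finset.mem_filter, hS]
    constructor
    · rintro ⟨⟨h1, h2, h3, h4⟩, h5, h6⟩
      exact ⟨h1, by simp [h2, h5.symm], by rw [Finset.insert_comm]; exact h6⟩
    · rintro ⟨h1, h2, h3⟩
      simp only [Finset.mem_insert, not_or] at h2
      refine ⟨⟨h1, h2.2, h.down _ h3 _ (by intro z; simp; tauto) (by simp), ?_⟩, Ne.symm h2.1, ?_⟩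
      · exact hcl z x hz.2.1 h2.2 hz.1 h1 hz.2.2.2 (by rw [Finset.insert_comm]; exact h3)
      · rw [Finset.insert_comm]; exact h3
  have cardp : (S.filter (R p)).card = 1 := by
    have hpS' := (hS p).1 hpS
    obtain ⟨a, b, hab, H2⟩ := h.two (insert p s) hpS'.2.2.1
      (by rw [Finset.card_insert_of_notMem hpS'.2.1, hc])
    have hv : v = a ∨ v = b := by
      rw [← H2]
      refine ⟨by simp [hpS'.1.symm, hvs], ?_⟩
      rw [Finset.insert_comm]; exact hp'.2
    rw [Finset.card_eq_one]
    rcases hv with rfl | rfl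
    · refine ⟨b, ?_⟩
      ext x
      rw [nbr p hpS, H2, Finset.mem_singleton]
      constructor
      · rintro ⟨h1, h2⟩; exact h2.resolve_left h1
      · rintro rfl; exact ⟨hab.symm, Or.inr rfl⟩
    · refine ⟨a, ?_⟩
      ext x
      rw [nbr p hpS, H2, Finset.mem_singleton]
      constructor
      · rintro ⟨h1, h2⟩; exact h2.resolve_right h1
      · rintro rfl; exact ⟨hab, Or.inl rfl⟩
  have cardz : ∀ z ∈ S.erase p, (S.filter (R z)).card = 2 := by
    intro z hz
    rw [Finset.mem_erase] at hz
    obtain ⟨hzp, hzS⟩ := hz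
    have hz' := (hS z).1 hzS
    obtain ⟨a, b, hab, H2⟩ := h.two (insert z s) hz'.2.2.1
      (by rw [Finset.card_insert_of_notMem hz'.2.1, hc])
    have hv : ¬ (v = a ∨ v = b) := by
      rw [← H2]
      rintro ⟨h1, h2⟩
      have : z = p ∨ z = q := by
        rw [← H]
        refine ⟨by simp [hz'.1, hz'.2.1], ?_⟩
        rw [Finset.insert_comm]; exact h2
      rcases this with rfl | rfl
      · exact hzp rfl
      · exact hq hz'.2.2.2
    push Not at hv
    rw [Finset.card_eq_two]
    refine ⟨a, b, hab, ?_⟩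
    ext x
    rw [nbr z hzS, H2, Finset.mem_insert, Finset.mem_singleton]
    constructor
    · exact fun h => h.2
    · rintro (rfl | rfl)
      · exact ⟨hv.1.symm, Or.inl rfl⟩
      · exact ⟨hv.2.symm, Or.inr rfl⟩
  rw [← Finset.add_sum_erase _ _ hpS, cardp, Finset.sum_congr rfl cardz] at hev
  simp only [Finset.sum_const, smul_eq_mul] at hev
  obtain ⟨k, hk⟩ := hev
  omega

theorem ccdel {F : Finset (Finset ℕ)} (h : NP F) {s : Finset ℕ} {v : ℕ} (hs : s ∈ F) (hvs : v ∉ s)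
    (hc : s.card ≤ 2) (P : ℕ → Prop)
    (hcl : ∀ p q, p ∉ s → q ∉ s → p ≠ v → q ≠ v → P p → insert p (insert q s) ∈ F → P q)
    (x y : ℕ) (hx : x ∉ s) (hy : y ∉ s) (hxv : x ≠ v) (hyv : y ≠ v) (hxs : insert x s ∈ F)
    (hys : insert y s ∈ F) (hP : P x) : P y := by
  classical
  by_cases hv : insert v s ∈ F
  · suffices hr : ∃ R : Prop, ∀ z, z ≠ v → z ∉ s → insert z (insert v s) ∈ F → (P z ↔ R) by
      obtain ⟨R, hR⟩ := hr
      have := h.cc s (Or.inr hs) hc (fun z => (z ≠ v → P z) ∧ (z = v → R)) x y hx hy hxs hys ?_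
        ⟨fun _ => hP, fun h => absurd h hxv⟩
      · exact this.1 hyv
      rintro p q hp hq ⟨h1, h2⟩ hpq
      by_cases hpv : p = v
      · subst hpv
        refine ⟨fun hqv => ?_, fun _ => h2 rfl⟩
        rw [hR q hqv hq (by rw [Finset.insert_comm]; exact hpq)]
        exact h2 rfl
      · refine ⟨fun hqv => hcl p q hp hq hpv hqv (h1 hpv) hpq, ?_⟩
        rintro rfl
        exact (hR p hpv hp hpq).1 (h1 hpv)
    by_cases hc2 : s.card = 2
    · obtain ⟨p, q, hpq, H⟩ := h.two (insert v s) hv (by rw [Finset.card_insert_of_notMem hvs, hc2])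
      have a1 := ccdel_aux h hvs hc2 P hcl p q hpq H
      have a2 := ccdel_aux h hvs hc2 P hcl q p hpq.symm (fun x => (H x).trans or_comm)
      refine ⟨P p, fun z hz hzs hzF => ?_⟩
      rcases (H z).1 ⟨by simp [hz, hzs], hzF⟩ with rfl | rfl
      · rfl
      · exact ⟨a2, a1⟩
    · have hcv : (insert v s).card ≤ 2 := by
        rw [Finset.card_insert_of_notMem hvs]; omega
      obtain ⟨z0, hz0, hz0F⟩ := exists_bigger h (Or.inl hv) (by omega)
      have step : ∀ z z', z ∉ insert v s → insert z (insert v s) ∈ F → z' ∉ insert v s →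
          insert z' (insert v s) ∈ F → P z → P z' := by
        intro z z' h1 h2 h3 h4 h5
        refine h.cc (insert v s) (Or.inr hv) hcv P z z' h1 h3 h2 h4 ?_ h5
        intro p q hp hq hPp hpq
        simp only [Finset.mem_insert, not_or] at hp hq
        refine hcl p q hp.2 hq.2 hp.1 hq.1 hPp (h.down _ hpq _ ?_ (by simp))
        intro t; simp; tauto
      refine ⟨P z0, fun z hz hzs hzF => ⟨?_, ?_⟩⟩
      · exact step z z0 (by simp [hz, hzs]) hzF hz0 hz0F
      · exact step z0 z hz0 hz0F (by simp [hz, hzs]) hzF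
  · have := h.cc s (Or.inr hs) hc (fun z => z ≠ v ∧ P z) x y hx hy hxs hys ?_ ⟨hxv, hP⟩
    · exact this.2
    rintro p q hp hq ⟨h1, h2⟩ hpq
    have hqv : q ≠ v := by
      rintro rfl
      exact hv (h.down _ hpq _ (Finset.subset_insert _ _) (by simp))
    exact ⟨hqv, hcl p q hp hq h1 hqv h2 hpq⟩

/-- Data for contracting the edge `uv`. -/
structure Con (F : Finset (Finset ℕ)) (u v w : ℕ) : Prop where
  np : NP F
  ne : u ≠ v
  edge : ({u, v} : Finset ℕ) ∈ F
  LC : ∀ s, s ≠ ∅ → u ∉ s → v ∉ s → insert u s ∈ F → insert v s ∈ F → insert u (insert v s) ∈ F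
  fresh : ∀ s ∈ F, w ∉ s

namespace Con

variable {F : Finset (Finset ℕ)} {u v w : ℕ}

theorem symm (C : Con F u v w) : Con F v u w :=
  ⟨C.np, C.ne.symm, by rw [Finset.pair_comm]; exact C.edge,
    fun s h0 h1 h2 h3 h4 => by rw [Finset.insert_comm]; exact C.LC s h0 h2 h1 h4 h3, C.fresh⟩

/-- Faces of the link of the contracted vertex (including the empty one). -/
def Y (F : Finset (Finset ℕ)) (u v : ℕ) (s : Finset ℕ) : Prop :=
  u ∉ s ∧ v ∉ s ∧ (insert u s ∈ F ∨ insert v s ∈ F)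

theorem Ysymm {s : Finset ℕ} : Y F u v s ↔ Y F v u s := by
  unfold Y; tauto

theorem uF (C : Con F u v w) : {u} ∈ F := C.np.down _ C.edge _ (by simp) (by simp)

theorem Y0 (C : Con F u v w) : Y F u v ∅ := ⟨by simp, by simp, Or.inl (by simpa using C.uF)⟩

theorem YF (C : Con F u v w) {s : Finset ℕ} (h : Y F u v s) (hs : s ≠ ∅) : s ∈ F := by
  rcases h.2.2 with h | h <;> exact C.np.down _ h _ (Finset.subset_insert _ _) hs

theorem Yw (C : Con F u v w) {s : Finset ℕ} (h : Y F u v s) : w ∉ s := by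
  intro hw
  rcases h.2.2 with h | h <;> exact C.fresh _ h (by simp [hw])

theorem wu (C : Con F u v w) : w ≠ u := fun h => C.fresh _ C.uF (by simp [h])

theorem wv (C : Con F u v w) : w ≠ v := C.symm.wu

theorem Ymono (C : Con F u v w) {s s' : Finset ℕ} (h : Y F u v s') (hs : s ⊆ s') : Y F u v s := by
  obtain ⟨h1, h2, h3⟩ := h
  refine ⟨fun h => h1 (hs h), fun h => h2 (hs h), ?_⟩
  rcases h3 with h | h
  · exact Or.inl (C.np.down _ h _ (Finset.insert_subset_insert _ hs) (by simp))
  · exact Or.inr (C.np.down _ h _ (Finset.insert_subset_insert _ hs) (by simp))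

theorem Yle (C : Con F u v w) {s : Finset ℕ} (h : Y F u v s) : s.card ≤ 3 := by
  obtain ⟨h1, h2, h | h⟩ := h
  · have := C.np.le4 _ h
    rw [Finset.card_insert_of_notMem h1] at this; omega
  · have := C.np.le4 _ h
    rw [Finset.card_insert_of_notMem h2] at this; omega

theorem Yup_aux (C : Con F u v w) {s : Finset ℕ} (h : Y F u v s) (hu : insert u s ∈ F) :
    ∃ r, s ⊆ r ∧ Y F u v r ∧ r.card = 3 := by
  classical
  obtain ⟨h1, h2, _⟩ := h
  obtain ⟨G, hG, hsG, hc⟩ := C.np.pure _ hu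
  have huG : u ∈ G := hsG (by simp)
  by_cases hv : v ∈ G
  · set e := (G.erase u).erase v with he
    have hvu : v ∈ G.erase u := by simp [hv, C.ne.symm]
    have hec : e.card = 2 := by
      rw [he, Finset.card_erase_of_mem hvu, Finset.card_erase_of_mem huG]; omega
    have hue : u ∉ e := by simp [he]
    have hve : v ∉ e := by simp [he]
    have hG' : insert v (insert u e) = G := by
      rw [he, Finset.insert_comm, Finset.insert_erase hvu, Finset.insert_erase huG]
    have hueF : insert u e ∈ F := C.np.down _ hG _ (by rw [← hG']; exact Finset.subset_insert _ _) (by simp)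
    obtain ⟨p, q, hpq, H⟩ := C.np.two _ hueF (by rw [Finset.card_insert_of_notMem hue, hec])
    have hvpq := (H v).1 ⟨by simp [hve, C.ne.symm], hG' ▸ hG⟩
    obtain ⟨x, hxv, hx⟩ : ∃ x, x ≠ v ∧ (x = p ∨ x = q) := by
      rcases hvpq with rfl | rfl
      · exact ⟨q, hpq.symm, Or.inr rfl⟩
      · exact ⟨p, hpq, Or.inl rfl⟩
    rw [← H] at hx
    simp only [Finset.mem_insert, not_or] at hx
    refine ⟨insert x e, ?_, ⟨?_, ?_, Or.inl ?_⟩, ?_⟩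
    · intro z hz
      apply Finset.mem_insert_of_mem
      simp only [he, Finset.mem_erase]
      exact ⟨fun h => h2 (h ▸ hz), fun h => h1 (h ▸ hz), hsG (by simp [hz])⟩
    · simp [Ne.symm hx.1.1, hue]
    · simp [Ne.symm hxv, hve]
    · rw [Finset.insert_comm]; exact hx.2
    · rw [Finset.card_insert_of_notMem hx.1.2, hec]
  · refine ⟨G.erase u, ?_, ⟨by simp, by simp [hv], Or.inl ?_⟩, ?_⟩
    · intro z hz
      simp only [Finset.mem_erase]
      exact ⟨fun h => h1 (h ▸ hz), hsG (by simp [hz])⟩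
    · rwa [Finset.insert_erase huG]
    · rw [Finset.card_erase_of_mem huG]; omega

theorem Yup (C : Con F u v w) {s : Finset ℕ} (h : Y F u v s) :
    ∃ r, s ⊆ r ∧ Y F u v r ∧ r.card = 3 := by
  rcases h.2.2 with hu | hv
  · exact C.Yup_aux h hu
  · obtain ⟨r, h1, h2, h3⟩ := C.symm.Yup_aux (Ysymm.1 h) hv
    exact ⟨r, h1, Ysymm.2 h2, h3⟩

theorem notboth (C : Con F u v w) {r : Finset ℕ} (hc : r.card = 3) (hu : u ∉ r) (hv : v ∉ r)
    (h1 : insert u r ∈ F) (h2 : insert v r ∈ F) : False := by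
  have := C.np.le4 _ (C.LC r (by rintro rfl; simp at hc) hu hv h1 h2)
  rw [Finset.card_insert_of_notMem (by simp [C.ne, hu]), Finset.card_insert_of_notMem hv] at this
  omega

open Classical in
/-- The contracted face set. -/
noncomputable def F' (F : Finset (Finset ℕ)) (u v w : ℕ) : Finset (Finset ℕ) :=
  (F.filter fun α => u ∉ α ∧ v ∉ α) ∪ ((insert ∅ F).filter (Y F u v)).image (insert w)

theorem mem_old (_C : Con F u v w) {s : Finset ℕ} (hw : w ∉ s) :
    s ∈ F' F u v w ↔ s ∈ F ∧ u ∉ s ∧ v ∉ s := by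
  classical
  simp only [F', Finset.mem_union, Finset.mem_filter, Finset.mem_image]
  constructor
  · rintro (h | ⟨r, _, rfl⟩)
    · exact h
    · simp at hw
  · exact Or.inl

theorem mem_new (C : Con F u v w) {s : Finset ℕ} (hw : w ∉ s) :
    insert w s ∈ F' F u v w ↔ Y F u v s := by
  classical
  simp only [F', Finset.mem_union, Finset.mem_filter, Finset.mem_image]
  constructor
  · rintro (h | ⟨r, ⟨_, h2⟩, h3⟩)
    · exact absurd (by simp) (C.fresh _ h.1)
    · have : r = s := by
        rw [← Finset.erase_insert (C.Yw h2), h3, Finset.erase_insert hw]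
      rwa [← this]
  · intro h
    refine Or.inr ⟨s, ⟨?_, h⟩, rfl⟩
    rw [Finset.mem_insert]
    by_cases h0 : s = ∅
    · exact Or.inl h0
    · exact Or.inr (C.YF h h0)

theorem two_aux (C : Con F u v w) {e : Finset ℕ} (hc : e.card = 2) (hu : u ∉ e) (hv : v ∉ e)
    (h1 : insert u e ∈ F) (h2 : insert v e ∉ F) :
    ∃ p q, p ≠ q ∧ ∀ x, (x ∉ insert w e ∧ insert x (insert w e) ∈ F' F u v w) ↔ (x = p ∨ x = q) := by
  classical
  obtain ⟨p, q, hpq, H⟩ := C.np.two _ h1 (by rw [Finset.card_insert_of_notMem hu, hc])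
  refine ⟨p, q, hpq, fun x => ?_⟩
  rw [← H]
  have hwe : w ∉ e := fun h => C.fresh _ h1 (by simp [h])
  constructor
  · rintro ⟨a1, a2⟩
    simp only [Finset.mem_insert, not_or] at a1
    rw [Finset.insert_comm, C.mem_new (by simp [Ne.symm a1.1, hwe])] at a2
    obtain ⟨b1, b2, b3⟩ := a2
    simp only [Finset.mem_insert, not_or] at b1
    refine ⟨by simp [a1.2, Ne.symm b1.1], ?_⟩
    rw [Finset.insert_comm]
    refine b3.resolve_right fun h => h2 (C.np.down _ h _ (by intro z; simp; tauto) (by simp))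
  · rintro ⟨a1, a2⟩
    have hxw : x ≠ w := by rintro rfl; exact C.fresh _ a2 (by simp)
    simp only [Finset.mem_insert, not_or] at a1
    refine ⟨by simp [a1.2, hxw], ?_⟩
    rw [Finset.insert_comm, C.mem_new (by simp [Ne.symm hxw, hwe])]
    refine ⟨by simp [Ne.symm a1.1, hu], ?_, Or.inl (by rw [Finset.insert_comm]; exact a2)⟩
    simp only [Finset.mem_insert, not_or]
    refine ⟨?_, hv⟩
    rintro rfl
    exact h2 (C.np.down _ a2 _ (by intro z; simp; tauto) (by simp))

theorem other (C : Con F u v w) {r : Finset ℕ} (hr : r ∈ F) (hc : r.card = 3) {z : ℕ} (hz : z ∉ r)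
    (hzF : insert z r ∈ F) : ∃ q, q ≠ z ∧ ∀ x, (x ∉ r ∧ insert x r ∈ F) ↔ (x = z ∨ x = q) := by
  obtain ⟨p, q, hpq, H⟩ := C.np.two _ hr hc
  rcases (H z).1 ⟨hz, hzF⟩ with rfl | rfl
  · exact ⟨q, hpq.symm, H⟩
  · exact ⟨p, hpq, fun x => (H x).trans or_comm⟩

theorem two_new (C : Con F u v w) {e : Finset ℕ} (hc : e.card = 2) (hY : Y F u v e) :
    ∃ p q, p ≠ q ∧ ∀ x, (x ∉ insert w e ∧ insert x (insert w e) ∈ F' F u v w) ↔ (x = p ∨ x = q) := by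
  classical
  obtain ⟨hu, hv, h⟩ := hY
  by_cases h1 : insert u e ∈ F
  · by_cases h2 : insert v e ∈ F
    · have hwe : w ∉ e := fun h => C.fresh _ h1 (by simp [h])
      have huv := C.LC e (by rintro rfl; simp at hc) hu hv h1 h2
      obtain ⟨p, hpv, Hp⟩ := C.other h1 (by rw [Finset.card_insert_of_notMem hu, hc])
        (z := v) (by simp [C.ne.symm, hv]) (by rw [Finset.insert_comm]; exact huv)
      obtain ⟨q, hqu, Hq⟩ := C.other h2 (by rw [Finset.card_insert_of_notMem hv, hc])
        (z := u) (by simp [C.ne, hu]) huv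
      have hp := (Hp p).2 (Or.inr rfl)
      have hq := (Hq q).2 (Or.inr rfl)
      have mk : ∀ x, x ≠ u → x ≠ v → x ∉ e → (insert u (insert x e) ∈ F ∨ insert v (insert x e) ∈ F) →
          (x ∉ insert w e ∧ insert x (insert w e) ∈ F' F u v w) := by
        intro x hxu hxv hxe h
        have hxw : x ≠ w := by rintro rfl; rcases h with h | h <;> exact C.fresh _ h (by simp)
        refine ⟨by simp [hxw, hxe], ?_⟩
        rw [Finset.insert_comm, C.mem_new (by simp [Ne.symm hxw, hwe])]
        exact ⟨by simp [hxu.symm, hu], by simp [hxv.symm, hv], h⟩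
      simp only [Finset.mem_insert, not_or] at hp hq
      refine ⟨p, q, ?_, fun x => ⟨?_, ?_⟩⟩
      · rintro rfl
        refine C.notboth (r := insert p e) ?_ ?_ ?_ ?_ ?_
        · rw [Finset.card_insert_of_notMem hp.1.2, hc]
        · simp [hqu.symm, hu]
        · simp [hpv.symm, hv]
        · rw [Finset.insert_comm]; exact hp.2
        · rw [Finset.insert_comm]; exact hq.2
      · rintro ⟨a1, a2⟩
        simp only [Finset.mem_insert, not_or] at a1
        rw [Finset.insert_comm, C.mem_new (by simp [Ne.symm a1.1, hwe])] at a2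
        obtain ⟨b1, b2, b3⟩ := a2
        simp only [Finset.mem_insert, not_or] at b1 b2
        rcases b3 with b3 | b3
        · left
          refine ((Hp x).1 ⟨by simp [a1.2, Ne.symm b1.1], ?_⟩).resolve_left (Ne.symm b2.1)
          rw [Finset.insert_comm]; exact b3
        · right
          refine ((Hq x).1 ⟨by simp [a1.2, Ne.symm b2.1], ?_⟩).resolve_left (Ne.symm b1.1)
          rw [Finset.insert_comm]; exact b3
      · rintro (rfl | rfl)
        · exact mk x hp.1.1 hpv hp.1.2 (Or.inl (by rw [Finset.insert_comm]; exact hp.2))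
        · exact mk x hqu hq.1.1 hq.1.2 (Or.inr (by rw [Finset.insert_comm]; exact hq.2))
    · exact C.two_aux hc hu hv h1 h2
  · have h2 := h.resolve_left h1
    have := C.symm.two_aux hc hv hu h2 h1
    have e : F' F v u w = F' F u v w := by
      unfold F'
      congr 1
      · ext; simp; tauto
      · congr 1; ext; simp [Ysymm (u := v)]
    rwa [e] at this

theorem two_old (C : Con F u v w) {r : Finset ℕ} (hc : r.card = 3) (hr : r ∈ F) (hu : u ∉ r)
    (hv : v ∉ r) :
    ∃ p q, p ≠ q ∧ ∀ x, (x ∉ r ∧ insert x r ∈ F' F u v w) ↔ (x = p ∨ x = q) := by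
  classical
  have hwr := C.fresh _ hr
  have hne : r ≠ ∅ := by rintro rfl; simp at hc
  have base : ∀ x, (x ∉ r ∧ insert x r ∈ F' F u v w) ↔
      (x = w ∧ Y F u v r) ∨ (x ≠ u ∧ x ≠ v ∧ x ∉ r ∧ insert x r ∈ F) := by
    intro x
    by_cases hx : x = w
    · subst hx
      rw [C.mem_new hwr]
      constructor
      · exact fun h => Or.inl ⟨rfl, h.2⟩
      · rintro (h | h)
        · exact ⟨hwr, h.2⟩
        · exact absurd (by simp) (C.fresh _ h.2.2.2)
    · rw [C.mem_old (by simp [Ne.symm hx, hwr])]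
      simp only [Finset.mem_insert, not_or, hx, false_and, false_or, hu, hv, not_false_eq_true, and_true]
      constructor
      · rintro ⟨a, b, c, d⟩; exact ⟨Ne.symm c, Ne.symm d, a, b⟩
      · rintro ⟨a, b, c, d⟩; exact ⟨c, d, Ne.symm a, Ne.symm b⟩
  by_cases hY : Y F u v r
  · have : ∃ z, (z = u ∨ z = v) ∧ insert z r ∈ F := by
      rcases hY.2.2 with h | h
      · exact ⟨u, Or.inl rfl, h⟩
      · exact ⟨v, Or.inr rfl, h⟩
    obtain ⟨z, hz, hzF⟩ := this
    obtain ⟨q, hqz, H⟩ := C.other hr hc (z := z) (by rcases hz with rfl | rfl <;> assumption) hzF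
    have hq := (H q).2 (Or.inr rfl)
    have hquv : q ≠ u ∧ q ≠ v := by
      rcases hz with rfl | rfl
      · exact ⟨hqz, by rintro rfl; exact C.notboth hc hu hv hzF hq.2⟩
      · exact ⟨by rintro rfl; exact C.notboth hc hu hv hq.2 hzF, hqz⟩
    refine ⟨w, q, by rintro rfl; exact C.fresh _ hq.2 (by simp), fun x => ?_⟩
    rw [base]
    constructor
    · rintro (h | ⟨h1, h2, h3⟩)
      · exact Or.inl h.1
      · right
        refine ((H x).1 h3).resolve_left ?_
        rintro rfl
        rcases hz with h | h
        · exact h1 h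
        · exact h2 h
    · rintro (rfl | rfl)
      · exact Or.inl ⟨rfl, hY⟩
      · exact Or.inr ⟨hquv.1, hquv.2, hq⟩
  · obtain ⟨p, q, hpq, H⟩ := C.np.two _ hr hc
    refine ⟨p, q, hpq, fun x => ?_⟩
    rw [base, ← H]
    constructor
    · rintro (h | h)
      · exact absurd h.2 hY
      · exact h.2.2
    · intro h
      refine Or.inr ⟨?_, ?_, h⟩
      · rintro rfl; exact hY ⟨hu, hv, Or.inl h.2⟩
      · rintro rfl; exact hY ⟨hu, hv, Or.inr h.2⟩

theorem cc_old (C : Con F u v w) {s : Finset ℕ} (hc : s.card ≤ 2) (hs : s = ∅ ∨ s ∈ F) (hu : u ∉ s)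
    (hv : v ∉ s) (hw : w ∉ s) : CC (F' F u v w) s := by
  classical
  intro P x y hx hy hxs hys hcl hPx
  let f : ℕ → ℕ := fun z => if z = u ∨ z = v then w else z
  have hf : ∀ z, z ∉ s → f z ∉ s := by
    intro z hz
    simp only [f]; split_ifs <;> assumption
  have rep : ∀ x, x ∉ s → insert x s ∈ F' F u v w → ∃ z, z ∉ s ∧ insert z s ∈ F ∧ f z = x := by
    intro x hx h
    by_cases hxw : x = w
    · subst hxw
      rw [C.mem_new hx] at h
      rcases h.2.2 with h | h
      · exact ⟨u, hu, h, by simp [f]⟩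
      · exact ⟨v, hv, h, by simp [f]⟩
    · rw [C.mem_old (by simp [Ne.symm hxw, hw])] at h
      simp only [Finset.mem_insert, not_or] at h
      refine ⟨x, hx, h.1, ?_⟩
      simp [f, Ne.symm h.2.1.1, Ne.symm h.2.2.1]
  obtain ⟨x', hx1, hx2, rfl⟩ := rep x hx hxs
  obtain ⟨y', hy1, hy2, rfl⟩ := rep y hy hys
  refine C.np.cc s hs hc (fun z => P (f z)) x' y' hx1 hy1 hx2 hy2 ?_ hPx
  intro p q hp hq hP hpq
  by_cases hfpq : f p = f q
  · rwa [← hfpq]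
  refine hcl (f p) (f q) (hf p hp) (hf q hq) hP ?_
  have hwp : w ≠ p := by rintro rfl; exact C.fresh _ hpq (by simp)
  have hwq : w ≠ q := by rintro rfl; exact C.fresh _ hpq (by simp)
  by_cases h1 : p = u ∨ p = v
  · by_cases h2 : q = u ∨ q = v
    · exact absurd (by simp [f, h1, h2]) hfpq
    · have e1 : f p = w := by simp [f, h1]
      have e2 : f q = q := by simp [f, h2]
      rw [e1, e2, C.mem_new (by simp [hwq, hw])]
      push Not at h2
      refine ⟨by simp [h2.1.symm, hu], by simp [h2.2.symm, hv], ?_⟩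
      rcases h1 with rfl | rfl
      · exact Or.inl hpq
      · exact Or.inr hpq
  · have e1 : f p = p := by simp [f, h1]
    push Not at h1
    by_cases h2 : q = u ∨ q = v
    · have e2 : f q = w := by simp [f, h2]
      rw [e1, e2, Finset.insert_comm, C.mem_new (by simp [hwp, hw])]
      refine ⟨by simp [h1.1.symm, hu], by simp [h1.2.symm, hv], ?_⟩
      rw [Finset.insert_comm] at hpq
      rcases h2 with rfl | rfl
      · exact Or.inl hpq
      · exact Or.inr hpq
    · have e2 : f q = q := by simp [f, h2]
      push Not at h2
      rw [e1, e2, C.mem_old (by simp [hwp, hwq, hw])]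
      exact ⟨hpq, by simp [h1.1.symm, h2.1.symm, hu], by simp [h1.2.symm, h2.2.symm, hv]⟩

theorem cc_new (C : Con F u v w) {s : Finset ℕ} (hc : s.card ≤ 1) (hY : Y F u v s) :
    CC (F' F u v w) (insert w s) := by
  classical
  intro P x y hx hy hxs hys hcl hPx
  have hws := C.Yw hY
  have hu := hY.1
  have hv := hY.2.1
  have vtx : ∀ z, z ∉ insert w s → insert z (insert w s) ∈ F' F u v w → z ∉ s ∧ z ≠ u ∧ z ≠ v ∧
      (insert z (insert u s) ∈ F ∨ insert z (insert v s) ∈ F) := by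
    intro z hz h
    simp only [Finset.mem_insert, not_or] at hz
    rw [Finset.insert_comm, C.mem_new (by simp [Ne.symm hz.1, hws])] at h
    obtain ⟨h1, h2, h3⟩ := h
    simp only [Finset.mem_insert, not_or] at h1 h2
    rw [Finset.insert_comm u, Finset.insert_comm v] at h3
    exact ⟨hz.2, Ne.symm h1.1, Ne.symm h2.1, h3⟩
  have edge : ∀ p q, p ∉ s → q ∉ s → p ≠ u → q ≠ u → p ≠ v → q ≠ v →
      (insert p (insert q (insert u s)) ∈ F ∨ insert p (insert q (insert v s)) ∈ F) → P p → P q := by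
    intro p q hp hq hpu hqu hpv hqv h hP
    have hwp : w ≠ p := by rintro rfl; rcases h with h | h <;> exact C.fresh _ h (by simp)
    have hwq : w ≠ q := by rintro rfl; rcases h with h | h <;> exact C.fresh _ h (by simp)
    refine hcl p q (by simp [hp, hwp.symm]) (by simp [hq, hwq.symm]) hP ?_
    have e : ∀ z, insert p (insert q (insert z s)) = insert z (insert p (insert q s)) := by
      intro z; ext; simp; tauto
    rw [e, C.mem_new (by simp [hwp, hwq, hws])]
    rw [e, e] at h
    exact ⟨by simp [hpu.symm, hqu.symm, hu], by simp [hpv.symm, hqv.symm, hv], h⟩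
  have hcu : ∀ z, (insert z s).card ≤ 2 := fun z => (Finset.card_insert_le _ _).trans (by omega)
  have su : ∀ x y, x ∉ s → y ∉ s → x ≠ u → y ≠ u → x ≠ v → y ≠ v → insert x (insert u s) ∈ F →
      insert y (insert u s) ∈ F → P x → P y := by
    intro x y hx hy hxu hyu hxv hyv hxF hyF hP
    refine ccdel C.np (s := insert u s) (v := v) (C.np.down _ hxF _ (Finset.subset_insert _ _) (by simp))
      (by simp [C.ne.symm, hv]) (hcu u) P ?_ x y (by simp [hx, hxu]) (by simp [hy, hyu]) hxv hyv hxF hyF hP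
    intro p q hp hq hpv hqv hPp hpq
    simp only [Finset.mem_insert, not_or] at hp hq
    exact edge p q hp.2 hq.2 hp.1 hq.1 hpv hqv (Or.inl hpq) hPp
  have sv : ∀ x y, x ∉ s → y ∉ s → x ≠ u → y ≠ u → x ≠ v → y ≠ v → insert x (insert v s) ∈ F →
      insert y (insert v s) ∈ F → P x → P y := by
    intro x y hx hy hxu hyu hxv hyv hxF hyF hP
    refine ccdel C.np (s := insert v s) (v := u) (C.np.down _ hxF _ (Finset.subset_insert _ _) (by simp))
      (by simp [C.ne, hu]) (hcu v) P ?_ x y (by simp [hx, hxv]) (by simp [hy, hyv]) hxu hyu hxF hyF hP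
    intro p q hp hq hpv hqv hPp hpq
    simp only [Finset.mem_insert, not_or] at hp hq
    exact edge p q hp.2 hq.2 hpv hqv hp.1 hq.1 (Or.inr hpq) hPp
  have mid : insert u s ∈ F → insert v s ∈ F → ∃ z, z ∉ s ∧ z ≠ u ∧ z ≠ v ∧
      insert z (insert u s) ∈ F ∧ insert z (insert v s) ∈ F := by
    intro h1 h2
    have huv : insert u (insert v s) ∈ F := by
      by_cases hs0 : s = ∅
      · subst hs0; simpa using C.edge
      · exact C.LC s hs0 hu hv h1 h2
    have h3 := Finset.card_insert_le u (insert v s)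
    have h4 := hcu v
    obtain ⟨z, hz, hzF⟩ := exists_bigger C.np (Or.inl huv) (by omega)
    simp only [Finset.mem_insert, not_or] at hz
    exact ⟨z, hz.2.2, hz.1, hz.2.1, C.np.down _ hzF _ (by intro t; simp; tauto) (by simp),
      C.np.down _ hzF _ (by intro t; simp; tauto) (by simp)⟩
  obtain ⟨x1, x2, x3, x4⟩ := vtx x hx hxs
  obtain ⟨y1, y2, y3, y4⟩ := vtx y hy hys
  have dn : ∀ z t, insert z (insert t s) ∈ F → insert t s ∈ F := fun z t h =>
    C.np.down _ h _ (Finset.subset_insert _ _) (by simp)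
  rcases x4 with x4 | x4 <;> rcases y4 with y4 | y4
  · exact su x y x1 y1 x2 y2 x3 y3 x4 y4 hPx
  · obtain ⟨z, z1, z2, z3, z4, z5⟩ := mid (dn _ _ x4) (dn _ _ y4)
    exact sv z y z1 y1 z2 y2 z3 y3 z5 y4 (su x z x1 z1 x2 z2 x3 z3 x4 z4 hPx)
  · obtain ⟨z, z1, z2, z3, z4, z5⟩ := mid (dn _ _ y4) (dn _ _ x4)
    exact su z y z1 y1 z2 y2 z3 y3 z4 y4 (sv x z x1 z1 x2 z2 x3 z3 x4 z5 hPx)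
  · exact sv x y x1 y1 x2 y2 x3 y3 x4 y4 hPx

theorem cases' (C : Con F u v w) {s : Finset ℕ} (h : s ∈ F' F u v w) :
    (w ∉ s ∧ s ∈ F ∧ u ∉ s ∧ v ∉ s) ∨ ∃ r, w ∉ r ∧ s = insert w r ∧ Y F u v r := by
  by_cases hw : w ∈ s
  · right
    refine ⟨s.erase w, by simp, (Finset.insert_erase hw).symm, ?_⟩
    rwa [← C.mem_new (by simp), Finset.insert_erase hw]
  · left
    exact ⟨hw, (C.mem_old hw).1 h⟩

theorem NP' (C : Con F u v w) : NP (F' F u v w) := by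
  classical
  have wnew : ∀ r, Y F u v r → insert w r ∈ F' F u v w := fun r h => (C.mem_new (C.Yw h)).2 h
  refine ⟨⟨insert w ∅, wnew _ C.Y0⟩, ?_, ?_, ?_, ?_, ?_, ?_⟩
  · rw [C.mem_old (by simp)]; exact fun h => C.np.emp h.1
  · intro s hs t hts ht
    rcases C.cases' hs with ⟨h1, h2, h3, h4⟩ | ⟨r, h1, rfl, h3⟩
    · rw [C.mem_old (fun h => h1 (hts h))]
      exact ⟨C.np.down _ h2 _ hts ht, fun h => h3 (hts h), fun h => h4 (hts h)⟩
    · by_cases hw : w ∈ t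
      · have : t.erase w ⊆ r := by
          intro z hz
          rw [Finset.mem_erase] at hz
          exact (Finset.mem_insert.1 (hts hz.2)).resolve_left hz.1
        rw [← Finset.insert_erase hw]
        exact wnew _ (C.Ymono h3 this)
      · have : t ⊆ r := (Finset.subset_insert_iff_of_notMem hw).1 hts
        have hY := C.Ymono h3 this
        rw [C.mem_old hw]
        exact ⟨C.YF hY ht, hY.1, hY.2.1⟩
  · intro s hs
    have hup : ∀ r, Y F u v r → ∃ G ∈ F' F u v w, insert w r ⊆ G ∧ G.card = 4 := by
      intro r hr
      obtain ⟨r', h1, h2, h3⟩ := C.Yup hr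
      exact ⟨insert w r', wnew _ h2, Finset.insert_subset_insert _ h1,
        by rw [Finset.card_insert_of_notMem (C.Yw h2), h3]⟩
    rcases C.cases' hs with ⟨h1, h2, h3, h4⟩ | ⟨r, h1, rfl, h3⟩
    · by_cases hY : Y F u v s
      · obtain ⟨G, hG, h5, h6⟩ := hup s hY
        exact ⟨G, hG, (Finset.subset_insert _ _).trans h5, h6⟩
      · obtain ⟨G, hG, h5, h6⟩ := C.np.pure s h2
        refine ⟨G, ?_, h5, h6⟩
        rw [C.mem_old (C.fresh _ hG)]
        refine ⟨hG, fun h => hY ⟨h3, h4, Or.inl ?_⟩, fun h => hY ⟨h3, h4, Or.inr ?_⟩⟩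
        · exact C.np.down _ hG _ (Finset.insert_subset h h5) (by simp)
        · exact C.np.down _ hG _ (Finset.insert_subset h h5) (by simp)
    · exact hup r h3
  · intro s hs
    rcases C.cases' hs with ⟨h1, h2, h3, h4⟩ | ⟨r, h1, rfl, h3⟩
    · exact C.np.le4 _ h2
    · have := C.Yle h3
      rw [Finset.card_insert_of_notMem h1]; omega
  · intro s hs hc
    rcases C.cases' hs with ⟨h1, h2, h3, h4⟩ | ⟨r, h1, rfl, h3⟩
    · exact C.two_old hc h2 h3 h4
    · exact C.two_new (by rw [Finset.card_insert_of_notMem h1] at hc; omega) h3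
  · intro s hs hc
    rcases hs with rfl | hs
    · exact C.cc_old hc (Or.inl rfl) (by simp) (by simp) (by simp)
    · rcases C.cases' hs with ⟨h1, h2, h3, h4⟩ | ⟨r, h1, rfl, h3⟩
      · exact C.cc_old hc (Or.inr h2) h3 h4 h1
      · exact C.cc_new (by rw [Finset.card_insert_of_notMem h1] at hc; omega) h3

end Con
end SComplex


namespace SComplex
namespace Con

variable {F : Finset (Finset ℕ)} {u v w : ℕ}

theorem bdry (C : Con F u v w) {s : Finset ℕ} :
    s ∈ bdryFaces (F.filter fun α => u ∉ α ∧ v ∉ α) 3 ↔ s ≠ ∅ ∧ Y F u v s := by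
  classical
  have cnt : ∀ r ∈ F, u ∉ r → v ∉ r → r.card = 3 →
      (((F.filter fun α => u ∉ α ∧ v ∉ α).filter fun t => t.card = 3 + 1 ∧ r ⊆ t).card = 1 ↔
        Y F u v r) := by
    intro r hr hu hv hc
    have h2 := (two_iff hc).2 (C.np.two r hr hc)
    have h3 := Finset.card_filter_add_card_filter_not (s := F.filter fun t => t.card = 3 + 1 ∧ r ⊆ t)
      (fun t => u ∉ t ∧ v ∉ t)
    have hh : ∀ z, z ∉ r → ∀ t, t.card = 3 + 1 → r ⊆ t → z ∈ t → t = insert z r := by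
      intro z hz t h1 h2 h3
      symm
      apply Finset.eq_of_subset_of_card_le (Finset.insert_subset h3 h2)
      rw [Finset.card_insert_of_notMem hz]; omega
    have h4 : (F.filter fun t => t.card = 3 + 1 ∧ r ⊆ t).filter (fun t => ¬ (u ∉ t ∧ v ∉ t)) =
        if insert u r ∈ F then {insert u r} else if insert v r ∈ F then {insert v r} else ∅ := by
      ext t
      simp only [Finset.mem_filter, not_and_or, not_not]
      have key : ((t ∈ F ∧ t.card = 3 + 1 ∧ r ⊆ t) ∧ (u ∈ t ∨ v ∈ t)) ↔
          (t = insert u r ∧ insert u r ∈ F) ∨ (t = insert v r ∧ insert v r ∈ F) := by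
        constructor
        · rintro ⟨⟨h1, h2, h3⟩, h4 | h4⟩
          · have := hh u hu t h2 h3 h4
            exact Or.inl ⟨this, this ▸ h1⟩
          · have := hh v hv t h2 h3 h4
            exact Or.inr ⟨this, this ▸ h1⟩
        · rintro (⟨rfl, h⟩ | ⟨rfl, h⟩)
          · exact ⟨⟨h, by rw [Finset.card_insert_of_notMem hu, hc], Finset.subset_insert _ _⟩,
              by simp⟩
          · exact ⟨⟨h, by rw [Finset.card_insert_of_notMem hv, hc], Finset.subset_insert _ _⟩,
              by simp⟩
      rw [key]
      split_ifs with hif hif2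
      · have := C.notboth hc hu hv hif
        rw [Finset.mem_singleton]; tauto
      · rw [Finset.mem_singleton]; tauto
      · simp [hif, hif2]
    rw [h4, h2] at h3
    rw [Finset.filter_comm]
    unfold Y
    split_ifs at h3 with hif hif2
    · rw [Finset.card_singleton] at h3
      exact ⟨fun _ => ⟨hu, hv, Or.inl hif⟩, fun _ => by omega⟩
    · rw [Finset.card_singleton] at h3
      exact ⟨fun _ => ⟨hu, hv, Or.inr hif2⟩, fun _ => by omega⟩
    · rw [Finset.card_empty] at h3
      exact ⟨fun h => by omega, fun h => by tauto⟩
  simp only [bdryFaces, Finset.mem_filter]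
  constructor
  · rintro ⟨⟨h1, h2⟩, r, ⟨hr, hwr⟩, hsr, hc, h3⟩
    have h4 := (cnt r hr hwr.1 hwr.2 hc).1 (by simpa only [Finset.filter_filter] using h3)
    exact ⟨fun h => C.np.emp (h ▸ h1), C.Ymono h4 hsr⟩
  · rintro ⟨h1, h2⟩
    obtain ⟨τ, h4, h5, h6⟩ := C.Yup h2
    have hτ : τ ∈ F := C.YF h5 (by rintro rfl; simp at h6)
    refine ⟨⟨C.YF h2 h1, h2.1, h2.2.1⟩, τ, ⟨hτ, h5.1, h5.2.1⟩, h4, h6, ?_⟩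
    have := (cnt τ hτ h5.1 h5.2.1 h6).2 h5
    simpa only [Finset.filter_filter] using this

/-- The contracted complex. -/
noncomputable def K' (C : Con F u v w) : SComplex where
  faces := F' F u v w
  not_empty_mem := C.NP'.emp
  down_closed := C.NP'.down

end Con

theorem Con.contr {K : SComplex} {u v w : ℕ} (C : Con K.faces u v w) : EdgeContraction K C.K' := by
  classical
  refine ⟨u, v, C.edge, C.ne, ?_, w, ?_, ?_⟩
  · ext γ
    simp only [Finset.mem_inter, lk, Finset.mem_filter]
    have d1 : ∀ x, γ ∩ {x} = ∅ ↔ x ∉ γ := by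
      intro x; rw [← Finset.disjoint_iff_inter_eq_empty, disjoint_comm]; simp
    have d2 : γ ∩ {u, v} = ∅ ↔ u ∉ γ ∧ v ∉ γ := by
      rw [← Finset.disjoint_iff_inter_eq_empty, disjoint_comm]; simp
    have e1 : ∀ x, γ ∪ {x} = insert x γ := by intro x; ext z; simp
    have e2 : γ ∪ {u, v} = insert u (insert v γ) := by ext z; simp
    rw [d1, d1, d2, e1, e1, e2]
    constructor
    · rintro ⟨⟨h1, h2, h3⟩, ⟨_, h4, h5⟩⟩
      exact ⟨h1, ⟨h2, h4⟩, C.LC γ (fun h => K.not_empty_mem (h ▸ h1)) h2 h4 h3 h5⟩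
    · rintro ⟨h1, ⟨h2, h3⟩, h4⟩
      refine ⟨⟨h1, h2, K.down_closed _ h4 _ ?_ (by simp)⟩, h1, h3, K.down_closed _ h4 _ ?_ (by simp)⟩
      · intro z; simp; tauto
      · intro z; simp; tauto
  · intro h
    simp only [vertexSet, Finset.mem_sup, id] at h
    obtain ⟨s, hs, hws⟩ := h
    exact C.fresh s hs hws
  · ext s
    simp only [coneFaces, Finset.mem_union, Finset.mem_image, C.bdry, Finset.mem_singleton,
      Finset.mem_filter]
    change s ∈ F' _ _ _ _ ↔ _
    constructor
    · intro hs
      rcases C.cases' hs with ⟨_, h⟩ | ⟨r, h1, rfl, h3⟩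
      · exact Or.inl h
      · right
        by_cases hr : r = ∅
        · right; rw [hr]; rfl
        · exact Or.inl (Or.inr ⟨r, ⟨hr, h3⟩, rfl⟩)
    · rintro (h | (h | ⟨s, h, rfl⟩) | rfl)
      · exact (C.mem_old (C.fresh _ h.1)).2 h
      · exact (C.mem_old (C.Yw h.2)).2 ⟨C.YF h.2 h.1, h.2.1, h.2.2.1⟩
      · exact (C.mem_new (C.Yw h.2)).2 h.2
      · exact (C.mem_new (by simp)).2 C.Y0

theorem Con.count {K : SComplex} {u v w : ℕ} (C : Con K.faces u v w) (D : Finset ℕ)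
    (hD4 : 4 ≤ D.card)
    (hD : ∀ x ∈ D, x ≠ u ∧ x ≠ v ∧ ({u, x} : Finset ℕ) ∈ K.faces ∧ ({v, x} : Finset ℕ) ∈ K.faces) :
    C.K'.g2 < K.g2 := by
  classical
  have h0 : K.fnum 0 ≤ C.K'.fnum 0 + 1 := by
    have hsub : insert {w} (((K.faces.filter fun s => s.card = 0 + 1).erase {u}).erase {v}) ⊆
        C.K'.faces.filter fun s => s.card = 0 + 1 := by
      intro s hs
      rw [Finset.mem_filter]
      change s ∈ F' _ _ _ _ ∧ _
      simp only [Finset.mem_erase, Finset.mem_filter, Finset.mem_insert] at hs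
      rcases hs with rfl | ⟨h1, h2, h3, h4⟩
      · exact ⟨(C.mem_new (s := ∅) (by simp)).2 C.Y0, by simp⟩
      · refine ⟨(C.mem_old (C.fresh _ h3)).2 ⟨h3, ?_, ?_⟩, h4⟩
        · intro hw
          obtain ⟨x, rfl⟩ := Finset.card_eq_one.1 h4
          simp at hw
          exact h2 (by rw [hw])
        · intro hw
          obtain ⟨x, rfl⟩ := Finset.card_eq_one.1 h4
          simp at hw
          exact h1 (by rw [hw])
    have hc := Finset.card_le_card hsub
    rw [Finset.card_insert_of_notMem] at hc
    · have p1 := Finset.pred_card_le_card_erase (s := (K.faces.filter fun s => s.card = 0 + 1)) (a := {u})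
      have p2 := Finset.pred_card_le_card_erase
        (s := (K.faces.filter fun s => s.card = 0 + 1).erase {u}) (a := {v})
      unfold fnum
      omega
    · intro hs
      simp only [Finset.mem_erase, Finset.mem_filter] at hs
      exact C.fresh _ hs.2.2.1 (by simp)
  have h1 : C.K'.fnum 1 + 5 ≤ K.fnum 1 := by
    let V := ((K.faces.sup id).erase u).erase v
    let A := V.filter fun x => ({u, x} : Finset ℕ) ∈ K.faces
    let B := V.filter fun x => ({v, x} : Finset ℕ) ∈ K.faces
    have hV : ∀ x, x ≠ u → x ≠ v → ∀ y, ({y, x} : Finset ℕ) ∈ K.faces → x ∈ V := by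
      intro x h1 h2 y h3
      simp only [V, Finset.mem_erase]
      refine ⟨h2, h1, ?_⟩
      exact (Finset.le_sup (f := id) h3 : _ ⊆ K.faces.sup id) (by simp)
    have hVu : ∀ x ∈ V, x ≠ u ∧ x ≠ v := by
      intro x hx
      simp only [V, Finset.mem_erase] at hx
      exact ⟨hx.2.1, hx.1⟩
    have hsub : (C.K'.faces.filter fun s => s.card = 1 + 1) ⊆
        ((K.faces.filter fun s => s.card = 1 + 1).filter fun s => u ∉ s ∧ v ∉ s) ∪
        (A ∪ B).image (fun x => {w, x}) := by
      intro s hs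
      rw [Finset.mem_filter] at hs
      obtain ⟨hs, hc⟩ := hs
      change s ∈ F' _ _ _ _ at hs
      rcases C.cases' hs with ⟨_, h⟩ | ⟨r, h1, rfl, h3⟩
      · apply Finset.mem_union_left
        simp only [Finset.mem_filter]
        exact ⟨⟨h.1, hc⟩, h.2⟩
      · apply Finset.mem_union_right
        rw [Finset.card_insert_of_notMem h1] at hc
        obtain ⟨x, rfl⟩ := Finset.card_eq_one.1 (by omega : r.card = 1)
        refine Finset.mem_image.2 ⟨x, ?_, rfl⟩
        obtain ⟨a1, a2, a3⟩ := h3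
        have b1 : x ≠ u := fun h => a1 (by simp [h])
        have b2 : x ≠ v := fun h => a2 (by simp [h])
        rw [Finset.mem_union]
        rcases a3 with a3 | a3
        · exact Or.inl (Finset.mem_filter.2 ⟨hV x b1 b2 u a3, a3⟩)
        · exact Or.inr (Finset.mem_filter.2 ⟨hV x b1 b2 v a3, a3⟩)
    have hc := Finset.card_le_card hsub
    have hu := Finset.card_union_le
      ((K.faces.filter fun s => s.card = 1 + 1).filter fun s => u ∉ s ∧ v ∉ s)
      ((A ∪ B).image (fun x => ({w, x} : Finset ℕ)))
    have hi1 := Finset.card_image_le (s := A ∪ B) (f := fun x => ({w, x} : Finset ℕ))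
    have hAA := Finset.card_union_add_card_inter A B
    have hAi : 4 ≤ (A ∩ B).card := by
      refine hD4.trans (Finset.card_le_card ?_)
      intro x hx
      obtain ⟨d1, d2, d3, d4⟩ := hD x hx
      simp only [A, B, Finset.mem_inter, Finset.mem_filter]
      exact ⟨⟨hV x d1 d2 u d3, d3⟩, hV x d1 d2 u d3, d4⟩
    have hN : A.card + B.card + 1 ≤
        ((K.faces.filter fun s => s.card = 1 + 1).filter fun s => ¬ (u ∉ s ∧ v ∉ s)).card := by
      have inj : ∀ (y : ℕ) (A : Finset ℕ), (∀ x ∈ A, x ≠ y) → (A.image fun x => ({y, x} : Finset ℕ)).card = A.card := by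
        intro y A hA
        apply Finset.card_image_of_injOn
        intro x hx z hz hxz
        have : x ∈ ({y, z} : Finset ℕ) := by
          have h : ({y, x} : Finset ℕ) = {y, z} := hxz
          rw [← h]; simp
        simp [hA x hx] at this
        exact this
      have hA' : ∀ x ∈ A, x ≠ u ∧ x ≠ v := fun x hx => hVu x (Finset.mem_filter.1 hx).1
      have hB' : ∀ x ∈ B, x ≠ u ∧ x ≠ v := fun x hx => hVu x (Finset.mem_filter.1 hx).1
      have e1 := inj u A (fun x hx => (hA' x hx).1)
      have e2 := inj v B (fun x hx => (hB' x hx).2)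
      rw [← e1, ← e2, ← Finset.card_union_of_disjoint, ← Finset.card_insert_of_notMem (a := {u, v})]
      · apply Finset.card_le_card
        intro s hs
        simp only [Finset.mem_insert, Finset.mem_union, Finset.mem_image, Finset.mem_filter] at hs ⊢
        rcases hs with rfl | ⟨x, hx, rfl⟩ | ⟨x, hx, rfl⟩
        · exact ⟨⟨C.edge, Finset.card_pair C.ne⟩, by simp⟩
        · exact ⟨⟨(Finset.mem_filter.1 hx).2, Finset.card_pair (hA' x hx).1.symm⟩, by simp⟩
        · exact ⟨⟨(Finset.mem_filter.1 hx).2, Finset.card_pair (hB' x hx).2.symm⟩, by simp⟩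
      · simp only [Finset.mem_union, Finset.mem_image, not_or, not_exists, not_and]
        refine ⟨fun x hx h => ?_, fun x hx h => ?_⟩
        · have : x ∈ ({u, v} : Finset ℕ) := by rw [← h]; simp
          simp [hA' x hx] at this
        · have : x ∈ ({u, v} : Finset ℕ) := by rw [← h]; simp
          simp [hB' x hx] at this
      · rw [Finset.disjoint_left]
        simp only [Finset.mem_image]
        rintro s ⟨x, hx, rfl⟩ ⟨y, hy, h⟩
        have : v ∈ ({u, x} : Finset ℕ) := by rw [← h]; simp
        simp [C.ne.symm, (hA' x hx).2.symm] at this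
    have hp := Finset.card_filter_add_card_filter_not (s := K.faces.filter fun s => s.card = 1 + 1)
      (fun t => u ∉ t ∧ v ∉ t)
    unfold fnum
    omega
  unfold g2
  have : (K.fnum 0 : ℤ) ≤ C.K'.fnum 0 + 1 := by exact_mod_cast h0
  have : (C.K'.fnum 1 : ℤ) + 5 ≤ K.fnum 1 := by exact_mod_cast h1
  linarith

theorem Con.absurd {K : SComplex} {u v w : ℕ} (C : Con K.faces u v w) (D : Finset ℕ)
    (hD4 : 4 ≤ D.card)
    (hD : ∀ x ∈ D, x ≠ u ∧ x ≠ v ∧ ({u, x} : Finset ℕ) ∈ K.faces ∧ ({v, x} : Finset ℕ) ∈ K.faces)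
    (hK : InClassR K) : False := by
  have := hK.2.2.2.2 C.K' (normal_of_NP C.NP') (Or.inr (Or.inl C.contr))
  have := C.count D hD4 hD
  omega

end SComplex


namespace SComplex

/-- Vertices. -/
def gV (F : Finset (Finset ℕ)) : Finset ℕ := (F.sup id).filter fun v => {v} ∈ F
/-- Neighbours. -/
def gN (F : Finset (Finset ℕ)) (x : ℕ) : Finset ℕ :=
  (F.sup id).filter fun y => y ≠ x ∧ {x, y} ∈ F
/-- Vertices of the link of an edge. -/
def gD (F : Finset (Finset ℕ)) (x y : ℕ) : Finset ℕ :=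
  (F.sup id).filter fun z => x ≠ y ∧ z ≠ x ∧ z ≠ y ∧ {x, y, z} ∈ F

variable {F : Finset (Finset ℕ)}

theorem mem_gV {v : ℕ} : v ∈ gV F ↔ {v} ∈ F := by
  simp only [gV, Finset.mem_filter, and_iff_right_iff_imp]
  intro h
  exact (Finset.le_sup (f := id) h : _ ⊆ F.sup id) (by simp)

theorem mem_gN {x y : ℕ} : y ∈ gN F x ↔ y ≠ x ∧ {x, y} ∈ F := by
  simp only [gN, Finset.mem_filter, and_iff_right_iff_imp]
  rintro ⟨_, h⟩
  exact (Finset.le_sup (f := id) h : _ ⊆ F.sup id) (by simp)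

theorem mem_gD {x y z : ℕ} : z ∈ gD F x y ↔ x ≠ y ∧ z ≠ x ∧ z ≠ y ∧ {x, y, z} ∈ F := by
  simp only [gD, Finset.mem_filter, and_iff_right_iff_imp]
  rintro ⟨_, _, _, h⟩
  exact (Finset.le_sup (f := id) h : _ ⊆ F.sup id) (by simp)

theorem exists_fresh (F : Finset (Finset ℕ)) : ∃ n : Bool → ℕ, (∀ i, ∀ s ∈ F, n i ∉ s) ∧
    ∀ i j, n i = n j → i = j := by
  refine ⟨fun b => (F.sup id).sup id + (if b then 1 else 2), ?_, ?_⟩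
  · intro i s hs hi
    have h1 := (Finset.le_sup (f := id) hs : _ ⊆ F.sup id) hi
    have h2 : _ ≤ (F.sup id).sup id := Finset.le_sup (f := id) h1
    simp only [id] at h2
    split_ifs at h2 <;> omega
  · intro i j
    cases i <;> cases j <;> simp

/-- Double counting of edges. -/
theorem count1 (N : Finset ℕ) (E : Finset (Finset ℕ)) (D : ℕ → Finset ℕ)
    (hE : ∀ e ∈ E, e.card = 2 ∧ e ⊆ N) (hD : ∀ y ∈ N, ∀ z, z ∈ D y ↔ z ≠ y ∧ {y, z} ∈ E) :
    ∑ y ∈ N, (D y).card = 2 * E.card := by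
  classical
  have h1 : ∀ y ∈ N, (D y).card = (E.filter fun e => y ∈ e).card := by
    intro y hy
    refine Finset.card_bij (fun z _ => {y, z}) ?_ ?_ ?_
    · intro z hz
      rw [hD y hy] at hz
      simp [hz.2]
    · intro z hz z' hz' h
      rw [hD y hy] at hz
      have : z ∈ ({y, z'} : Finset ℕ) := by rw [← h]; simp
      simpa [hz.1] using this
    · intro e he
      rw [Finset.mem_filter] at he
      obtain ⟨a, b, hab, rfl⟩ := Finset.card_eq_two.1 (hE e he.1).1
      have := he.2
      simp only [Finset.mem_insert, Finset.mem_singleton] at this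
      rcases this with rfl | rfl
      · exact ⟨b, (hD _ hy b).2 ⟨hab.symm, he.1⟩, rfl⟩
      · exact ⟨a, (hD _ hy a).2 ⟨hab, by rw [Finset.pair_comm]; exact he.1⟩, Finset.pair_comm _ _⟩
  rw [Finset.sum_congr rfl h1]
  simp only [Finset.card_filter]
  rw [Finset.sum_comm]
  have h2 : ∀ e ∈ E, ∑ y ∈ N, (if y ∈ e then 1 else 0) = 2 := by
    intro e he
    rw [← Finset.card_filter, Finset.filter_mem_eq_inter, Finset.inter_eq_right.2 (hE e he).2,
      (hE e he).1]
  rw [Finset.sum_congr rfl h2]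
  simp [mul_comm]

/-- Double counting of triangles. -/
theorem count2 (E T : Finset (Finset ℕ)) (hT : ∀ τ ∈ T, τ.card = 3)
    (hE : ∀ e ∈ E, e.card = 2)
    (hET : ∀ τ ∈ T, ∀ e ⊆ τ, e.card = 2 → e ∈ E)
    (h2 : ∀ e ∈ E, (T.filter fun τ => e ⊆ τ).card = 2) : 3 * T.card = 2 * E.card := by
  classical
  have h1 : ∑ e ∈ E, (T.filter fun τ => e ⊆ τ).card = 2 * E.card := by
    rw [Finset.sum_congr rfl h2]; simp [mul_comm]
  rw [← h1]
  simp only [Finset.card_filter]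
  rw [Finset.sum_comm]
  have h3 : ∀ τ ∈ T, ∑ e ∈ E, (if e ⊆ τ then 1 else 0) = 3 := by
    intro τ hτ
    rw [← Finset.card_filter]
    have : E.filter (fun e => e ⊆ τ) = τ.powersetCard 2 := by
      ext e
      simp only [Finset.mem_filter, Finset.mem_powersetCard]
      exact ⟨fun h => ⟨h.2, hE e h.1⟩, fun h => ⟨hET τ hτ e h.1 h.2, h.1⟩⟩
    rw [this, Finset.card_powersetCard, hT τ hτ]
    rfl
  rw [Finset.sum_congr rfl h3]
  simp [mul_comm]

theorem mem_lk1 {K : SComplex} {x : ℕ} {s : Finset ℕ} :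
    s ∈ (K.lk {x}).faces ↔ s ≠ ∅ ∧ x ∉ s ∧ insert x s ∈ K.faces := by
  have d1 : s ∩ {x} = ∅ ↔ x ∉ s := by
    rw [← Finset.disjoint_iff_inter_eq_empty, disjoint_comm]; simp
  have e1 : s ∪ {x} = insert x s := by ext z; simp
  simp only [lk, Finset.mem_filter, d1, e1]
  constructor
  · rintro ⟨h1, h2, h3⟩
    exact ⟨fun h => K.not_empty_mem (h ▸ h1), h2, h3⟩
  · rintro ⟨h1, h2, h3⟩
    exact ⟨K.down_closed _ h3 _ (Finset.subset_insert _ _) h1, h2, h3⟩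

/-- The two triangles of the link of `x` around an edge. -/
theorem link_two {K : SComplex} (hn : NP K.faces) {x : ℕ} {e : Finset ℕ} (hc : e.card = 2)
    (hx : x ∉ e) (he : insert x e ∈ K.faces) :
    ∃ p q, p ≠ q ∧ p ∉ e ∧ q ∉ e ∧
      (K.lk {x}).faces.filter (fun τ => τ.card = 3 ∧ e ⊆ τ) = {insert p e, insert q e} := by
  classical
  obtain ⟨p, q, hpq, H⟩ := hn.two _ he (by rw [Finset.card_insert_of_notMem hx, hc])
  have hp := (H p).2 (Or.inl rfl)
  have hq := (H q).2 (Or.inr rfl)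
  simp only [Finset.mem_insert, not_or] at hp hq
  refine ⟨p, q, hpq, hp.1.2, hq.1.2, ?_⟩
  ext τ
  simp only [Finset.mem_filter, mem_lk1, Finset.mem_insert, Finset.mem_singleton]
  constructor
  · rintro ⟨⟨h1, h2, h3⟩, h4, h5⟩
    obtain ⟨z, hz⟩ := Finset.card_eq_one.1 (by rw [Finset.card_sdiff_of_subset h5]; omega :
      (τ \ e).card = 1)
    have hze : z ∉ e := by
      have : z ∈ τ \ e := by rw [hz]; simp
      exact (Finset.mem_sdiff.1 this).2
    have hτ : τ = insert z e := by
      rw [← Finset.sdiff_union_of_subset h5, hz, Finset.insert_eq]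
    have hzx : z ≠ x := by rintro rfl; exact h2 (by rw [hτ]; simp)
    have := (H z).1 ⟨by simp [hzx, hze], by rw [Finset.insert_comm, ← hτ]; exact h3⟩
    rcases this with rfl | rfl
    · exact Or.inl hτ
    · exact Or.inr hτ
  · have aux : ∀ r, (r ≠ x ∧ r ∉ e) → insert r (insert x e) ∈ K.faces → τ = insert r e →
        (τ ≠ ∅ ∧ x ∉ τ ∧ insert x τ ∈ K.faces) ∧ τ.card = 3 ∧ e ⊆ τ := by
      rintro r ⟨h1, h2⟩ h3 rfl
      refine ⟨⟨by simp, by simp [h1.symm, hx], by rw [Finset.insert_comm]; exact h3⟩, ?_,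
        Finset.subset_insert _ _⟩
      rw [Finset.card_insert_of_notMem h2, hc]
    rintro (h | h)
    · exact aux p hp.1 hp.2 h
    · exact aux q hq.1 hq.2 h

theorem link_counts {K : SComplex} (hn : NP K.faces) (x : ℕ) :
    (K.lk {x}).fnum 0 = (gN K.faces x).card ∧
    ∑ y ∈ gN K.faces x, (gD K.faces x y).card = 2 * (K.lk {x}).fnum 1 ∧
    3 * (K.lk {x}).fnum 2 = 2 * (K.lk {x}).fnum 1 := by
  classical
  refine ⟨?_, ?_, ?_⟩
  · symm
    refine Finset.card_bij (fun y _ => {y}) ?_ ?_ ?_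
    · intro y hy
      rw [mem_gN] at hy
      simp only [Finset.mem_filter, mem_lk1]
      exact ⟨⟨by simp, by simpa using hy.1.symm, hy.2⟩, by simp⟩
    · intro a _ b _ h
      simpa using h
    · intro s hs
      simp only [Finset.mem_filter, mem_lk1] at hs
      obtain ⟨y, rfl⟩ := Finset.card_eq_one.1 hs.2
      refine ⟨y, ?_, rfl⟩
      rw [mem_gN]
      exact ⟨fun h => hs.1.2.1 (by simp [h]), hs.1.2.2⟩
  · apply count1
    · intro e he
      simp only [Finset.mem_filter, mem_lk1] at he
      refine ⟨he.2, fun z hz => ?_⟩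
      rw [mem_gN]
      refine ⟨fun h => he.1.2.1 (h ▸ hz), hn.down _ he.1.2.2 _ ?_ (by simp)⟩
      intro a ha
      simp only [Finset.mem_insert, Finset.mem_singleton] at ha ⊢
      rcases ha with rfl | rfl
      · exact Or.inl rfl
      · exact Or.inr hz
    · intro y hy z
      rw [mem_gN] at hy
      simp only [Finset.mem_filter, mem_lk1, mem_gD]
      constructor
      · rintro ⟨h1, h2, h3, h4⟩
        exact ⟨h3, ⟨by simp, by simp [h1, h2.symm], h4⟩, Finset.card_pair h3.symm⟩
      · rintro ⟨h1, ⟨_, h2, h3⟩, _⟩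
        simp only [Finset.mem_insert, Finset.mem_singleton, not_or] at h2
        exact ⟨h2.1, Ne.symm h2.2, h1, h3⟩
  · apply count2
    · intro τ hτ; exact (Finset.mem_filter.1 hτ).2
    · intro τ hτ; exact (Finset.mem_filter.1 hτ).2
    · intro τ hτ e he hc
      simp only [Finset.mem_filter, mem_lk1] at hτ ⊢
      exact ⟨⟨by rintro rfl; simp at hc, fun h => hτ.1.2.1 (he h),
        hn.down _ hτ.1.2.2 _ (Finset.insert_subset_insert _ he) (by simp)⟩, hc⟩
    · intro e he
      simp only [Finset.mem_filter, mem_lk1] at he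
      obtain ⟨p, q, hpq, hp, hq, H⟩ := link_two hn he.2 he.1.2.1 he.1.2.2
      rw [Finset.filter_filter]
      have : (K.lk {x}).faces.filter (fun τ => τ.card = 2 + 1 ∧ e ⊆ τ) = {insert p e, insert q e} := H
      rw [this]
      apply Finset.card_pair
      intro h
      have : p ∈ insert q e := by rw [← h]; simp
      rcases Finset.mem_insert.1 this with h | h
      · exact hpq h
      · exact hp h

theorem total_counts {K : SComplex} (hn : NP K.faces) :
    K.fnum 0 = (gV K.faces).card ∧ ∑ y ∈ gV K.faces, (gN K.faces y).card = 2 * K.fnum 1 := by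
  classical
  refine ⟨?_, ?_⟩
  · symm
    refine Finset.card_bij (fun y _ => {y}) ?_ ?_ ?_
    · intro y hy
      rw [mem_gV] at hy
      simp [hy]
    · intro a _ b _ h
      simpa using h
    · intro s hs
      simp only [Finset.mem_filter] at hs
      obtain ⟨y, rfl⟩ := Finset.card_eq_one.1 hs.2
      exact ⟨y, mem_gV.2 hs.1, rfl⟩
  · apply count1
    · intro e he
      simp only [Finset.mem_filter] at he
      refine ⟨he.2, fun z hz => ?_⟩
      rw [mem_gV]
      exact hn.down _ he.1 _ (by simpa using hz) (by simp)
    · intro y hy z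
      simp only [Finset.mem_filter, mem_gN]
      constructor
      · rintro ⟨h1, h2⟩
        exact ⟨h1, h2, Finset.card_pair h1.symm⟩
      · rintro ⟨h1, h2, _⟩
        exact ⟨h1, h2⟩

theorem A7_of {K : SComplex} (hn : NP K.faces) {t h : ℕ}
    (hlink : (K.lk {t}).euler = 2 - 2 * (h : ℤ)) :
    ∑ v ∈ gN K.faces t, (gD K.faces t v).card + 12 = 6 * (gN K.faces t).card + 12 * h := by
  obtain ⟨h1, h2, h3⟩ := link_counts hn t
  unfold euler at hlink
  rw [h2, ← h1]
  omega

theorem A8_of {K : SComplex} (hn : NP K.faces) (x : ℕ) :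
    6 ∣ ∑ y ∈ gN K.faces x, (gD K.faces x y).card := by
  obtain ⟨h1, h2, h3⟩ := link_counts hn x
  rw [h2]
  omega

/-- If all 4-subsets of a 5-set are faces, there are no other vertices. -/
theorem five_all (hn : NP F) {U : Finset ℕ} (hU : U.card = 5)
    (h4 : ∀ G ⊆ U, G.card = 4 → G ∈ F) : gV F ⊆ U := by
  classical
  have hsubF : ∀ s ⊆ U, s.card ≤ 3 → s ≠ ∅ → s ∈ F := by
    intro s hs hc h0
    obtain ⟨G, h1, h2, h3⟩ := Finset.exists_subsuperset_card_eq hs (by omega : s.card ≤ 4) (by omega)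
    exact hn.down _ (h4 G h2 h3) _ h1 h0
  have l3 : ∀ s ⊆ U, s.card = 3 → ∀ q, q ∉ s → insert q s ∈ F → q ∈ U := by
    intro s hs hc q hq hqF
    obtain ⟨p, r, hpr, H⟩ := hn.two s (hsubF s hs (by omega) (by rintro rfl; simp at hc)) hc
    obtain ⟨a, b, hab, e⟩ := Finset.card_eq_two.1 (by rw [Finset.card_sdiff_of_subset hs]; omega :
      (U \ s).card = 2)
    have ha : a ∈ U \ s := by rw [e]; simp
    have hb : b ∈ U \ s := by rw [e]; simp
    rw [Finset.mem_sdiff] at ha hb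
    have aux : ∀ a, a ∈ U → a ∉ s → insert a s ∈ F := by
      intro a h1 h2
      exact h4 _ (Finset.insert_subset h1 hs) (by rw [Finset.card_insert_of_notMem h2, hc])
    have h1 := (H a).1 ⟨ha.2, aux a ha.1 ha.2⟩
    have h2 := (H b).1 ⟨hb.2, aux b hb.1 hb.2⟩
    have h3 := (H q).1 ⟨hq, hqF⟩
    have : q = a ∨ q = b := by
      rcases h1 with rfl | rfl <;> rcases h2 with rfl | rfl <;> tauto
    rcases this with rfl | rfl
    · exact ha.1
    · exact hb.1
  have step : ∀ k, k ≤ 2 → (∀ s ⊆ U, s.card = k + 1 → ∀ q, q ∉ s → insert q s ∈ F → q ∈ U) →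
      ∀ s ⊆ U, s.card = k → ∀ q, q ∉ s → insert q s ∈ F → q ∈ U := by
    intro k hk ih s hs hc q hq hqF
    obtain ⟨x, hx, hxs⟩ := Finset.exists_mem_notMem_of_card_lt_card (s := s) (t := U) (by omega)
    refine hn.cc s ?_ (by omega) (fun z => z ∈ U) x q hxs hq ?_ hqF ?_ hx
    · by_cases h : s = ∅
      · exact Or.inl h
      · exact Or.inr (hsubF s hs (by omega) h)
    · exact hsubF _ (Finset.insert_subset hx hs)
        (by rw [Finset.card_insert_of_notMem hxs]; omega) (by simp)
    · intro p r hp hr hpU hpr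
      by_cases hrp : r = p
      · rw [hrp]; exact hpU
      · refine ih (insert p s) (Finset.insert_subset hpU hs)
          (by rw [Finset.card_insert_of_notMem hp, hc]) r (by simp [hrp, hr]) ?_
        rw [Finset.insert_comm]; exact hpr
  have l0 := step 0 (by omega) (step 1 (by omega) (step 2 (by omega) l3))
  intro v hv
  exact l0 ∅ (by simp) (by simp) v (by simp) (by simpa using mem_gV.1 hv)

/-- The basic facts used below. -/
structure Setup (K : SComplex) (t h : ℕ) : Prop where
  hK : InClassR K
  hn : NP K.faces
  sph : ∀ x, {x} ∈ K.faces → x ≠ t → K.HasSphereLink 3 x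
  tF : {t} ∈ K.faces
  hh : 1 ≤ h
  hlink : (K.lk {t}).euler = 2 - 2 * (h : ℤ)

namespace Setup

variable {K : SComplex} {t h : ℕ}

theorem no_five (S : Setup K t h) {U : Finset ℕ} (hU : U.card = 5)
    (h4 : ∀ G ⊆ U, G.card = 4 → G ∈ K.faces) : False := by
  classical
  have hV := five_all S.hn hU h4
  have hNV : gN K.faces t ⊆ U.erase t := by
    intro y hy
    rw [mem_gN] at hy
    rw [Finset.mem_erase]
    exact ⟨hy.1, hV (mem_gV.2 (S.hn.down _ hy.2 _ (by simp) (by simp)))⟩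
  have hc := Finset.card_le_card hNV
  rw [Finset.card_erase_of_mem (hV (mem_gV.2 S.tF)), hU] at hc
  have h7 := A7_of S.hn S.hlink
  have hb : ∑ v ∈ gN K.faces t, (gD K.faces t v).card ≤ (gN K.faces t).card * 4 := by
    apply Finset.sum_le_card_nsmul
    intro v hv
    refine le_trans (Finset.card_le_card ?_) hc
    intro z hz
    rw [mem_gD] at hz
    rw [mem_gN]
    exact ⟨hz.2.1, S.hn.down _ hz.2.2.2 _ (by intro a; simp; tauto) (by simp)⟩
  have hpos : 0 < (gN K.faces t).card := by
    obtain ⟨x, hx, hxF⟩ := exists_bigger S.hn (Or.inl S.tF) (by simp)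
    refine Finset.card_pos.2 ⟨x, ?_⟩
    rw [mem_gN]
    exact ⟨by simpa using hx, by rw [Finset.pair_comm]; exact hxF⟩
  have := S.hh
  omega

theorem R1 (S : Setup K t h) {s : Finset ℕ} (hc : s.card = 4) (hs : ∀ z ∈ s, s.erase z ∈ K.faces) :
    s ∈ K.faces := by
  refine S.hK.2.2.2.1 s hc ?_
  intro r hr
  simp only [properFaces, Finset.mem_filter, Finset.mem_powerset] at hr
  obtain ⟨z, hz, hzr⟩ := Finset.exists_of_ssubset (Finset.ssubset_iff_subset_ne.2 ⟨hr.1, hr.2.2⟩)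
  refine K.down_closed _ (hs z hz) _ ?_ hr.2.1
  intro a ha
  rw [Finset.mem_erase]
  exact ⟨fun h => hzr (h ▸ ha), hr.1 ha⟩

/-- Empty triangles in the link are missing faces of `K`. -/
theorem R1' (S : Setup K t h) {w : ℕ} {Δ : Finset ℕ} (hc : Δ.card = 3) (hw : w ∉ Δ)
    (hs : ∀ z ∈ Δ, insert w (Δ.erase z) ∈ K.faces) (hΔ : Δ ∈ K.faces) : insert w Δ ∈ K.faces := by
  apply S.R1
  · rw [Finset.card_insert_of_notMem hw, hc]
  · intro z hz
    rcases Finset.mem_insert.1 hz with rfl | hz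
    · rwa [Finset.erase_insert hw]
    · rw [Finset.erase_insert_of_ne (by rintro rfl; exact hw hz)]
      exact hs z hz

theorem sub_erase {Δ e : Finset ℕ} (hc : Δ.card = 3) (he : e ⊆ Δ) (hec : e.card = 2) :
    ∃ z ∈ Δ, e = Δ.erase z := by
  obtain ⟨z, hz, hze⟩ := Finset.exists_mem_notMem_of_card_lt_card (s := e) (t := Δ) (by omega)
  refine ⟨z, hz, Finset.eq_of_subset_of_card_le ?_ ?_⟩
  · intro a ha
    rw [Finset.mem_erase]
    exact ⟨fun h => hze (h ▸ ha), he ha⟩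
  · rw [Finset.card_erase_of_mem hz]; omega

theorem R2 (S : Setup K t h) {w : ℕ} (hwt : w ≠ t) {Δ : Finset ℕ} (hc : Δ.card = 3) (hw : w ∉ Δ)
    (hs : ∀ z ∈ Δ, insert w (Δ.erase z) ∈ K.faces) : insert w Δ ∈ K.faces := by
  classical
  by_contra hcon
  have hΔ : Δ ∉ K.faces := fun hΔ => hcon (S.R1' hc hw hs hΔ)
  have hpair : ∀ e, e ⊆ Δ → e.card = 2 → insert w e ∈ K.faces := by
    intro e he hec
    obtain ⟨z, hz, rfl⟩ := sub_erase hc he hec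
    exact hs z hz
  obtain ⟨a, b, c, hab, hac, hbc, rfl⟩ := Finset.card_eq_three.1 hc
  have hwF : {w} ∈ K.faces :=
    S.hn.down _ (hs a (by simp)) _ (by simp) (by simp)
  obtain ⟨Φ⟩ := S.sph w hwF hwt
  have hL : ∀ e, e ⊆ ({a, b, c} : Finset ℕ) → e.card = 2 → e ∈ (K.lk {w}).faces := by
    intro e he hec
    rw [mem_lk1]
    exact ⟨by rintro rfl; simp at hec, fun h => hw (he h), hpair e he hec⟩
  obtain ⟨T, hT⟩ := triangle_bounds (K.lk {w}) Φ a b c hab hbc hac.symm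
    (hL _ (by intro z; simp; tauto) (Finset.card_pair hab))
    (hL _ (by intro z; simp; tauto) (Finset.card_pair hbc))
    (hL _ (by intro z; simp; tauto) (Finset.card_pair hac.symm))
  obtain ⟨n, hn1, hn2⟩ := exists_fresh K.faces
  have hsub : ∀ e : Finset ℕ, e.card = 2 → (e ⊆ {a, b, c} ↔ e = {a, b} ∨ e = {b, c} ∨ e = {c, a}) := by
    intro e hec
    constructor
    · intro he
      obtain ⟨z, hz, rfl⟩ := sub_erase hc he hec
      simp only [Finset.mem_insert, Finset.mem_singleton] at hz
      rcases hz with rfl | rfl | rfl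
      · right; left; ext y; simp; grind
      · right; right; ext y; simp; grind
      · left; ext y; simp; grind
    · rintro (rfl | rfl | rfl) <;> (intro z; simp; tauto)
  have key : ∀ e, e.card = 2 → w ∉ e → insert w e ∈ K.faces → ∃ p q, insert p e ≠ insert q e ∧
      (∀ τ, Tri K.faces w τ ∧ e ⊆ τ ↔ τ = insert p e ∨ τ = insert q e) ∧
      ((if insert p e ∈ T then (1 : ZMod 2) else 0) + if insert q e ∈ T then 1 else 0) =
        if e ⊆ {a, b, c} then 1 else 0 := by
    intro e hec hwe heF
    obtain ⟨p, q, hpq, hp, hq, H⟩ := link_two S.hn hec hwe heF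
    have hne : insert p e ≠ insert q e := by
      intro h
      have : p ∈ insert q e := by rw [← h]; simp
      rcases Finset.mem_insert.1 this with h | h
      · exact hpq h
      · exact hp h
    refine ⟨p, q, hne, ?_, ?_⟩
    · intro τ
      have : τ ∈ (K.lk {w}).faces.filter (fun τ => τ.card = 3 ∧ e ⊆ τ) ↔
          τ = insert p e ∨ τ = insert q e := by rw [H]; simp
      rw [← this, Finset.mem_filter, mem_lk1]
      unfold Tri
      constructor
      · rintro ⟨⟨h1, h2, h3⟩, h4⟩
        exact ⟨⟨by rintro rfl; simp at h1, h2, h3⟩, h1, h4⟩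
      · rintro ⟨⟨h1, h2, h3⟩, h4, h5⟩
        exact ⟨⟨h4, h2, h3⟩, h5⟩
    · have h1 := hT e (mem_lk1.2 ⟨by rintro rfl; simp at hec, hwe, heF⟩) hec
      rw [H, Finset.sum_pair hne] at h1
      rw [h1]
      simp only [hsub e hec]
  refine Split.absurd (K := K) (w := w) (Δ := {a, b, c}) (n := n) (col := fun τ => decide (τ ∈ T))
    ⟨S.hn, hc, hΔ, hn1, hn2, ?_, ?_⟩ S.hK
  · intro e τ τ' hec heΔ h1 h2 h3 h4
    obtain ⟨p, q, hne, H, hsum⟩ := key e hec (fun h => h3.2.1 (h1 h))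
      (S.hn.down _ h3.2.2 _ (Finset.insert_subset_insert _ h1) (by simp))
    rw [if_neg heΔ] at hsum
    have e1 := (H τ).1 ⟨h3, h1⟩
    have e2 := (H τ').1 ⟨h4, h2⟩
    have : insert p e ∈ T ↔ insert q e ∈ T := by
      split_ifs at hsum <;> simp_all
    rcases e1 with rfl | rfl <;> rcases e2 with rfl | rfl <;> simp [this]
  · intro e heΔ hec i
    obtain ⟨p, q, hne, H, hsum⟩ := key e hec (fun h => hw (heΔ h)) (hpair e heΔ hec)
    rw [if_pos heΔ] at hsum
    have hp := (H _).2 (Or.inl rfl)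
    have hq := (H _).2 (Or.inr rfl)
    have : insert p e ∈ T ↔ insert q e ∉ T := by
      split_ifs at hsum with u1 u2 u2
      · exact False.elim (by revert hsum; decide)
      · simp [u1, u2]
      · simp [u1, u2]
      · exact False.elim (by revert hsum; decide)
    by_cases hpT : insert p e ∈ T
    · have hqT := this.1 hpT
      cases i
      · exact ⟨_, hq.1, hq.2, by simp [hqT]⟩
      · exact ⟨_, hp.1, hp.2, by simp [hpT]⟩
    · have hqT : insert q e ∈ T := by tauto
      cases i
      · exact ⟨_, hp.1, hp.2, by simp [hpT]⟩
      · exact ⟨_, hq.1, hq.2, by simp [hqT]⟩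

end Setup
end SComplex


namespace SComplex
namespace Setup

variable {K : SComplex} {t h : ℕ}

/-- A degree three edge: the triangle fills on the `x` side. -/
theorem R3_aux (S : Setup K t h) {x y : ℕ} {Δ : Finset ℕ} (hc : Δ.card = 3) (hxy : x ≠ y)
    (hx : x ∉ Δ) (hy : y ∉ Δ) (hD : ∀ z, z ∈ gD K.faces x y ↔ z ∈ Δ)
    (hF : ∀ e ⊆ Δ, e.card = 2 → insert x (insert y e) ∈ K.faces) : insert x Δ ∈ K.faces := by
  classical
  by_contra hcon
  have hpair : ∀ e ⊆ Δ, e.card = 2 → insert x e ∈ K.faces := by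
    intro e he hec
    exact S.hn.down _ (hF e he hec) _ (by intro z; simp; tauto) (by simp)
  have hΔ : Δ ∉ K.faces := by
    intro hΔ
    refine hcon (S.R1' hc hx ?_ hΔ)
    intro z hz
    exact hpair _ (Finset.erase_subset _ _) (by rw [Finset.card_erase_of_mem hz, hc])
  obtain ⟨n, hn1, hn2⟩ := exists_fresh K.faces
  -- triangles of the link through `y` are joins of `y` with an edge of `Δ`
  have htri : ∀ τ, Tri K.faces x τ → y ∈ τ → τ ⊆ insert y Δ := by
    intro τ hτ hyτ z hz
    by_cases hzy : z = y
    · simp [hzy]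
    · refine Finset.mem_insert_of_mem ((hD z).1 (mem_gD.2 ⟨hxy, ?_, hzy, ?_⟩))
      · rintro rfl; exact hτ.2.1 hz
      · refine S.hn.down _ hτ.2.2 _ ?_ (by simp)
        intro a ha
        simp only [Finset.mem_insert, Finset.mem_singleton] at ha ⊢
        rcases ha with rfl | rfl | rfl
        · exact Or.inl rfl
        · exact Or.inr hyτ
        · exact Or.inr hz
  refine Split.absurd (K := K) (w := x) (Δ := Δ) (n := n) (col := fun τ => decide (y ∈ τ))
    ⟨S.hn, hc, hΔ, hn1, hn2, ?_, ?_⟩ S.hK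
  · intro e τ τ' hec heΔ h1 h2 h3 h4
    have aux : ∀ τ, Tri K.faces x τ → e ⊆ τ → y ∈ τ → y ∈ e := by
      intro τ hτ heτ hyτ
      by_contra hye
      apply heΔ
      intro z hz
      rcases Finset.mem_insert.1 (htri τ hτ hyτ (heτ hz)) with rfl | h
      · exact absurd hz hye
      · exact h
    have : y ∈ τ ↔ y ∈ τ' := ⟨fun h => h2 (aux τ h3 h1 h), fun h => h1 (aux τ' h4 h2 h)⟩
    simp [this]
  · intro e heΔ hec i
    have hye : y ∉ e := fun h => hy (heΔ h)
    have hxe : x ∉ e := fun h => hx (heΔ h)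
    have hyT : Tri K.faces x (insert y e) :=
      ⟨by rw [Finset.card_insert_of_notMem hye, hec], by simp [hxy, hxe], hF e heΔ hec⟩
    cases i
    · obtain ⟨p, q, hpq, H⟩ := S.hn.two _ (hpair e heΔ hec)
        (by rw [Finset.card_insert_of_notMem hxe, hec])
      have h1 := (H y).1 ⟨by simp [hxy.symm, hye], by rw [Finset.insert_comm]; exact hF e heΔ hec⟩
      obtain ⟨r, hry, hr⟩ : ∃ r, r ≠ y ∧ (r = p ∨ r = q) := by
        rcases h1 with rfl | rfl
        · exact ⟨q, hpq.symm, Or.inr rfl⟩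
        · exact ⟨p, hpq, Or.inl rfl⟩
      rw [← H] at hr
      simp only [Finset.mem_insert, not_or] at hr
      refine ⟨insert r e, ⟨?_, ?_, ?_⟩, Finset.subset_insert _ _, ?_⟩
      · rw [Finset.card_insert_of_notMem hr.1.2, hec]
      · simp [Ne.symm hr.1.1, hxe]
      · rw [Finset.insert_comm]; exact hr.2
      · simp [hry.symm, hye]
    · exact ⟨insert y e, hyT, Finset.subset_insert _ _, by simp⟩

/-- Five vertex configuration. -/
theorem no_five' (S : Setup K t h) {x y : ℕ} {Δ : Finset ℕ} (hc : Δ.card = 3) (hxy : x ≠ y)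
    (hx : x ∉ Δ) (hy : y ∉ Δ)
    (hF : ∀ e ⊆ Δ, e.card = 2 → insert x (insert y e) ∈ K.faces)
    (h1 : insert x Δ ∈ K.faces) (h2 : insert y Δ ∈ K.faces) : False := by
  classical
  have hU : (insert x (insert y Δ)).card = 5 := by
    rw [Finset.card_insert_of_notMem (by simp [hxy, hx]), Finset.card_insert_of_notMem hy, hc]
  refine S.no_five hU ?_
  intro G hG hGc
  obtain ⟨z, hz, hzG⟩ := Finset.exists_mem_notMem_of_card_lt_card (s := G) (by rw [hU, hGc]; omega)
  have e : G = (insert x (insert y Δ)).erase z := by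
    apply Finset.eq_of_subset_of_card_le
    · intro a ha
      rw [Finset.mem_erase]
      exact ⟨fun h => hzG (h ▸ ha), hG ha⟩
    · rw [Finset.card_erase_of_mem hz]; omega
  rw [e]
  simp only [Finset.mem_insert] at hz
  rcases hz with rfl | rfl | hz
  · rwa [Finset.erase_insert (by simp [hxy, hx])]
  · rw [Finset.erase_insert_of_ne hxy, Finset.erase_insert hy]; exact h1
  · rw [Finset.erase_insert_of_ne (by rintro rfl; exact hx hz),
      Finset.erase_insert_of_ne (by rintro rfl; exact hy hz)]
    exact hF _ (Finset.erase_subset _ _) (by rw [Finset.card_erase_of_mem hz, hc])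

theorem gD_comm (F : Finset (Finset ℕ)) (x y z : ℕ) : z ∈ gD F x y ↔ z ∈ gD F y x := by
  rw [mem_gD, mem_gD]
  have e : ({x, y, z} : Finset ℕ) = {y, x, z} := Finset.insert_comm _ _ _
  rw [e]
  constructor <;> (rintro ⟨h1, h2, h3, h4⟩; exact ⟨h1.symm, h3, h2, h4⟩)

/-- Apexes over a triangle. -/
theorem apex (S : Setup K t h) {x y z : ℕ} (hz : z ∈ gD K.faces x y) :
    ∃ p q, p ≠ q ∧ ∀ w, (w ≠ z ∧ w ∈ gD K.faces x y ∧ insert w {x, y, z} ∈ K.faces) ↔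
      (w = p ∨ w = q) := by
  rw [mem_gD] at hz
  obtain ⟨h1, h2, h3, h4⟩ := hz
  obtain ⟨p, q, hpq, H⟩ := S.hn.two _ h4
    (by rw [Finset.card_eq_three]; exact ⟨x, y, z, h1, h2.symm, h3.symm, rfl⟩)
  refine ⟨p, q, hpq, fun w => ?_⟩
  rw [← H, mem_gD]
  simp only [Finset.mem_insert, Finset.mem_singleton, not_or]
  constructor
  · rintro ⟨a, ⟨b, c, d, e⟩, f⟩
    exact ⟨⟨c, d, a⟩, f⟩
  · rintro ⟨⟨a, b, c⟩, d⟩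
    exact ⟨c, ⟨h1, a, b, S.hn.down _ d _ (by intro v; simp; tauto) (by simp)⟩, d⟩

theorem R3 (S : Setup K t h) {x y : ℕ} (hxy : y ∈ gN K.faces x) : 4 ≤ (gD K.faces x y).card := by
  classical
  by_contra hlt
  rw [mem_gN] at hxy
  obtain ⟨hyx, hE⟩ := hxy
  obtain ⟨z, hz, hzF⟩ := exists_bigger S.hn (Or.inl hE)
    (by rw [Finset.card_pair hyx.symm]; omega)
  have hzD : z ∈ gD K.faces x y := by
    simp only [Finset.mem_insert, Finset.mem_singleton, not_or] at hz
    rw [mem_gD]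
    refine ⟨hyx.symm, hz.1, hz.2, ?_⟩
    have e : ({x, y, z} : Finset ℕ) = insert z {x, y} := by ext a; simp; tauto
    rw [e]; exact hzF
  -- every vertex of the link has two neighbours
  have hadj : ∀ z ∈ gD K.faces x y, ∃ p q, p ≠ q ∧ p ≠ z ∧ q ≠ z ∧ p ∈ gD K.faces x y ∧
      q ∈ gD K.faces x y ∧ insert p {x, y, z} ∈ K.faces ∧ insert q {x, y, z} ∈ K.faces := by
    intro z hz
    obtain ⟨p, q, hpq, H⟩ := S.apex hz
    have hp := (H p).2 (Or.inl rfl)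
    have hq := (H q).2 (Or.inr rfl)
    exact ⟨p, q, hpq, hp.1, hq.1, hp.2.1, hq.2.1, hp.2.2, hq.2.2⟩
  obtain ⟨p, q, h1, h2, h3, h4, h5, h6, h7⟩ := hadj z hzD
  have hsub : ({z, p, q} : Finset ℕ) ⊆ gD K.faces x y := by
    intro a ha
    simp only [Finset.mem_insert, Finset.mem_singleton] at ha
    rcases ha with rfl | rfl | rfl <;> assumption
  have hc3 : ({z, p, q} : Finset ℕ).card = 3 :=
    Finset.card_eq_three.2 ⟨z, p, q, h2.symm, h3.symm, h1, rfl⟩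
  have hDe : ({z, p, q} : Finset ℕ) = gD K.faces x y :=
    Finset.eq_of_subset_of_card_le hsub (by omega)
  set Δ := gD K.faces x y with hΔ
  have hc : Δ.card = 3 := by rw [← hDe]; exact hc3
  have hx : x ∉ Δ := fun h => (mem_gD.1 h).2.1 rfl
  have hy : y ∉ Δ := fun h => (mem_gD.1 h).2.2.1 rfl
  have hF : ∀ e ⊆ Δ, e.card = 2 → insert x (insert y e) ∈ K.faces := by
    intro e he hec
    obtain ⟨a, b, hab, rfl⟩ := Finset.card_eq_two.1 hec
    have ha : a ∈ Δ := he (by simp)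
    have hb : b ∈ Δ := he (by simp)
    obtain ⟨p, q, g1, g2, g3, g4, g5, g6, g7⟩ := hadj a ha
    have hb' : b ∈ ({p, q} : Finset ℕ) := by
      have e2 : ({p, q} : Finset ℕ) = Δ.erase a := by
        apply Finset.eq_of_subset_of_card_le
        · intro v hv
          simp only [Finset.mem_insert, Finset.mem_singleton] at hv
          rw [Finset.mem_erase]
          rcases hv with rfl | rfl
          · exact ⟨g2, g4⟩
          · exact ⟨g3, g5⟩
        · rw [Finset.card_erase_of_mem ha, Finset.card_pair g1]; omega
      rw [e2, Finset.mem_erase]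
      exact ⟨hab.symm, hb⟩
    have e3 : (insert x (insert y {a, b}) : Finset ℕ) = insert b {x, y, a} := by
      ext v; simp; tauto
    rw [e3]
    simp only [Finset.mem_insert, Finset.mem_singleton] at hb'
    rcases hb' with rfl | rfl
    · exact g6
    · exact g7
  have k1 := S.R3_aux hc hyx.symm hx hy (fun _ => Iff.rfl) hF
  have k2 := S.R3_aux hc hyx hy hx (fun z => gD_comm K.faces y x z)
    (fun e he hec => by rw [Finset.insert_comm]; exact hF e he hec)
  exact S.no_five' hc hyx.symm hx hy hF k1 k2

theorem R4 (S : Setup K t h) {x y : ℕ} (hxy : y ∈ gN K.faces x) :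
    ∃ z, z ∈ gN K.faces x ∧ z ∈ gN K.faces y ∧ z ∉ gD K.faces x y := by
  classical
  by_contra hcon
  push Not at hcon
  have hD4 := S.R3 hxy
  rw [mem_gN] at hxy
  obtain ⟨hyx, hE⟩ := hxy
  have s1 : ∀ z, z ≠ x → z ≠ y → ({x, z} : Finset ℕ) ∈ K.faces → ({y, z} : Finset ℕ) ∈ K.faces →
      ({x, y, z} : Finset ℕ) ∈ K.faces := by
    intro z h1 h2 h3 h4
    exact (mem_gD.1 (hcon z (mem_gN.2 ⟨h1, h3⟩) (mem_gN.2 ⟨h2, h4⟩))).2.2.2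
  have s2 : ∀ a b, a ≠ b → a ≠ x → a ≠ y → b ≠ x → b ≠ y → ({x, a, b} : Finset ℕ) ∈ K.faces →
      ({y, a, b} : Finset ℕ) ∈ K.faces → ({x, y, a, b} : Finset ℕ) ∈ K.faces := by
    intro a b h1 h2 h3 h4 h5 h6 h7
    have d : ∀ {s : Finset ℕ}, s ∈ K.faces → ∀ r, r ⊆ s → r ≠ ∅ → r ∈ K.faces :=
      fun hs r => K.down_closed _ hs r
    have p1 := s1 a h2 h3 (d h6 _ (by intro v; simp; tauto) (by simp))
      (d h7 _ (by intro v; simp; tauto) (by simp))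
    have p2 := s1 b h4 h5 (d h6 _ (by intro v; simp; tauto) (by simp))
      (d h7 _ (by intro v; simp; tauto) (by simp))
    apply S.R1
    · rw [Finset.card_insert_of_notMem (by simp [hyx.symm, h2.symm, h4.symm]),
        Finset.card_insert_of_notMem (by simp [h3.symm, h5.symm]), Finset.card_pair h1]
    · intro z hz
      simp only [Finset.mem_insert, Finset.mem_singleton] at hz
      rcases hz with rfl | rfl | rfl | rfl
      · refine d h7 _ (by intro v; simp) (Finset.ne_empty_of_mem (a := y) (by simp [hyx]))
      · refine d h6 _ (by intro v; simp; tauto) (Finset.ne_empty_of_mem (a := x) (by simp [hyx.symm]))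
      · refine d p2 _ (by intro v; simp; tauto) (Finset.ne_empty_of_mem (a := x) (by simp [h2.symm]))
      · refine d p1 _ (by intro v; simp; tauto) (Finset.ne_empty_of_mem (a := x) (by simp [h4.symm]))
  obtain ⟨n, hn1, _⟩ := exists_fresh K.faces
  have C : Con K.faces x y (n true) := by
    refine ⟨S.hn, hyx.symm, hE, ?_, hn1 true⟩
    intro s h0 hxs hys h1 h2
    have hle := S.hn.le4 _ h1
    rw [Finset.card_insert_of_notMem hxs] at hle
    have hpos := Finset.card_pos.2 (Finset.nonempty_iff_ne_empty.2 h0)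
    have t2 : ∀ e : Finset ℕ, e ⊆ s → e.card = 2 → insert x (insert y e) ∈ K.faces := by
      intro e he hec
      obtain ⟨a, b, hab, rfl⟩ := Finset.card_eq_two.1 hec
      have ha : a ∈ s := he (by simp)
      have hb : b ∈ s := he (by simp)
      refine s2 a b hab ?_ ?_ ?_ ?_ (K.down_closed _ h1 _ (Finset.insert_subset_insert _ he) (by simp))
        (K.down_closed _ h2 _ (Finset.insert_subset_insert _ he) (by simp)) <;>
        rintro rfl <;> contradiction
    obtain h | h | h : s.card = 1 ∨ s.card = 2 ∨ s.card = 3 := by omega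
    · obtain ⟨z, rfl⟩ := Finset.card_eq_one.1 h
      exact s1 z (fun h => hxs (by simp [h])) (fun h => hys (by simp [h])) h1 h2
    · exact t2 s (Finset.Subset.refl _) h
    · exact (S.no_five' h hyx.symm hxs hys t2 h1 h2).elim
  refine C.absurd (gD K.faces x y) hD4 ?_ S.hK
  intro z hz
  rw [mem_gD] at hz
  exact ⟨hz.2.1, hz.2.2.1, K.down_closed _ hz.2.2.2 _ (by intro v; simp; tauto) (by simp),
    K.down_closed _ hz.2.2.2 _ (by intro v; simp; tauto) (by simp)⟩

theorem R2' (S : Setup K t h) {w a b c : ℕ} (hwt : w ≠ t) (hab : a ≠ b) (hbc : b ≠ c) (hac : a ≠ c)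
    (ha : w ≠ a) (hb : w ≠ b) (hc : w ≠ c) (h1 : ({w, a, b} : Finset ℕ) ∈ K.faces)
    (h2 : ({w, b, c} : Finset ℕ) ∈ K.faces) (h3 : ({w, a, c} : Finset ℕ) ∈ K.faces) :
    ({w, a, b, c} : Finset ℕ) ∈ K.faces := by
  refine S.R2 hwt (Finset.card_eq_three.2 ⟨a, b, c, hab, hac, hbc, rfl⟩) (by simp [ha, hb, hc]) ?_
  intro z hz
  simp only [Finset.mem_insert, Finset.mem_singleton] at hz
  rcases hz with rfl | rfl | rfl
  · refine K.down_closed _ h2 _ ?_ (by simp)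
    intro v; simp; tauto
  · refine K.down_closed _ h3 _ ?_ (by simp)
    intro v; simp; tauto
  · refine K.down_closed _ h1 _ ?_ (by simp)
    intro v; simp; tauto

theorem comb (S : Setup K t h) : Comb t (gV K.faces) (gN K.faces) (gD K.faces) h := by
  classical
  refine ⟨mem_gV.2 S.tF, ?_, ?_, ?_, ?_, ?_, ?_, ?_, fun x y => S.R3, ?_, fun x y => S.R4, ?_, ?_, ?_,
    A7_of S.hn S.hlink, A8_of S.hn⟩
  · intro x y hy
    rw [mem_gN] at hy
    exact mem_gV.2 (K.down_closed _ hy.2 _ (by simp) (by simp))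
  · intro x hx
    obtain ⟨y, hy, hyF⟩ := exists_bigger S.hn (Or.inl (mem_gV.1 hx)) (by simp)
    exact ⟨y, mem_gN.2 ⟨by simpa using hy, by rw [Finset.pair_comm]; exact hyF⟩⟩
  · intro x y hy
    rw [mem_gN] at hy ⊢
    exact ⟨hy.1.symm, by rw [Finset.pair_comm]; exact hy.2⟩
  · intro x hx
    exact (mem_gN.1 hx).1 rfl
  · intro x y z hz
    rw [mem_gD] at hz
    exact mem_gN.2 ⟨hz.2.1, K.down_closed _ hz.2.2.2 _ (by intro v; simp; tauto) (by simp)⟩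
  · intro x y z hz
    exact (gD_comm _ _ _ _).1 hz
  · intro x y z hz
    rw [mem_gD] at hz ⊢
    refine ⟨hz.2.1.symm, hz.1.symm, hz.2.2.1.symm, ?_⟩
    have e : ({x, z, y} : Finset ℕ) = {x, y, z} := by ext v; simp; tauto
    rw [e]; exact hz.2.2.2
  · intro x y c hxt hc
    obtain ⟨p, q, hpq, H⟩ := S.apex hc
    have : gD K.faces x c ∩ gD K.faces x y = {p, q} := by
      ext w
      rw [Finset.mem_insert, Finset.mem_singleton, ← H, Finset.mem_inter]
      rw [mem_gD] at hc
      constructor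
      · rintro ⟨h1, h2⟩
        have h1' := mem_gD.1 h1
        have h2' := mem_gD.1 h2
        refine ⟨h1'.2.2.1, h2, ?_⟩
        have := S.R2' (a := y) (b := c) (c := w) hxt hc.2.2.1.symm h1'.2.2.1.symm h2'.2.2.1.symm hc.1
          hc.2.1.symm h2'.2.1.symm hc.2.2.2 h1'.2.2.2 h2'.2.2.2
        have e : (insert w {x, y, c} : Finset ℕ) = {x, y, c, w} := by ext v; simp; tauto
        rw [e]; exact this
      · rintro ⟨h1, h2, h3⟩
        have h2' := mem_gD.1 h2
        refine ⟨mem_gD.2 ⟨hc.2.1.symm, h2'.2.1, h1, ?_⟩, h2⟩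
        exact K.down_closed _ h3 _ (by intro v; simp; tauto) (by simp)
    rw [this, Finset.card_pair hpq]
  · intro c x y z hct h1 h2 h3
    rw [mem_gD] at h1 h2 h3 ⊢
    have perm : ∀ a b : ℕ, ({a, b, c} : Finset ℕ) = {c, a, b} := by
      intro a b; ext v; simp; tauto
    rw [perm] at h1 h2 h3
    have := S.R2' (a := x) (b := y) (c := z) hct h1.1 h2.1 h3.1 h1.2.1 h1.2.2.1 h2.2.2.1
      h1.2.2.2 h2.2.2.2 h3.2.2.2
    refine ⟨h1.1, h3.1.symm, h2.1.symm, K.down_closed _ this _ ?_ (by simp)⟩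
    intro v; simp; tauto
  · rintro x T hT ⟨a, ha⟩ hcl y hy
    have haN := mem_gN.1 (hT ha)
    have hyN := mem_gN.1 hy
    refine S.hn.cc {x} (Or.inr (K.down_closed _ haN.2 _ (by simp) (by simp))) (by simp)
      (fun z => z ∈ T) a y (by simpa using haN.1) (by simpa using hyN.1)
      (by rw [Finset.pair_comm]; exact haN.2) (by rw [Finset.pair_comm]; exact hyN.2) ?_ ha
    intro p q hp hq hpT hpq
    by_cases hqp : q = p
    · rw [hqp]; exact hpT
    · refine hcl p hpT (mem_gD.2 ⟨?_, ?_, hqp, ?_⟩)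
      · intro h; exact hp (by simp [h])
      · intro h; exact hq (by simp [h])
      · exact K.down_closed _ hpq _ (by intro v; simp; tauto) (by simp)
  · rintro x y T hT ⟨a, ha⟩ hcl z hz
    have haD := mem_gD.1 (hT ha)
    have hzD := mem_gD.1 hz
    have perm : ∀ c : ℕ, (insert c {x, y} : Finset ℕ) = {x, y, c} := by
      intro c; ext v; simp; tauto
    refine S.hn.cc {x, y} (Or.inr (K.down_closed _ haD.2.2.2 _ ?_ (by simp)))
      (by rw [Finset.card_pair haD.1]) (fun z => z ∈ T) a z ?_ ?_ ?_ ?_ ?_ ha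
    · intro v; simp; tauto
    · simp [haD.2.1, haD.2.2.1]
    · simp [hzD.2.1, hzD.2.2.1]
    · rw [perm]; exact haD.2.2.2
    · rw [perm]; exact hzD.2.2.2
    intro p q hp hq hpT hpq
    by_cases hqp : q = p
    · rw [hqp]; exact hpT
    · simp only [Finset.mem_insert, Finset.mem_singleton, not_or] at hp hq
      refine hcl p hpT (Finset.mem_inter.2 ⟨mem_gD.2 ⟨Ne.symm hp.1, hq.1, hqp, ?_⟩,
        mem_gD.2 ⟨haD.1, hq.1, hq.2, ?_⟩⟩)
      · exact K.down_closed _ hpq _ (by intro v; simp; tauto) (by simp)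
      · exact K.down_closed _ hpq _ (by intro v; simp; tauto) (by simp)

end Setup

theorem statement15 (K : SComplex) (t : ℕ) (h : ℕ) (hK : InClassR K)
    (hsing : {v | K.IsSingular v} = {t})
    (hh : 1 ≤ h)
    (hlink : (K.lk {t}).euler = 2 - 2 * (h : ℤ)) :
    4 * (K.fnum 0 : ℤ) + 6 * (h : ℤ) ≤ (K.fnum 1 : ℤ) ∧
    10 + 6 * (h : ℤ) ≤ K.g2 := by
  have hn := NP_of_normal hK.1
  have htS : K.IsSingular t := by
    have : t ∈ {v | K.IsSingular v} := by rw [hsing]; rfl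
    exact this
  have S : Setup K t h := by
    refine ⟨hK, hn, ?_, htS.1, hh, hlink⟩
    intro x hx hxt
    by_contra hns
    have : x ∈ {v | K.IsSingular v} := ⟨hx, hns⟩
    rw [hsing] at this
    exact hxt this
  have hf := S.comb.final hh
  obtain ⟨h0, h1⟩ := total_counts hn
  rw [h1, ← h0] at hf
  unfold g2
  constructor <;> omega

end SComplex
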